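/- Assume the Riemann Hypothesis and the Strong Pair Correlation Conjecture. Then the Pair Correlation Conjecture holds: for every fixed β > 0, N(T,β) → ∫₀^β (1 − (sin(πu)/(πu))²) du as T → ∞. -/

import Mathlib

open Complex Filter MeasureTheory Real Set

noncomputable section

/-- A non-trivial zero of the Riemann zeta function. -/
def ZetaNontrivZero (ρ : ℂ) : Prop := riemannZeta ρ = 0 ∧ 0 < ρ.re ∧ ρ.re < 1

/-- The multiplicity of `ρ` as a zero of `ζ`. -/
def zetaMult (ρ : ℂ) : ℕ := sInf {n : ℕ | iteratedDeriv n riemannZeta ρ ≠ 0}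

/-- The set of non-trivial zeros with ordinate in `(0, T]`. -/
def zerosUpTo (T : ℝ) : Set ℂ := {ρ | ZetaNontrivZero ρ ∧ 0 < ρ.im ∧ ρ.im ≤ T}

/-- Montgomery's pair correlation function `F(x,T)`, zeros counted with multiplicity. -/
def Fxt (x T : ℝ) : ℂ :=
  ∑' p : zerosUpTo T × zerosUpTo T,
    (zetaMult p.1 * zetaMult p.2 : ℂ) *
      Complex.exp (Complex.I * (((p.1 : ℂ).im - (p.2 : ℂ).im : ℝ) : ℂ) * (Real.log x : ℂ)) *
      ((4 / (4 + ((p.1 : ℂ).im - (p.2 : ℂ).im) ^ 2) : ℝ) : ℂ)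

/-- The normalized form `F(α) = F(α, T)`. -/
def FF (α T : ℝ) : ℂ := ((T / (2 * π) * Real.log T : ℝ) : ℂ)⁻¹ * Fxt (T ^ α) T

/-- The Strong Pair Correlation Conjecture: for every fixed `M ≥ 1`,
`F(α,T) = 1 + o(1)` as `T → ∞`, uniformly for `1 ≤ α ≤ M`. -/
def SPC : Prop :=
  ∀ M : ℝ, 1 ≤ M → ∀ ε : ℝ, 0 < ε → ∃ T₀ : ℝ, ∀ T : ℝ, T₀ ≤ T →
    ∀ α : ℝ, 1 ≤ α → α ≤ M → ‖FF α T - 1‖ ≤ ε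

/-- `N(T,β)`: the normalized number of pairs of ordinates `0 < γ, γ' ≤ T` (with
multiplicity) satisfying `0 < γ' - γ ≤ 2πβ/log T`. -/
def Npair (T β : ℝ) : ℝ :=
  (T / (2 * π) * Real.log T)⁻¹ *
    ∑' p : zerosUpTo T × zerosUpTo T,
      if 0 < (p.2 : ℂ).im - (p.1 : ℂ).im ∧
          (p.2 : ℂ).im - (p.1 : ℂ).im ≤ 2 * π * β / Real.log T
      then (zetaMult p.1 * zetaMult p.2 : ℝ) else 0

namespace PC

lemma entire_order_ne_top {f : ℂ → ℂ} (hf : Differentiable ℂ f) (h0 : ∃ z, f z ≠ 0) (a : ℂ) :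
    analyticOrderAt f a ≠ ⊤ := by
  obtain ⟨z, hz⟩ := h0
  have han : AnalyticOnNhd ℂ f Set.univ := fun x _ => hf.analyticAt x
  refine han.analyticOrderAt_ne_top_of_isPreconnected (x := z) (y := a)
    isPreconnected_univ (Set.mem_univ _) (Set.mem_univ _) ?_
  rw [(han z (Set.mem_univ _)).analyticOrderAt_eq_zero.2 hz]
  simp

lemma entire_factor_one {f : ℂ → ℂ} (hf : Differentiable ℂ f) (h0 : ∃ z, f z ≠ 0) (a : ℂ) :
    ∃ G : ℂ → ℂ, Differentiable ℂ G ∧ (∀ z, f z = (z - a) ^ (analyticOrderNatAt f a) * G z) ∧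
      G a ≠ 0 := by
  classical
  obtain ⟨g, hg, hga, hfg⟩ := (hf.analyticAt a).analyticOrderAt_ne_top.1
    (entire_order_ne_top hf h0 a)
  set n := analyticOrderNatAt f a
  refine ⟨fun z => if z = a then g a else f z / (z - a) ^ n, ?_, ?_, by simpa using hga⟩
  · intro z
    by_cases hz : z = a
    · subst hz
      refine hg.differentiableAt.congr_of_eventuallyEq ?_
      filter_upwards [hfg] with w hw
      by_cases hwz : w = z
      · simp [hwz]
      · have : (w - z) ^ n ≠ 0 := pow_ne_zero _ (sub_ne_zero.2 hwz)
        simp only [hwz, if_false]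
        rw [hw]; simp only [smul_eq_mul]; field_simp
    · have h1 : DifferentiableAt ℂ (fun w => f w / (w - a) ^ n) z := by
        refine (hf z).div (by fun_prop) (pow_ne_zero _ (sub_ne_zero.2 hz))
      refine h1.congr_of_eventuallyEq ?_
      filter_upwards [isOpen_ne.mem_nhds hz] with w hw
      have hw' : w ≠ a := hw
      simp [hw']
  · intro z
    by_cases hz : z = a
    · subst hz
      have := hfg.self_of_nhds
      simpa using this
    · have : (z - a) ^ n ≠ 0 := pow_ne_zero _ (sub_ne_zero.2 hz)
      simp only [hz, if_false]; field_simp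

lemma entire_factor {f : ℂ → ℂ} (hf : Differentiable ℂ f) (h0 : ∃ z, f z ≠ 0) (S : Finset ℂ) :
    ∃ G : ℂ → ℂ, Differentiable ℂ G ∧
      (∀ z, f z = (∏ a ∈ S, (z - a) ^ (analyticOrderNatAt f a)) * G z) ∧
      ∀ a ∈ S, G a ≠ 0 := by
  classical
  induction S using Finset.induction_on with
  | empty => exact ⟨f, hf, by simp, by simp⟩
  | insert a S ha ih =>
    obtain ⟨G, hG, hfG, hGS⟩ := ih
    have hG0 : ∃ z, G z ≠ 0 := by
      obtain ⟨z, hz⟩ := h0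
      refine ⟨z, fun h => hz ?_⟩
      rw [hfG, h, mul_zero]
    obtain ⟨H, hH, hGH, hHa⟩ := entire_factor_one hG hG0 a
    set p : ℂ → ℂ := fun z => ∏ b ∈ S, (z - b) ^ (analyticOrderNatAt f b) with hp
    have hpd : Differentiable ℂ p := by
      rw [hp]; fun_prop
    have hpa : p a ≠ 0 := by
      refine Finset.prod_ne_zero_iff.2 fun b hb => pow_ne_zero _ (sub_ne_zero.2 ?_)
      rintro rfl; exact ha hb
    have hord : analyticOrderNatAt f a = analyticOrderNatAt G a := by
      have e : f = p * G := by ext z; exact hfG z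
      have h1 := analyticOrderAt_mul (hpd.analyticAt a) (hG.analyticAt a)
      rw [← e, (hpd.analyticAt a).analyticOrderAt_eq_zero.2 hpa, zero_add] at h1
      simp [analyticOrderNatAt, h1]
    refine ⟨H, hH, fun z => ?_, ?_⟩
    · rw [Finset.prod_insert ha, hfG, hGH, hord]
      ring
    · intro b hb
      rcases Finset.mem_insert.1 hb with rfl | hb
      · exact hHa
      · intro h
        apply hGS b hb
        rw [hGH, h, mul_zero]

/-- finite set of zeros in a closed ball -/
lemma entire_zeros_finite {f : ℂ → ℂ} (hf : Differentiable ℂ f) (h0 : ∃ z, f z ≠ 0) (R : ℝ) :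
    (Metric.closedBall (0:ℂ) R ∩ {z | f z = 0}).Finite := by
  obtain ⟨z, hz⟩ := h0
  have han : AnalyticOnNhd ℂ f Set.univ := fun x _ => hf.analyticAt x
  by_contra hinf
  have hinf : (Metric.closedBall (0:ℂ) R ∩ {z | f z = 0}).Infinite := hinf
  obtain ⟨x, -, hx⟩ := hinf.exists_accPt_of_subset_isCompact (isCompact_closedBall (0:ℂ) R)
    Set.inter_subset_left
  have h3 : ∃ᶠ y in nhdsWithin x {x}ᶜ, f y = 0 := by
    rw [accPt_iff_frequently] at hx
    rw [frequently_nhdsWithin_iff]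
    exact hx.mono fun y hy => ⟨hy.2.2, hy.1⟩
  have h4 := han.eqOn_zero_of_preconnected_of_frequently_eq_zero isPreconnected_univ
    (Set.mem_univ x) h3
  exact hz (h4 (Set.mem_univ z))

end PC

namespace PC

lemma G_bound {f G : ℂ → ℂ} (hG : Differentiable ℂ G)
    {R M : ℝ} (hR : 0 < R) (hf0 : f 0 ≠ 0)
    (hM : ∀ s, ‖s‖ ≤ 4 * R → ‖f s‖ ≤ ‖f 0‖ * Real.exp M) (S : Finset ℂ) (m : ℂ → ℕ)
    (hS : ∀ a ∈ S, ‖a‖ ≤ R)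
    (hfG : ∀ z, f z = (∏ a ∈ S, (z - a) ^ (m a)) * G z) :
    ∀ s, ‖s‖ ≤ 4 * R → ‖G s‖ ≤ ‖G 0‖ * Real.exp M / 3 ^ (∑ a ∈ S, m a) := by
  set p : ℂ → ℂ := fun z => ∏ a ∈ S, (z - a) ^ (m a) with hp
  have hp0 : p 0 ≠ 0 := by
    intro h; apply hf0; rw [hfG]; simp only [hp] at h; rw [h, zero_mul]
  have hps : ∀ s : ℂ, ‖s‖ = 4 * R → 3 ^ (∑ a ∈ S, m a) * ‖p 0‖ ≤ ‖p s‖ := by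
    intro s hs
    simp only [hp, norm_prod, ← Finset.prod_pow_eq_pow_sum, ← Finset.prod_mul_distrib, norm_pow,
      ← mul_pow]
    refine Finset.prod_le_prod (fun _ _ => by positivity) fun a ha => ?_
    refine pow_le_pow_left₀ (by positivity) ?_ _
    have h1 := hS a ha
    have h2 := norm_sub_norm_le s a
    simp only [zero_sub, norm_neg]
    linarith
  intro s hs
  have hs' : s ∈ closure (Metric.ball (0:ℂ) (4 * R)) := by
    rw [closure_ball _ (by positivity)]; simpa using hs
  refine Complex.norm_le_of_forall_mem_frontier_norm_le Metric.isBounded_ball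
    hG.diffContOnCl ?_ hs'
  intro z hz
  rw [frontier_ball _ (by positivity)] at hz
  have hz : ‖z‖ = 4 * R := by simpa using hz
  have h1 := hM z hz.le
  have h2 := hps z hz
  rw [hfG z, hfG 0, norm_mul, norm_mul] at h1
  change ‖p z‖ * _ ≤ ‖p 0‖ * _ * _ at h1
  have hp0' : 0 < ‖p 0‖ := norm_pos_iff.2 hp0
  have h3 : (0:ℝ) < 3 ^ (∑ a ∈ S, m a) := by positivity
  rw [le_div_iff₀ h3]
  have h4 : 3 ^ (∑ a ∈ S, m a) * ‖p 0‖ * ‖G z‖ ≤ ‖p 0‖ * ‖G 0‖ * Real.exp M :=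
    (mul_le_mul_of_nonneg_right h2 (norm_nonneg _)).trans h1
  have h5 : ‖p 0‖ * (‖G z‖ * 3 ^ (∑ a ∈ S, m a)) ≤ ‖p 0‖ * (‖G 0‖ * Real.exp M) := by
    linarith
  exact le_of_mul_le_mul_left h5 hp0'

/-- Bound for the difference of logarithmic derivatives of a zero-free function. -/
lemma logDeriv_diff_bound {G : ℂ → ℂ} (hG : Differentiable ℂ G) {R M : ℝ} (hR : 0 < R)
    (hM0 : 0 < M) (hGz : ∀ s, ‖s‖ < R → G s ≠ 0)
    (hGM : ∀ s, ‖s‖ < R → ‖G s‖ ≤ ‖G 0‖ * Real.exp M) :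
    ∀ s₁ s₂, ‖s₁‖ ≤ R / 8 → ‖s₂‖ ≤ R / 8 →
      ‖logDeriv G s₁ - logDeriv G s₂‖ ≤ 64 * M / R ^ 2 * ‖s₁ - s₂‖ := by
  have hdG : Differentiable ℂ (deriv G) := by
    intro z; exact (hG.analyticAt z).deriv.differentiableAt
  have hG0 : G 0 ≠ 0 := hGz 0 (by simpa)
  have hld : DifferentiableOn ℂ (logDeriv G) (Metric.ball 0 R) := by
    intro z hz
    have hz : ‖z‖ < R := by simpa using hz
    exact ((hdG z).div (hG z) (hGz z hz)).differentiableWithinAt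
  obtain ⟨g, hg0, hg⟩ := hld.isExactOn_ball.with_val_at 0 0
  have hexp : ∀ z ∈ Metric.ball (0:ℂ) R, G z * Complex.exp (-g z) = G 0 := by
    intro z hz
    have hd : ∀ x ∈ Metric.ball (0:ℂ) R,
        HasDerivAt (fun w => G w * Complex.exp (-g w)) 0 x := by
      intro x hx
      have h1 := (hG x).hasDerivAt.mul ((hg x hx).neg.cexp)
      have hx' : ‖x‖ < R := by simpa using hx
      refine h1.congr_deriv ?_
      have := hGz x hx'
      rw [logDeriv_apply]
      field_simp
      ring
    have h2 := (convex_ball (0:ℂ) R).norm_image_sub_le_of_norm_hasDerivWithin_le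
      (f := fun w => G w * Complex.exp (-g w)) (f' := fun _ => 0) (C := 0) (x := 0) (y := z)
      (fun x hx => (hd x hx).hasDerivWithinAt) (fun x hx => by simp) (by simpa using hR) hz
    simp only [zero_mul, norm_le_zero_iff, sub_eq_zero] at h2
    rw [h2, hg0]; simp
  have hre : MapsTo g (Metric.ball 0 R) {z | z.re ≤ M} := by
    intro z hz
    have h1 := hexp z hz
    have hz' : ‖z‖ < R := by simpa using hz
    have h2 : G z = G 0 * Complex.exp (g z) := by
      rw [← h1, mul_assoc, ← Complex.exp_add]; simp
    have h3 := hGM z hz'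
    rw [h2, norm_mul, Complex.norm_exp] at h3
    have h4 := le_of_mul_le_mul_left h3 (norm_pos_iff.2 hG0)
    exact Real.exp_le_exp.1 h4
  have hgd : DifferentiableOn ℂ g (Metric.ball 0 R) := fun z hz =>
    (hg z hz).differentiableAt.differentiableWithinAt
  have hbc : ∀ z, ‖z‖ ≤ R / 2 → ‖g z‖ ≤ 2 * M := by
    intro z hz
    have h := Complex.borelCaratheodory_zero hM0 hgd hre hR
      (show z ∈ Metric.ball 0 R by simp; linarith) hg0
    refine h.trans ?_
    rw [div_le_iff₀ (by linarith)]
    nlinarith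
  have hderiv : ∀ z ∈ Metric.ball (0:ℂ) R, deriv g z = logDeriv G z := fun z hz => (hg z hz).deriv
  have h1 : ∀ z, ‖z‖ ≤ R / 4 → ‖logDeriv G z‖ ≤ 2 * M / (R / 4) := by
    intro z hz
    rw [← hderiv z (by simp; linarith)]
    refine Complex.norm_deriv_le_of_forall_mem_sphere_norm_le (by positivity) ?_ ?_
    · refine DifferentiableOn.diffContOnCl (hgd.mono ?_)
      rw [closure_ball _ (by positivity)]
      intro w hw
      have hw : ‖w - z‖ ≤ R / 4 := by simpa [dist_eq_norm] using hw
      have := norm_sub_norm_le w z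
      simp; linarith
    · intro w hw
      have hw : ‖w - z‖ = R / 4 := by simpa [dist_eq_norm] using hw
      have := norm_sub_norm_le w z
      exact hbc w (by linarith)
  have h2 : ∀ z, ‖z‖ ≤ R / 8 → ‖deriv (logDeriv G) z‖ ≤ 64 * M / R ^ 2 := by
    intro z hz
    have : 64 * M / R ^ 2 = (2 * M / (R / 4)) / (R / 8) := by field_simp; norm_num
    rw [this]
    refine Complex.norm_deriv_le_of_forall_mem_sphere_norm_le (by positivity) ?_ ?_
    · refine DifferentiableOn.diffContOnCl (hld.mono ?_)
      rw [closure_ball _ (by positivity)]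
      intro w hw
      have hw : ‖w - z‖ ≤ R / 8 := by simpa [dist_eq_norm] using hw
      have := norm_sub_norm_le w z
      simp; linarith
    · intro w hw
      have hw : ‖w - z‖ = R / 8 := by simpa [dist_eq_norm] using hw
      have := norm_sub_norm_le w z
      exact h1 w (by linarith)
  intro s₁ s₂ hs₁ hs₂
  refine (convex_closedBall (0:ℂ) (R/8)).norm_image_sub_le_of_norm_deriv_le (𝕜 := ℂ)
    (f := logDeriv G) (x := s₂) (y := s₁) ?_ ?_ (by simpa using hs₂) (by simpa using hs₁)
  · intro x hx
    have hx : ‖x‖ ≤ R / 8 := by simpa using hx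
    exact (hld x (by simp; linarith)).differentiableAt
      (Metric.isOpen_ball.mem_nhds (by simp; linarith))
  · intro x hx
    exact h2 x (by simpa using hx)

lemma hadamard_finite {f : ℂ → ℂ} (hf : Differentiable ℂ f) {R M : ℝ} (hR : 0 < R) (hM0 : 0 < M)
    (hf0 : f 0 ≠ 0) (hM : ∀ s, ‖s‖ ≤ 4 * R → ‖f s‖ ≤ ‖f 0‖ * Real.exp M) (S : Finset ℂ)
    (hS : ∀ a, a ∈ S ↔ ‖a‖ ≤ R ∧ f a = 0) :
    ((∑ a ∈ S, analyticOrderNatAt f a : ℕ) : ℝ) ≤ M ∧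
    ∀ s₁ s₂, ‖s₁‖ ≤ R / 8 → ‖s₂‖ ≤ R / 8 → f s₁ ≠ 0 → f s₂ ≠ 0 →
      ‖logDeriv f s₁ - logDeriv f s₂ -
        ∑ a ∈ S, (analyticOrderNatAt f a : ℂ) * (1 / (s₁ - a) - 1 / (s₂ - a))‖
        ≤ 64 * M / R ^ 2 * ‖s₁ - s₂‖ := by
  obtain ⟨G, hG, hfG, hGS⟩ := entire_factor hf ⟨0, hf0⟩ S
  have hGb := G_bound hG hR hf0 hM S _ (fun a ha => ((hS a).1 ha).1) hfG
  have hG0 : G 0 ≠ 0 := by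
    intro h; apply hf0; rw [hfG, h, mul_zero]
  have hG0' : 0 < ‖G 0‖ := norm_pos_iff.2 hG0
  constructor
  · have h1 := hGb 0 (by simp; linarith)
    set n := ∑ a ∈ S, analyticOrderNatAt f a
    rw [le_div_iff₀ (by positivity)] at h1
    have h2 : (3:ℝ) ^ n ≤ Real.exp M := le_of_mul_le_mul_left h1 hG0'
    have h3 : Real.exp n ≤ (3:ℝ) ^ n := by
      rw [← Real.exp_one_pow]
      exact pow_le_pow_left₀ (by positivity) (Real.exp_one_lt_three.le) _
    exact Real.exp_le_exp.1 (h3.trans h2)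
  · intro s₁ s₂ hs₁ hs₂ h1 h2
    have hlog : ∀ s, f s ≠ 0 → logDeriv f s =
        ∑ a ∈ S, (analyticOrderNatAt f a : ℂ) * (1 / (s - a)) + logDeriv G s := by
      intro s hs
      have e : f = fun z => (∏ a ∈ S, (z - a) ^ (analyticOrderNatAt f a)) * G z := by
        ext z; exact hfG z
      have hs' := hs
      rw [hfG] at hs'
      have hp := left_ne_zero_of_mul hs'
      have hg := right_ne_zero_of_mul hs'
      conv_lhs => rw [e]
      rw [logDeriv_mul s hp hg (by fun_prop) (hG s)]
      congr 1
      rw [logDeriv_prod (fun a ha => Finset.prod_ne_zero_iff.1 hp a ha) (fun a ha => by fun_prop)]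
      refine Finset.sum_congr rfl fun a ha => ?_
      rw [logDeriv_fun_pow (by fun_prop)]
      simp [logDeriv_apply]
    rw [hlog s₁ h1, hlog s₂ h2]
    have := logDeriv_diff_bound hG hR hM0 (fun s hs hgs => ?_) (fun s hs => ?_) s₁ s₂ hs₁ hs₂
    · convert this using 2
      simp only [mul_sub, Finset.sum_sub_distrib]
      ring
    · by_cases hsS : s ∈ S
      · exact hGS s hsS hgs
      · exact hsS ((hS s).2 ⟨hs.le, by rw [hfG, hgs, mul_zero]⟩)
    · refine (hGb s (by linarith)).trans (div_le_self (by positivity) ?_)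
      exact one_le_pow₀ (by norm_num)
end PC

namespace PC

/-- multiplicity function of an entire function -/
lemma ord_eq_zero {f : ℂ → ℂ} {a : ℂ} (h : f a ≠ 0) : analyticOrderNatAt f a = 0 := by
  by_contra hc
  exact h (apply_eq_zero_of_analyticOrderNatAt_ne_zero hc)

lemma ord_summable {f : ℂ → ℂ} (hf : Differentiable ℂ f) {C : ℝ} (hC : 0 < C)
    (hf0 : f 0 ≠ 0) (hM : ∀ R : ℝ, 1 ≤ R → ∀ s, ‖s‖ ≤ 4 * R →
      ‖f s‖ ≤ ‖f 0‖ * Real.exp (C * R ^ (3/2:ℝ))) :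
    Summable (fun a : ℂ => (analyticOrderNatAt f a : ℝ) * (1 / (1 + ‖a‖) ^ 2)) := by
  classical
  set m : ℂ → ℕ := fun a => analyticOrderNatAt f a with hm
  have hcount : ∀ R : ℝ, 1 ≤ R → ∀ u : Finset ℂ,
      (∑ a ∈ u with ‖a‖ ≤ R, (m a : ℝ)) ≤ C * R ^ (3/2:ℝ) := by
    intro R hR u
    set S := (entire_zeros_finite hf ⟨0, hf0⟩ R).toFinset with hSdef
    have hS : ∀ a, a ∈ S ↔ ‖a‖ ≤ R ∧ f a = 0 := by
      intro a; simp [hSdef]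
    have h1 := (hadamard_finite hf (by linarith) (by positivity) hf0 (hM R hR) S hS).1
    push_cast at h1
    refine le_trans ?_ h1
    have : (∑ a ∈ u with ‖a‖ ≤ R, (m a : ℝ)) = ∑ a ∈ u with (‖a‖ ≤ R ∧ f a = 0), (m a : ℝ) := by
      rw [← Finset.filter_filter]
      symm
      apply Finset.sum_filter_of_ne
      intro x _ hx
      by_contra h
      exact hx (by simp [hm, ord_eq_zero h])
    rw [this]
    refine Finset.sum_le_sum_of_subset_of_nonneg ?_ (fun _ _ _ => by positivity)
    intro a ha
    exact (hS a).2 (Finset.mem_filter.1 ha).2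
  refine summable_of_sum_le (c := 12 * C) (fun a => by positivity) fun u => ?_
  have hk : ∀ a : ℂ, ∃ k : ℕ, (2:ℝ) ^ k ≤ 1 + ‖a‖ ∧ 1 + ‖a‖ < 2 ^ (k + 1) := fun a =>
    exists_nat_pow_near (by linarith [norm_nonneg a]) (by norm_num)
  choose k hk1 hk2 using hk
  set K := u.sup k + 1
  have hterm : ∀ a ∈ u, (m a : ℝ) * (1 / (1 + ‖a‖) ^ 2) ≤
      ∑ j ∈ Finset.range K, if ‖a‖ ≤ 2 ^ (j + 1) then (m a : ℝ) * (1 / 4) ^ j else 0 := by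
    intro a ha
    have h1 : k a ∈ Finset.range K := by
      have := Finset.le_sup (f := k) ha
      simp only [K, Finset.mem_range]; omega
    refine le_trans ?_ (Finset.single_le_sum
      (f := fun j => if ‖a‖ ≤ 2 ^ (j + 1) then (m a : ℝ) * (1 / 4) ^ j else 0) ?_ h1)
    · have h2 : ‖a‖ ≤ 2 ^ (k a + 1) := by linarith [hk2 a]
      simp only [h2, if_true]
      gcongr
      have h3 : (4:ℝ) ^ k a ≤ (1 + ‖a‖) ^ 2 := by
        have : (4:ℝ) ^ k a = (2 ^ k a) ^ 2 := by rw [← pow_mul, mul_comm, pow_mul]; norm_num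
        rw [this]
        exact pow_le_pow_left₀ (by positivity) (hk1 a) 2
      rw [one_div_pow]
      exact one_div_le_one_div_of_le (by positivity) h3
    · intro j _
      split_ifs <;> positivity
  refine (Finset.sum_le_sum hterm).trans ?_
  rw [Finset.sum_comm]
  have h2 : ∀ j ∈ Finset.range K, (∑ a ∈ u, if ‖a‖ ≤ 2 ^ (j + 1) then (m a : ℝ) * (1 / 4) ^ j else 0)
      ≤ 3 * C * (3 / 4) ^ j := by
    intro j _
    rw [← Finset.sum_filter, ← Finset.sum_mul]
    have h3 := hcount (2 ^ (j+1)) (one_le_pow₀ (by norm_num)) u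
    have h4 : ((2:ℝ) ^ (j+1)) ^ (3/2:ℝ) ≤ 3 ^ (j+1) := by
      have e1 : ((2:ℝ) ^ (j+1)) ^ (3/2:ℝ) = ((2:ℝ) ^ (3/2:ℝ)) ^ (j+1) := by
        rw [← Real.rpow_natCast, ← Real.rpow_mul (by norm_num), mul_comm, Real.rpow_mul (by norm_num),
          Real.rpow_natCast]
      rw [e1]
      refine pow_le_pow_left₀ (by positivity) ?_ _
      have e2 : ((2:ℝ) ^ (3/2:ℝ)) ^ 2 = 8 := by
        rw [← Real.rpow_natCast, ← Real.rpow_mul (by norm_num)]; norm_num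
      nlinarith [Real.rpow_nonneg (show (0:ℝ) ≤ 2 by norm_num) (3/2)]
    calc _ ≤ (C * 3 ^ (j+1)) * (1/4) ^ j := by
            refine mul_le_mul_of_nonneg_right (h3.trans ?_) (by positivity)
            gcongr
      _ = 3 * C * (3/4) ^ j := by
            rw [pow_succ, div_pow, div_pow]; ring
  refine (Finset.sum_le_sum h2).trans ?_
  rw [← Finset.mul_sum]
  have h5 : ∑ i ∈ Finset.range K, ((3:ℝ)/4) ^ i ≤ 4 := by
    have := (summable_geometric_of_lt_one (by norm_num : (0:ℝ) ≤ 3/4) (by norm_num)).sum_le_tsum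
      (Finset.range K) (fun _ _ => by positivity)
    rw [tsum_geometric_of_lt_one (by norm_num) (by norm_num)] at this
    norm_num at this ⊢
    linarith
  nlinarith

lemma ord_diff_summable {m : ℂ → ℕ}
    (hm : Summable (fun a : ℂ => (m a : ℝ) * (1 / (1 + ‖a‖) ^ 2)))
    (hfin : ∀ R : ℝ, (Metric.closedBall (0:ℂ) R ∩ {a | m a ≠ 0}).Finite) (s₁ s₂ : ℂ) :
    Summable (fun a : ℂ => (m a : ℂ) * (1 / (s₁ - a) - 1 / (s₂ - a))) := by
  refine Summable.of_norm_bounded_eventually (g := fun a : ℂ =>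
    (4 * ‖s₂ - s₁‖) * ((m a : ℝ) * (1 / (1 + ‖a‖) ^ 2))) (hm.mul_left _) ?_
  set B := 2 * ‖s₁‖ + 2 * ‖s₂‖ + 1 with hB
  rw [Filter.eventually_cofinite]
  refine (hfin B).subset ?_
  intro a ha
  simp only [mem_setOf_eq, not_le] at ha
  have hma : m a ≠ 0 := by
    intro h; simp [h] at ha
  refine ⟨?_, hma⟩
  by_contra hnb
  have hnb : B < ‖a‖ := by simpa using hnb
  have g1 : (1 + ‖a‖) / 2 ≤ ‖s₁ - a‖ := by
    have := norm_sub_norm_le a s₁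
    rw [norm_sub_rev] at this
    nlinarith [norm_nonneg s₁, norm_nonneg s₂]
  have g2 : (1 + ‖a‖) / 2 ≤ ‖s₂ - a‖ := by
    have := norm_sub_norm_le a s₂
    rw [norm_sub_rev] at this
    nlinarith [norm_nonneg s₁, norm_nonneg s₂]
  have hp : 0 < (1 + ‖a‖) / 2 := by positivity
  have n1 : s₁ - a ≠ 0 := norm_pos_iff.1 (by linarith)
  have n2 : s₂ - a ≠ 0 := norm_pos_iff.1 (by linarith)
  refine absurd ha (not_lt.2 ?_)
  have e : 1 / (s₁ - a) - 1 / (s₂ - a) = (s₂ - s₁) / ((s₁ - a) * (s₂ - a)) := by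
    field_simp; ring
  rw [e, norm_mul, norm_div, norm_mul, Complex.norm_natCast]
  have h3 : (1 + ‖a‖) / 2 * ((1 + ‖a‖) / 2) ≤ ‖s₁ - a‖ * ‖s₂ - a‖ :=
    mul_le_mul g1 g2 hp.le (norm_nonneg _)
  have h4 : ‖s₂ - s₁‖ / (‖s₁ - a‖ * ‖s₂ - a‖) ≤ ‖s₂ - s₁‖ / ((1 + ‖a‖) / 2 * ((1 + ‖a‖) / 2)) :=
    div_le_div_of_nonneg_left (norm_nonneg _) (by positivity) h3
  calc _ ≤ (m a : ℝ) * (‖s₂ - s₁‖ / ((1 + ‖a‖) / 2 * ((1 + ‖a‖) / 2))) := by gcongr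
    _ = _ := by field_simp; ring

lemma hadamard_hasSum {f : ℂ → ℂ} (hf : Differentiable ℂ f) {C : ℝ} (hC : 0 < C)
    (hf0 : f 0 ≠ 0) (hM : ∀ R : ℝ, 1 ≤ R → ∀ s, ‖s‖ ≤ 4 * R →
      ‖f s‖ ≤ ‖f 0‖ * Real.exp (C * R ^ (3/2:ℝ))) {s₁ s₂ : ℂ} (h1 : f s₁ ≠ 0) (h2 : f s₂ ≠ 0) :
    HasSum (fun a : ℂ => (analyticOrderNatAt f a : ℂ) * (1 / (s₁ - a) - 1 / (s₂ - a)))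
      (logDeriv f s₁ - logDeriv f s₂) := by
  classical
  set F := fun a : ℂ => (analyticOrderNatAt f a : ℂ) * (1 / (s₁ - a) - 1 / (s₂ - a)) with hF
  have hfin : ∀ R : ℝ, (Metric.closedBall (0:ℂ) R ∩ {a | analyticOrderNatAt f a ≠ 0}).Finite := by
    intro R
    refine (entire_zeros_finite hf ⟨0, hf0⟩ R).subset ?_
    rintro a ⟨ha, ha2⟩
    exact ⟨ha, apply_eq_zero_of_analyticOrderNatAt_ne_zero ha2⟩
  have hsum : Summable F := ord_diff_summable (ord_summable hf hC hf0 hM) hfin s₁ s₂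
  have hlim : Tendsto (fun n : ℕ => ∑' a, if ‖a‖ ≤ (n:ℝ) then F a else 0) atTop (nhds (∑' a, F a)) := by
    refine tendsto_tsum_of_dominated_convergence (bound := fun a => ‖F a‖) hsum.norm ?_ ?_
    · intro a
      refine tendsto_const_nhds.congr' ?_
      filter_upwards [eventually_ge_atTop ⌈‖a‖⌉₊] with n hn
      have : ‖a‖ ≤ n := Nat.ceil_le.1 hn
      simp [this]
    · refine Eventually.of_forall fun n a => ?_
      split_ifs
      · exact le_rfl
      · simp
  have hlim2 : Tendsto (fun n : ℕ => ∑' a, if ‖a‖ ≤ (n:ℝ) then F a else 0) atTop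
      (nhds (logDeriv f s₁ - logDeriv f s₂)) := by
    rw [tendsto_iff_norm_sub_tendsto_zero]
    have hb : Tendsto (fun n : ℕ => 64 * C * ‖s₁ - s₂‖ * (n:ℝ) ^ (-(1/2):ℝ)) atTop (nhds 0) := by
      have := ((tendsto_rpow_neg_atTop (show (0:ℝ) < 1/2 by norm_num)).comp
        tendsto_natCast_atTop_atTop).const_mul (64 * C * ‖s₁ - s₂‖)
      simpa using this
    refine squeeze_zero' (Eventually.of_forall fun _ => norm_nonneg _) ?_ hb
    filter_upwards [eventually_ge_atTop (max 1 (max ⌈8 * ‖s₁‖⌉₊ ⌈8 * ‖s₂‖⌉₊))] with n hn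
    have hn1 : (1:ℝ) ≤ n := by exact_mod_cast (le_max_left _ _).trans hn
    have hn2 : 8 * ‖s₁‖ ≤ n := Nat.ceil_le.1 ((le_max_left _ _).trans ((le_max_right _ _).trans hn))
    have hn3 : 8 * ‖s₂‖ ≤ n := Nat.ceil_le.1 ((le_max_right _ _).trans ((le_max_right _ _).trans hn))
    set S := (entire_zeros_finite hf ⟨0, hf0⟩ n).toFinset with hSdef
    have hS : ∀ a, a ∈ S ↔ ‖a‖ ≤ n ∧ f a = 0 := by
      intro a; simp [hSdef]
    have key := (hadamard_finite hf (by linarith) (by positivity) hf0 (hM n hn1) S hS).2 s₁ s₂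
      (by linarith) (by linarith) h1 h2
    have e : (∑' a, if ‖a‖ ≤ (n:ℝ) then F a else 0) = ∑ a ∈ S, F a := by
      rw [tsum_eq_sum (s := S)]
      · refine Finset.sum_congr rfl fun a ha => ?_
        simp [((hS a).1 ha).1]
      · intro a ha
        split_ifs with h
        · have : f a ≠ 0 := fun hfa => ha ((hS a).2 ⟨h, hfa⟩)
          simp [hF, ord_eq_zero this]
        · rfl
    rw [e, norm_sub_rev]
    refine key.trans (le_of_eq ?_)
    have hnp : (0:ℝ) < n := by linarith
    have e3 : (n:ℝ) ^ (3/2:ℝ) / (n:ℝ) ^ 2 = (n:ℝ) ^ (-(1/2):ℝ) := by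
      rw [← Real.rpow_natCast, ← Real.rpow_sub hnp]; norm_num
    rw [← e3]; ring
  have := tendsto_nhds_unique hlim hlim2
  rw [← this]
  exact hsum.hasSum
end PC

namespace PC

def fr : ℝ → ℂ := (Ioi (1:ℝ)).indicator (fun t => ((Int.fract t : ℝ) : ℂ))

lemma fr_norm_le (t : ℝ) : ‖fr t‖ ≤ 1 := by
  unfold fr
  refine (norm_indicator_le_norm_self _ _).trans ?_
  rw [Complex.norm_real, Real.norm_eq_abs, abs_of_nonneg (Int.fract_nonneg t)]
  exact (Int.fract_lt_one t).le

lemma fr_measurable : Measurable fr := by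
  unfold fr
  refine Measurable.indicator ?_ measurableSet_Ioi
  exact Complex.measurable_ofReal.comp measurable_fract

lemma mellin_fr_diff {s : ℂ} (hs : 0 < s.re) : DifferentiableAt ℂ (fun z => mellin fr (-z)) s := by
  have h : DifferentiableAt ℂ (mellin fr) (-s) := by
    refine mellin_differentiableAt_of_isBigO_rpow (a := 0) (b := -s.re - 1) ?_ ?_ (by simpa) ?_
      (by simp)
    · refine LocallyIntegrable.locallyIntegrableOn ?_ _
      refine (locallyIntegrable_const (1:ℝ)).mono fr_measurable.aestronglyMeasurable ?_
      exact Eventually.of_forall fun x => by simpa using fr_norm_le x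
    · refine Asymptotics.IsBigO.of_bound 1 (Eventually.of_forall fun x => ?_)
      simpa using fr_norm_le x
    · refine Asymptotics.IsBigO.of_bound 1 ?_
      have : Iio (1:ℝ) ∈ nhdsWithin 0 (Ioi (0:ℝ)) :=
        mem_nhdsWithin_of_mem_nhds (Iio_mem_nhds (by norm_num))
      filter_upwards [this] with x hx
      have : fr x = 0 := by
        unfold fr; rw [indicator_of_notMem]; simp; exact (le_of_lt hx)
      rw [this]; simp
  exact h.comp s (differentiableAt_id.neg)

lemma mellin_fr_eq (s : ℂ) : mellin fr (-s) =
    ∫ t in Ioi (1:ℝ), (t:ℂ) ^ (-s - 1) * ((Int.fract t : ℝ) : ℂ) := by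
  unfold mellin fr
  have : ∀ t : ℝ, (t:ℂ) ^ (-s-1) • (Ioi (1:ℝ)).indicator (fun t => ((Int.fract t : ℝ) : ℂ)) t =
      (Ioi (1:ℝ)).indicator (fun t : ℝ => (t:ℂ) ^ (-s-1) * ((Int.fract t : ℝ) : ℂ)) t := by
    intro t
    by_cases h : t ∈ Ioi (1:ℝ) <;> simp [h]
  simp_rw [this]
  rw [setIntegral_indicator measurableSet_Ioi]
  congr 2
  ext x; simp

lemma zeta1_eq_of_one_lt {s : ℂ} (hs : 1 < s.re) :
    riemannZeta₁ s = s - s * (s - 1) * mellin fr (-s) := by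
  have hs1 : s ≠ 1 := by rintro rfl; simp at hs
  have h1 : riemannZeta s = s * ∫ t in Set.Ioi (1 : ℝ),
      (∑ k ∈ Finset.Icc 1 ⌊t⌋₊, (1 : ℕ → ℂ) k) * (t:ℂ) ^ (-(s + 1)) := by
    rw [← LSeries_one_eq_riemannZeta hs]
    refine LSeries_eq_mul_integral' 1 (r := 1) (by norm_num) hs ?_
    refine Asymptotics.IsBigO.of_bound 1 (Eventually.of_forall fun n => ?_)
    simp
  have hne : s - 1 ≠ 0 := sub_ne_zero.2 hs1
  have hint1 : IntegrableOn (fun t : ℝ => (t:ℂ) ^ (-s)) (Ioi 1) :=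
    integrableOn_Ioi_cpow_of_lt (by simpa using hs) (by norm_num)
  have hval1 : ∫ t in Ioi (1:ℝ), (t:ℂ) ^ (-s) = 1 / (s - 1) := by
    rw [integral_Ioi_cpow_of_lt (by simpa using hs) (by norm_num)]
    simp
    rw [neg_div, ← one_div, ← one_div_neg_eq_neg_one_div]
    congr 1; ring
  have hint2 : IntegrableOn (fun t : ℝ => (t:ℂ) ^ (-s - 1) * ((Int.fract t : ℝ) : ℂ)) (Ioi 1) := by
    refine Integrable.mul_bdd (c := 1) (f := fun t : ℝ => (t:ℂ) ^ (-s-1)) (g := fun t : ℝ => ((Int.fract t : ℝ) : ℂ)) ?_ ?_ ?_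
    · exact integrableOn_Ioi_cpow_of_lt (by simp; linarith) (by norm_num)
    · exact (Complex.measurable_ofReal.comp measurable_fract).aestronglyMeasurable
    · refine Eventually.of_forall fun t => ?_
      rw [Complex.norm_real, Real.norm_eq_abs, abs_of_nonneg (Int.fract_nonneg t)]
      exact (Int.fract_lt_one t).le
  have h2 : ∫ t in Set.Ioi (1 : ℝ),
      (∑ k ∈ Finset.Icc 1 ⌊t⌋₊, (1 : ℕ → ℂ) k) * (t:ℂ) ^ (-(s + 1)) =
      1 / (s - 1) - mellin fr (-s) := by
    rw [mellin_fr_eq, ← hval1, ← integral_sub hint1 hint2]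
    refine setIntegral_congr_fun measurableSet_Ioi fun t ht => ?_
    have ht : (1:ℝ) < t := ht
    have ht0 : (t:ℂ) ≠ 0 := by exact_mod_cast (by linarith : t ≠ 0)
    have e1 : (∑ k ∈ Finset.Icc 1 ⌊t⌋₊, (1 : ℕ → ℂ) k) = (t:ℂ) - ((Int.fract t : ℝ) : ℂ) := by
      simp
      have : ((⌊t⌋₊ : ℝ)) = t - Int.fract t := by
        rw [natCast_floor_eq_intCast_floor (by linarith)]
        exact (Int.self_sub_fract t).symm
      exact_mod_cast congrArg (fun x : ℝ => (x:ℂ)) this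
    have e2 : (t:ℂ) ^ (-s) = t * (t:ℂ) ^ (-s - 1) := by
      rw [Complex.cpow_sub _ _ ht0]; simp; field_simp
    rw [e1, e2, show -(s+1) = -s - 1 by ring]; ring
  rw [h2] at h1
  have h3 := riemannZeta_eq_inv_sub_mul hs1
  have h4 : riemannZeta₁ s = (s - 1) * riemannZeta s := by rw [h3]; field_simp
  rw [h4, h1]; field_simp

lemma zeta1_eq {s : ℂ} (hs : 0 < s.re) :
    riemannZeta₁ s = s - s * (s - 1) * mellin fr (-s) := by
  set U : Set ℂ := {z | 0 < z.re} with hU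
  have hUo : IsOpen U := isOpen_lt continuous_const Complex.continuous_re
  have hUc : IsPreconnected U := (convex_halfSpace_re_gt 0).isPreconnected
  have h1 : AnalyticOnNhd ℂ riemannZeta₁ U := fun z _ => differentiable_riemannZeta₁.analyticAt z
  have h2 : AnalyticOnNhd ℂ (fun s => s - s * (s - 1) * mellin fr (-s)) U := by
    refine DifferentiableOn.analyticOnNhd ?_ hUo
    intro z hz
    refine DifferentiableAt.differentiableWithinAt ?_
    have := mellin_fr_diff hz
    fun_prop
  refine h1.eqOn_of_preconnected_of_eventuallyEq h2 hUc (z₀ := 2) (by simp [hU]) ?_ hs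
  have : {z : ℂ | 1 < z.re} ∈ nhds (2:ℂ) :=
    (isOpen_lt continuous_const Complex.continuous_re).mem_nhds (by simp)
  filter_upwards [this] with z hz
  exact zeta1_eq_of_one_lt hz

lemma zeta1_norm_le {s : ℂ} (hs : 1/2 ≤ s.re) :
    ‖riemannZeta₁ s‖ ≤ ‖s‖ + 2 * (‖s‖ * ‖s - 1‖) := by
  have hI : ‖mellin fr (-s)‖ ≤ 2 := by
    rw [mellin_fr_eq]
    have hi : IntegrableOn (fun t : ℝ => t ^ (-(3/2):ℝ)) (Ioi 1) :=
      integrableOn_Ioi_rpow_of_lt (by norm_num) (by norm_num)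
    have hv : ∫ t in Ioi (1:ℝ), t ^ (-(3/2):ℝ) = 2 := by
      rw [integral_Ioi_rpow_of_lt (by norm_num) (by norm_num)]; norm_num
    rw [← hv]
    refine norm_integral_le_of_norm_le hi ?_
    filter_upwards [ae_restrict_mem measurableSet_Ioi] with t ht
    have ht : (1:ℝ) < t := ht
    rw [norm_mul, Complex.norm_cpow_eq_rpow_re_of_pos (by linarith), Complex.norm_real,
      Real.norm_eq_abs, abs_of_nonneg (Int.fract_nonneg t)]
    calc _ ≤ t ^ (-s - 1).re * 1 := by
          gcongr
          exact (Int.fract_lt_one t).le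
      _ ≤ _ := by
          rw [mul_one]
          exact Real.rpow_le_rpow_of_exponent_le ht.le (by simp; linarith)
  rw [zeta1_eq (by linarith)]
  refine (norm_sub_le _ _).trans ?_
  rw [norm_mul, norm_mul]
  nlinarith [mul_nonneg (norm_nonneg s) (norm_nonneg (s-1))]

lemma norm_Gamma_le {s : ℂ} (hs : 0 < s.re) : ‖Complex.Gamma s‖ ≤ Real.Gamma s.re := by
  rw [Complex.Gamma_eq_integral hs, Complex.GammaIntegral, Real.Gamma_eq_integral hs]
  refine norm_integral_le_of_norm_le (Real.GammaIntegral_convergent hs) ?_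
  filter_upwards [ae_restrict_mem measurableSet_Ioi] with t ht
  rw [norm_mul, Complex.norm_cpow_eq_rpow_re_of_pos ht, Complex.norm_real]
  simp

lemma real_Gamma_le {σ : ℝ} (hs : 1/2 ≤ σ) :
    Real.Gamma σ ≤ 4 / 3 * Real.exp (2 * (σ + 2) ^ (3/2:ℝ)) := by
  have h1 : Real.Gamma (σ + 1 + 1) = (σ + 1) * (σ * Real.Gamma σ) := by
    rw [Real.Gamma_add_one (by linarith), Real.Gamma_add_one (by linarith)]
  have hpos : 0 < Real.Gamma σ := Real.Gamma_pos_of_pos (by linarith)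
  have h2 : Real.Gamma σ ≤ 4/3 * Real.Gamma (σ + 1 + 1) := by
    rw [h1]
    have : 3/4 ≤ (σ+1) * σ := by nlinarith
    nlinarith
  refine h2.trans ?_
  gcongr
  set N := ⌈σ⌉₊ + 1 with hN
  have hσN : σ ≤ ⌈σ⌉₊ := Nat.le_ceil σ
  have hNσ : (N:ℝ) ≤ σ + 2 := by
    have := (Nat.ceil_lt_add_one (by linarith : 0 ≤ σ)).le
    push_cast [hN]; linarith
  have hN1 : (1:ℝ) ≤ N := by push_cast [hN]; linarith [(Nat.cast_nonneg ⌈σ⌉₊ : (0:ℝ) ≤ _)]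
  have h3 : Real.Gamma (σ + 1 + 1) ≤ (N.factorial : ℝ) := by
    rw [← Real.Gamma_nat_eq_factorial]
    refine Real.Gamma_strictMonoOn_Ici.monotoneOn ?_ ?_ ?_
    · simp; linarith
    · simp; linarith
    · push_cast [hN]; linarith
  refine h3.trans ?_
  have h4 : (N.factorial : ℝ) ≤ (N:ℝ) ^ N := by exact_mod_cast Nat.factorial_le_pow N
  refine h4.trans ?_
  have h5 : (N:ℝ) ^ N = Real.exp (N * Real.log N) := by
    rw [mul_comm, Real.exp_mul, Real.exp_log (by linarith), Real.rpow_natCast]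
  rw [h5]
  refine Real.exp_le_exp.2 ?_
  have h6 : Real.log N ≤ 2 * (N:ℝ) ^ (1/2:ℝ) := by
    have := Real.log_le_rpow_div (x := N) (by linarith) (ε := 1/2) (by norm_num)
    linarith
  calc (N:ℝ) * Real.log N ≤ N * (2 * (N:ℝ) ^ (1/2:ℝ)) := by gcongr
    _ = 2 * (N:ℝ) ^ (3/2:ℝ) := by
      rw [show (3/2:ℝ) = 1 + 1/2 by norm_num, Real.rpow_add (by linarith), Real.rpow_one]; ring
    _ ≤ _ := by gcongr

end PC

namespace PC

lemma zeta1_ne_one {s : ℂ} (hs : s ≠ 1) : riemannZeta₁ s = (s - 1) * riemannZeta s := by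
  rw [riemannZeta_eq_inv_sub_mul hs]
  have : s - 1 ≠ 0 := sub_ne_zero.2 hs
  field_simp

lemma rpow32_ge {r : ℝ} (hr : 1 ≤ r) : r ≤ r ^ (3/2:ℝ) := by
  nth_rewrite 1 [← Real.rpow_one r]
  exact Real.rpow_le_rpow_of_exponent_le hr (by norm_num)

lemma norm_cos_le (z : ℂ) : ‖Complex.cos z‖ ≤ Real.exp ‖z‖ := by
  rw [Complex.cos]
  rw [norm_div]
  have h1 : ‖Complex.exp (z * I)‖ ≤ Real.exp ‖z‖ := by
    refine (Complex.norm_exp_le_exp_norm _).trans (le_of_eq ?_); simp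
  have h2 : ‖Complex.exp (-z * I)‖ ≤ Real.exp ‖z‖ := by
    refine (Complex.norm_exp_le_exp_norm _).trans (le_of_eq ?_); simp
  have := norm_add_le (Complex.exp (z * I)) (Complex.exp (-z * I))
  simp only [Complex.norm_ofNat]
  linarith

lemma zeta1_growth_aux {w : ℂ} (hw : 4 ≤ ‖w‖) :
    ‖riemannZeta₁ w‖ ≤ Real.exp (30 * ‖w‖ ^ (3/2:ℝ)) := by
  set r := ‖w‖ with hr
  have hrr : r ≤ r ^ (3/2:ℝ) := rpow32_ge (by linarith)
  have hre : r ≤ Real.exp r := by linarith [Real.add_one_le_exp r]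
  have hr1 : ‖w - 1‖ ≤ 2 * r := by
    have := norm_sub_le w 1
    rw [norm_one] at this; linarith
  have h2e : (2:ℝ) ≤ Real.exp r := by linarith [Real.add_one_le_exp r]
  by_cases hre2 : 1/2 ≤ w.re
  · have h := zeta1_norm_le hre2
    have : ‖riemannZeta₁ w‖ ≤ 5 * r * r := by nlinarith
    have h5 : (5:ℝ) ≤ Real.exp r := by linarith [Real.add_one_le_exp r]
    calc _ ≤ 5 * r * r := this
      _ ≤ Real.exp r * Real.exp r * Real.exp r := by gcongr
      _ = Real.exp (3 * r) := by rw [← Real.exp_add, ← Real.exp_add]; ring_nf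
      _ ≤ _ := Real.exp_le_exp.2 (by nlinarith)
  · push Not at hre2
    set s := 1 - w with hs
    have hws : w = 1 - s := by rw [hs]; ring
    have hsre : 1/2 ≤ s.re := by simp [hs]; linarith
    have hs1 : s ≠ 1 := by
      intro h
      have : w = 0 := by rw [hws, h]; ring
      rw [hr, this] at hw; norm_num at hw
    have hw1 : w ≠ 1 := by
      rintro h; rw [h] at hre2; norm_num at hre2
    have hsn : ‖s‖ ≤ 2 * r := by rw [hs, norm_sub_rev]; exact hr1
    have hs1n : ‖s - 1‖ = r := by rw [hs, hr, ← norm_neg]; congr 1; ring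
    have hfe := riemannZeta_one_sub (s := s) (fun n h => by
      have := congrArg Complex.re h
      simp at this
      have h0 : (0:ℝ) ≤ n := n.cast_nonneg
      linarith) hs1
    rw [zeta1_ne_one hw1, hws, hfe, ← hws]
    have hz : ‖riemannZeta s‖ ≤ 6 * r := by
      have h := zeta1_norm_le hsre
      rw [zeta1_ne_one hs1, norm_mul, hs1n] at h
      have h' : r * ‖riemannZeta s‖ ≤ r * (6 * r) := by nlinarith
      exact le_of_mul_le_mul_left h' (by linarith)
    have hσ : s.re ≤ r + 1 := by
      have := Complex.re_le_norm s
      have h2 := norm_sub_le 1 w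
      rw [norm_one] at h2; linarith
    have hG : ‖Complex.Gamma s‖ ≤ 4/3 * Real.exp (6 * r ^ (3/2:ℝ)) := by
      refine (norm_Gamma_le (by linarith)).trans ((real_Gamma_le hsre).trans ?_)
      refine mul_le_mul_of_nonneg_left (Real.exp_le_exp.2 ?_) (by norm_num)
      have h1 : (s.re + 2) ^ (3/2:ℝ) ≤ (2 * r) ^ (3/2:ℝ) := by
        refine Real.rpow_le_rpow (by linarith) (by linarith) (by norm_num)
      rw [Real.mul_rpow (by norm_num) (by linarith)] at h1
      have e2 : ((2:ℝ) ^ (3/2:ℝ)) ^ 2 = 8 := by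
        rw [← Real.rpow_natCast, ← Real.rpow_mul (by norm_num)]; norm_num
      have e3 : (2:ℝ) ^ (3/2:ℝ) ≤ 3 := by
        nlinarith [Real.rpow_nonneg (show (0:ℝ) ≤ 2 by norm_num) (3/2)]
      nlinarith [Real.rpow_nonneg (show (0:ℝ) ≤ r by linarith) (3/2)]
    have hp : ‖(2 * (π:ℂ)) ^ (-s)‖ ≤ 1 := by
      have : (2 * (π:ℂ)) = ((2 * π : ℝ) : ℂ) := by push_cast; rfl
      rw [this, Complex.norm_cpow_eq_rpow_re_of_pos (by positivity)]
      refine Real.rpow_le_one_of_one_le_of_nonpos (by linarith [Real.pi_gt_three]) (by simp; linarith)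
    have hc : ‖Complex.cos (π * s / 2)‖ ≤ Real.exp (4 * r) := by
      refine (norm_cos_le _).trans (Real.exp_le_exp.2 ?_)
      rw [norm_div, norm_mul, Complex.norm_real, Real.norm_eq_abs, abs_of_pos Real.pi_pos]
      simp only [Complex.norm_ofNat]
      nlinarith [Real.pi_lt_four, Real.pi_pos, norm_nonneg s]
    simp only [norm_mul, Complex.norm_ofNat]
    calc ‖w - 1‖ * (2 * ‖(2 * (π:ℂ)) ^ (-s)‖ * ‖Complex.Gamma s‖ * ‖Complex.cos (π * s / 2)‖ * ‖riemannZeta s‖)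
        ≤ (2 * r) * (2 * 1 * (4/3 * Real.exp (6 * r ^ (3/2:ℝ))) * Real.exp (4 * r) * (6 * r)) := by
          gcongr
      _ = 32 * r * r * (Real.exp (6 * r ^ (3/2:ℝ)) * Real.exp (4 * r)) := by ring
      _ ≤ (Real.exp r * Real.exp r * Real.exp r * Real.exp r * Real.exp r) * Real.exp r * Real.exp r * (Real.exp (6 * r ^ (3/2:ℝ)) * Real.exp (4 * r)) := by
          gcongr
          have : (32:ℝ) = 2 * 2 * 2 * 2 * 2 := by norm_num
          rw [this]
          gcongr
      _ = Real.exp (6 * r ^ (3/2:ℝ) + 11 * r) := by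
          simp only [← Real.exp_add]; congr 1; ring
      _ ≤ _ := Real.exp_le_exp.2 (by linarith)

lemma zeta1_zero : riemannZeta₁ 0 = 1/2 := by
  rw [zeta1_ne_one (by norm_num), riemannZeta_zero]; norm_num

lemma zeta1_zero_ne : riemannZeta₁ 0 ≠ 0 := by rw [zeta1_zero]; norm_num

lemma zeta1_growth : ∀ R : ℝ, 1 ≤ R → ∀ s, ‖s‖ ≤ 4 * R →
      ‖riemannZeta₁ s‖ ≤ ‖riemannZeta₁ 0‖ * Real.exp (241 * R ^ (3/2:ℝ)) := by
  intro R hR s hs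
  have hs' : s ∈ closure (Metric.ball (0:ℂ) (4 * R)) := by
    rw [closure_ball _ (by positivity)]; simpa using hs
  refine Complex.norm_le_of_forall_mem_frontier_norm_le Metric.isBounded_ball
    differentiable_riemannZeta₁.diffContOnCl ?_ hs'
  intro z hz
  rw [frontier_ball _ (by positivity)] at hz
  have hz : ‖z‖ = 4 * R := by simpa using hz
  have h := zeta1_growth_aux (w := z) (by linarith)
  rw [hz, Real.mul_rpow (by norm_num) (by linarith)] at h
  have e : (4:ℝ) ^ (3/2:ℝ) = 8 := by
    rw [show (4:ℝ) = 2 ^ (2:ℝ) by norm_num, ← Real.rpow_mul (by norm_num)]; norm_num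
  rw [e] at h
  refine h.trans ?_
  rw [zeta1_zero]
  have h1 : (1:ℝ) ≤ R ^ (3/2:ℝ) := hR.trans (rpow32_ge hR)
  have h2 : (2:ℝ) ≤ Real.exp (R ^ (3/2:ℝ)) := by
    linarith [Real.add_one_le_exp (R ^ (3/2:ℝ))]
  have h3 : Real.exp (241 * R ^ (3/2:ℝ)) = Real.exp (30 * (8 * R ^ (3/2:ℝ))) * Real.exp (R ^ (3/2:ℝ)) := by
    rw [← Real.exp_add]; congr 1; ring
  rw [h3]
  have h4 : ‖(1/2:ℂ)‖ = 1/2 := by norm_num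
  rw [h4]
  nlinarith [Real.exp_pos (30 * (8 * R ^ (3/2:ℝ)))]

/-- multiplicity of zeros -/
def mm (a : ℂ) : ℕ := analyticOrderNatAt riemannZeta₁ a

lemma mm_summable : Summable (fun a : ℂ => (mm a : ℝ) * (1 / (1 + ‖a‖) ^ 2)) :=
  ord_summable differentiable_riemannZeta₁ (by norm_num) zeta1_zero_ne zeta1_growth

lemma mm_hasSum {s₁ s₂ : ℂ} (h1 : riemannZeta₁ s₁ ≠ 0) (h2 : riemannZeta₁ s₂ ≠ 0) :
    HasSum (fun a : ℂ => (mm a : ℂ) * (1 / (s₁ - a) - 1 / (s₂ - a)))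
      (logDeriv riemannZeta₁ s₁ - logDeriv riemannZeta₁ s₂) :=
  hadamard_hasSum differentiable_riemannZeta₁ (by norm_num) zeta1_zero_ne zeta1_growth h1 h2

lemma mm_fin (R : ℝ) : (Metric.closedBall (0:ℂ) R ∩ {a | mm a ≠ 0}).Finite := by
  refine (entire_zeros_finite differentiable_riemannZeta₁ ⟨0, zeta1_zero_ne⟩ R).subset ?_
  rintro a ⟨ha, ha2⟩
  exact ⟨ha, apply_eq_zero_of_analyticOrderNatAt_ne_zero ha2⟩

lemma mm_ne_zero_iff {a : ℂ} : mm a ≠ 0 ↔ riemannZeta₁ a = 0 := by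
  constructor
  · exact apply_eq_zero_of_analyticOrderNatAt_ne_zero
  · intro h
    have h1 := entire_order_ne_top differentiable_riemannZeta₁ ⟨0, zeta1_zero_ne⟩ a
    have h2 := ((differentiable_riemannZeta₁.analyticAt a).analyticOrderAt_ne_zero).2 h
    intro h3
    apply h2
    rw [← Nat.cast_analyticOrderNatAt h1]
    simpa [mm] using h3

lemma mm_ne_zero_iff' {a : ℂ} : mm a ≠ 0 ↔ a ≠ 1 ∧ riemannZeta a = 0 := by
  rw [mm_ne_zero_iff]
  by_cases h : a = 1
  · subst h; simp
  · rw [zeta1_ne_one h]; simp [sub_ne_zero.2 h, h]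

/-- agreement with the frozen multiplicity -/
lemma zetaMult_eq {a : ℂ} (ha : a ≠ 1) : zetaMult a = mm a := by
  have han : AnalyticAt ℂ riemannZeta a := by
    refine DifferentiableOn.analyticAt (s := {1}ᶜ) ?_ (isOpen_ne.mem_nhds ha)
    intro z hz
    exact (differentiableAt_riemannZeta hz).differentiableWithinAt
  have hev : riemannZeta₁ =ᶠ[nhds a] (fun z => z - 1) * riemannZeta := by
    filter_upwards [isOpen_ne.mem_nhds ha] with z hz
    exact zeta1_ne_one hz
  have h1 : analyticOrderAt riemannZeta₁ a = analyticOrderAt riemannZeta a := by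
    rw [analyticOrderAt_congr hev, analyticOrderAt_mul (by fun_prop) han]
    have h0 : AnalyticAt ℂ (fun z : ℂ => z - 1) a := by fun_prop
    rw [h0.analyticOrderAt_eq_zero.2 (sub_ne_zero.2 ha), zero_add]
  have htop := entire_order_ne_top differentiable_riemannZeta₁ ⟨0, zeta1_zero_ne⟩ a
  have h2 : analyticOrderAt riemannZeta a = (mm a : ℕ∞) := by
    rw [← h1, mm, Nat.cast_analyticOrderNatAt htop]
  have h3 : ∀ n : ℕ, (n : ℕ∞) ≤ analyticOrderAt riemannZeta a ↔
      ∀ i < n, iteratedDeriv i riemannZeta a = 0 := fun n =>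
    natCast_le_analyticOrderAt_iff_iteratedDeriv_eq_zero han
  unfold zetaMult
  have hA := (h3 (mm a)).1 (by rw [h2])
  have hB : iteratedDeriv (mm a) riemannZeta a ≠ 0 := by
    intro h
    have : ((mm a + 1 : ℕ) : ℕ∞) ≤ analyticOrderAt riemannZeta a := by
      rw [h3]
      intro i hi
      rcases Nat.lt_succ_iff_lt_or_eq.1 hi with h' | h'
      · exact hA i h'
      · rw [h']; exact h
    rw [h2] at this
    have := Nat.cast_le.1 this
    omega
  refine le_antisymm (Nat.sInf_le hB) ?_
  refine le_csInf ⟨_, hB⟩ ?_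
  intro n hn
  by_contra hlt
  exact hn (hA n (by omega))
end PC

namespace PC

lemma tendsto_deriv_of_bounded {h : ℕ → ℂ → ℂ} {g : ℂ → ℂ} {c : ℂ} {r B : ℝ} (hr : 0 < r)
    (hd : ∀ᶠ n in atTop, DifferentiableOn ℂ (h n) (Metric.closedBall c r))
    (hgd : DifferentiableOn ℂ g (Metric.closedBall c r))
    (hB : ∀ᶠ n in atTop, ∀ z ∈ Metric.sphere c r, ‖h n z‖ ≤ B)
    (hlim : ∀ z ∈ Metric.sphere c r, Tendsto (fun n => h n z) atTop (nhds (g z))) :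
    Tendsto (fun n => deriv (h n) c) atTop (nhds (deriv g c)) := by
  have key : ∀ f : ℂ → ℂ, DifferentiableOn ℂ f (Metric.closedBall c r) →
      deriv f c = (2 * (π:ℂ) * I : ℂ)⁻¹ • ∮ z in C(c, r), (z - c) ^ (-2:ℤ) • f z := by
    intro f hf
    have h1 := DifferentiableOn.deriv_eq_smul_circleIntegral hr hf
    have e : (fun z : ℂ => (z - c) ^ (-2:ℤ) • f z) = fun z => (1 / (z - c) ^ 2) • f z := by
      ext z; rw [zpow_neg, one_div]; rfl
    rw [e, h1, smul_smul, inv_mul_cancel₀ Complex.two_pi_I_ne_zero, one_smul]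
  rw [key g hgd]
  have e : (fun n => deriv (h n) c) =ᶠ[atTop]
      fun n => (2 * (π:ℂ) * I : ℂ)⁻¹ • ∮ z in C(c, r), (z - c) ^ (-2:ℤ) • h n z := by
    filter_upwards [hd] with n hn
    exact key _ hn
  refine Tendsto.congr' e.symm (Tendsto.const_smul ?_ _)
  unfold circleIntegral
  have hcm : ∀ θ, circleMap c r θ ∈ Metric.sphere c r := fun θ => circleMap_mem_sphere c hr.le θ
  have hnz : ∀ θ, ‖circleMap c r θ - c‖ = r := fun θ => by
    have := hcm θ; simpa [dist_eq_norm] using this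
  refine intervalIntegral.tendsto_integral_filter_of_dominated_convergence
    (fun _ => r * (r ^ (-2:ℤ) * B)) ?_ ?_ (by simp) ?_
  · filter_upwards [hd] with n hn
    refine Continuous.aestronglyMeasurable ?_
    have h1 : Continuous (fun θ => h n (circleMap c r θ)) :=
      hn.continuousOn.comp_continuous (continuous_circleMap c r)
        (fun θ => Metric.sphere_subset_closedBall (hcm θ))
    have h2 : Continuous (fun θ => (circleMap c r θ - c) ^ (-2:ℤ)) := by
      refine Continuous.zpow₀ ((continuous_circleMap c r).sub continuous_const) _ fun θ => ?_
      left; intro h0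
      change circleMap c r θ - c = 0 at h0
      have := hnz θ; rw [h0] at this; simp at this; linarith
    have h3 : Continuous (deriv (circleMap c r)) := by
      have : deriv (circleMap c r) = fun θ => circleMap 0 r θ * I := by
        ext θ; exact deriv_circleMap c r θ
      rw [this]; exact (continuous_circleMap 0 r).mul continuous_const
    exact h3.smul (h2.smul h1)
  · filter_upwards [hB] with n hn
    refine Eventually.of_forall fun θ _ => ?_
    rw [norm_smul, norm_smul, norm_zpow, hnz θ, deriv_circleMap]
    have : ‖circleMap 0 r θ * I‖ = r := by simp [abs_of_pos hr]
    rw [this]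
    gcongr
    exact hn _ (hcm θ)
  · refine Eventually.of_forall fun θ _ => ?_
    exact ((hlim _ (hcm θ)).const_smul _).const_smul _

lemma real_GammaSeq_le {x : ℝ} (hx : 0 < x) {n : ℕ} (hn : n ≠ 0) :
    (n : ℝ) ^ x * n.factorial / ∏ j ∈ Finset.range (n + 1), (x + j) ≤ Real.Gamma x := by
  have h := Real.BohrMollerup.ge_logGammaSeq (f := Real.log ∘ Real.Gamma) (x := x) (n := n)
    Real.convexOn_log_Gamma (fun {y} hy => by
      simp only [Function.comp]
      rw [Real.Gamma_add_one hy.ne', Real.log_mul hy.ne' (Real.Gamma_pos_of_pos hy).ne', add_comm])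
    hx hn
  simp only [Function.comp, Real.Gamma_one, Real.log_one, zero_add] at h
  have hn0 : (0:ℝ) < n := by exact_mod_cast Nat.pos_of_ne_zero hn
  have hp : 0 < ∏ j ∈ Finset.range (n + 1), (x + j) := Finset.prod_pos fun j _ => by positivity
  have hpos : 0 < (n : ℝ) ^ x * n.factorial / ∏ j ∈ Finset.range (n + 1), (x + j) := by positivity
  refine (Real.log_le_log_iff hpos (Real.Gamma_pos_of_pos hx)).1 (le_trans (le_of_eq ?_) h)
  unfold Real.BohrMollerup.logGammaSeq
  rw [Real.log_div (by positivity) hp.ne', Real.log_mul (by positivity) (by positivity),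
    Real.log_rpow hn0, Real.log_prod (fun j _ => by positivity)]

lemma GammaSeq_norm_le {s : ℂ} (hs : 0 < s.re) {n : ℕ} (hn : n ≠ 0) :
    ‖Complex.GammaSeq s n‖ ≤ Real.Gamma s.re := by
  refine le_trans ?_ (real_GammaSeq_le hs hn)
  have hn0 : (0:ℝ) < n := by exact_mod_cast Nat.pos_of_ne_zero hn
  unfold Complex.GammaSeq
  rw [norm_div, norm_mul, norm_prod, Complex.norm_natCast]
  have : ‖(n:ℂ) ^ s‖ = (n:ℝ) ^ s.re := by
    rw [← Complex.ofReal_natCast, Complex.norm_cpow_eq_rpow_re_of_pos hn0]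
  rw [this]
  refine div_le_div_of_nonneg_left (by positivity) (Finset.prod_pos fun j _ => by positivity) ?_
  refine Finset.prod_le_prod (fun j _ => by positivity) fun j _ => ?_
  have := Complex.re_le_norm (s + j)
  simpa using this

lemma add_nat_ne {s : ℂ} (hs : 0 < s.re) (j : ℕ) : s + j ≠ 0 := by
  intro h
  have := congrArg Complex.re h
  simp at this
  have h0 : (0:ℝ) ≤ j := j.cast_nonneg
  linarith

lemma GammaSeq_hasDeriv {s : ℂ} (hs : 0 < s.re) {n : ℕ} (hn : n ≠ 0) :
    DifferentiableAt ℂ (fun z => Complex.GammaSeq z n) s ∧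
    logDeriv (fun z => Complex.GammaSeq z n) s =
      Real.log n - ∑ j ∈ Finset.range (n + 1), 1 / (s + j) := by
  have hnc : (n:ℂ) ≠ 0 := by exact_mod_cast hn
  have hp : ∏ j ∈ Finset.range (n + 1), (s + j) ≠ 0 :=
    Finset.prod_ne_zero_iff.2 fun j _ => add_nat_ne hs j
  have d1 : DifferentiableAt ℂ (fun z : ℂ => (n:ℂ) ^ z) s :=
    (differentiableAt_id).const_cpow (Or.inl hnc)
  have d2 : DifferentiableAt ℂ (fun z : ℂ => ∏ j ∈ Finset.range (n + 1), (z + (j:ℂ))) s := by fun_prop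
  have d3 : DifferentiableAt ℂ (fun z : ℂ => (n:ℂ) ^ z * (n.factorial : ℂ)) s := d1.mul_const _
  have hf : (n.factorial : ℂ) ≠ 0 := by exact_mod_cast n.factorial_ne_zero
  have hnz : (n:ℂ) ^ s ≠ 0 := by simp [Complex.cpow_eq_zero_iff, hnc]
  unfold Complex.GammaSeq
  refine ⟨d3.div d2 hp, ?_⟩
  rw [logDeriv_div (f := fun z : ℂ => (n:ℂ) ^ z * (n.factorial : ℂ)) (g := fun z : ℂ => ∏ j ∈ Finset.range (n + 1), (z + (j:ℂ))) s (mul_ne_zero hnz hf) hp d3 d2]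
  congr 1
  · rw [logDeriv_mul_const _ _ hf, logDeriv_apply]
    have : HasDerivAt (fun z : ℂ => (n:ℂ) ^ z) ((n:ℂ) ^ s * Complex.log n) s := by
      have := (hasDerivAt_id s).const_cpow (c := (n:ℂ)) (Or.inl hnc)
      simpa using this
    rw [this.deriv, mul_div_cancel_left₀ _ hnz, Complex.ofReal_log (by positivity)]
    simp
  · rw [logDeriv_prod (fun j _ => add_nat_ne hs j) (fun j _ => by fun_prop)]
    refine Finset.sum_congr rfl fun j _ => ?_
    rw [logDeriv_apply]; simp

lemma digamma_tendsto {s : ℂ} (hs : 1 < s.re) :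
    Tendsto (fun n : ℕ => (Real.log n : ℂ) - ∑ j ∈ Finset.range (n + 1), 1 / (s + j)) atTop
      (nhds (logDeriv Complex.Gamma s)) := by
  have hball : ∀ z ∈ Metric.closedBall s 1, 0 < z.re := by
    intro z hz
    have hz : ‖z - s‖ ≤ 1 := by simpa [dist_eq_norm] using hz
    have := (abs_le.1 ((Complex.abs_re_le_norm (z - s)).trans hz)).1
    simp at this; linarith
  have hΓd : ∀ z : ℂ, 0 < z.re → DifferentiableAt ℂ Complex.Gamma z := fun z hz =>
    Complex.differentiableAt_Gamma _ fun m h => by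
      have := add_nat_ne hz m
      rw [h] at this; simp at this
  have hΓc : ContinuousOn (fun z : ℂ => Real.Gamma z.re) (Metric.sphere s 1) := by
    intro z hz
    have hz' := hball z (Metric.sphere_subset_closedBall hz)
    have h1 : ContinuousAt Real.Gamma z.re := by
      refine (Real.differentiableAt_Gamma fun m h => ?_).continuousAt
      have h0 : (0:ℝ) ≤ m := m.cast_nonneg
      linarith
    exact (ContinuousAt.comp (f := fun z : ℂ => z.re) h1 Complex.continuous_re.continuousAt).continuousWithinAt
  obtain ⟨B, hB⟩ := (isCompact_sphere s 1).exists_bound_of_continuousOn hΓc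
  have h1 : Tendsto (fun n : ℕ => deriv (fun z => Complex.GammaSeq z n) s) atTop
      (nhds (deriv Complex.Gamma s)) := by
    refine tendsto_deriv_of_bounded (r := 1) (B := B) (by norm_num) ?_ ?_ ?_ ?_
    · filter_upwards [eventually_ne_atTop 0] with n hn
      exact fun z hz => ((GammaSeq_hasDeriv (hball z hz) hn).1).differentiableWithinAt
    · exact fun z hz => (hΓd z (hball z hz)).differentiableWithinAt
    · filter_upwards [eventually_ne_atTop 0] with n hn
      intro z hz
      refine (GammaSeq_norm_le (hball z (Metric.sphere_subset_closedBall hz)) hn).trans ?_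
      exact (Real.le_norm_self _).trans (hB z hz)
    · exact fun z _ => Complex.GammaSeq_tendsto_Gamma z
  have h2 := h1.div (Complex.GammaSeq_tendsto_Gamma s) (Complex.Gamma_ne_zero_of_re_pos (by linarith))
  refine Tendsto.congr' ?_ h2
  filter_upwards [eventually_ne_atTop 0] with n hn
  rw [← (GammaSeq_hasDeriv (by linarith) hn).2, logDeriv_apply]
  rfl

lemma log_step {z : ℂ} (hz : 0 < z.re) :
    ‖Complex.log (z + 1) - Complex.log z - 1 / z‖ ≤ 1 / ‖z‖ ^ 2 := by
  have hz0 : z ≠ 0 := by rintro rfl; simp at hz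
  have hzn : 0 < ‖z‖ := norm_pos_iff.2 hz0
  have hd : ∀ u ∈ Icc (0:ℝ) 1, HasDerivWithinAt (fun u : ℝ => Complex.log (z + u) - u / z)
      (1 / (z + u) - 1 / z) (Icc 0 1) u := by
    intro u hu
    have hsl : z + u ∈ Complex.slitPlane := by
      left; simp; linarith [hu.1]
    have h1 : HasDerivAt (fun u : ℝ => z + (u:ℂ)) 1 u := (Complex.ofRealCLM.hasDerivAt).const_add z
    have h2 := h1.clog_real hsl
    have h3 : HasDerivAt (fun u : ℝ => (u:ℂ) / z) (1 / z) u :=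
      (Complex.ofRealCLM.hasDerivAt).div_const z
    exact (h2.sub h3).hasDerivWithinAt
  have hb : ∀ u ∈ Icc (0:ℝ) 1, ‖1 / (z + u) - 1 / z‖ ≤ 1 / ‖z‖ ^ 2 := by
    intro u hu
    have hsl : z + u ≠ 0 := by
      intro h
      have := congrArg Complex.re h
      simp at this; linarith [hu.1]
    have e : 1 / (z + u) - 1 / z = -u / ((z + u) * z) := by
      field_simp; ring
    have hge : ‖z‖ ≤ ‖z + u‖ := by
      rw [Complex.norm_def, Complex.norm_def]
      refine Real.sqrt_le_sqrt ?_
      simp [Complex.normSq_apply]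
      nlinarith [hu.1]
    rw [e, norm_div, norm_neg, norm_mul, Complex.norm_real, Real.norm_eq_abs, abs_of_nonneg hu.1]
    refine div_le_div₀ (by norm_num) hu.2 (by positivity) ?_
    rw [pow_two]
    gcongr
  have := (convex_Icc (0:ℝ) 1).norm_image_sub_le_of_norm_hasDerivWithin_le hd hb
    (left_mem_Icc.2 zero_le_one) (right_mem_Icc.2 zero_le_one)
  simp only [Complex.ofReal_zero, add_zero, Complex.ofReal_one, zero_div, sub_zero, sub_zero,
    norm_one, mul_one] at this
  refine le_trans (le_of_eq ?_) this
  congr 1; ring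

lemma digamma_bound {s : ℂ} (hs : 1 < s.re) :
    ‖logDeriv Complex.Gamma s - Complex.log s‖ ≤ 2 := by
  have h1 := digamma_tendsto hs
  have hlog : Tendsto (fun n : ℕ => Complex.log (s + (n + 1 : ℕ)) - (Real.log n : ℂ)) atTop (nhds 0) := by
    have h2 : Tendsto (fun n : ℕ => Complex.log (1 + (s + 1) / n)) atTop (nhds (Complex.log 1)) := by
      refine Tendsto.clog ?_ (by simp)
      have : Tendsto (fun n : ℕ => (1:ℂ) + (s + 1) / n) atTop (nhds (1 + 0)) :=
        tendsto_const_nhds.add (tendsto_const_div_atTop_nhds_zero_nat (s + 1))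
      simpa using this
    rw [Complex.log_one] at h2
    refine Tendsto.congr' ?_ h2
    filter_upwards [eventually_gt_atTop 0] with n hn
    have hn0 : (0:ℝ) < n := by exact_mod_cast hn
    have hnc : (n:ℂ) ≠ 0 := by exact_mod_cast hn.ne'
    have hne : 1 + (s + 1) / n ≠ 0 := by
      intro h
      have h3 : s + 1 + n = 0 := by
        have : (n:ℂ) * (1 + (s+1)/n) = 0 := by rw [h, mul_zero]
        field_simp at this
        linear_combination this
      have := congrArg Complex.re h3
      simp at this; linarith
    have e : s + ((n + 1 : ℕ) : ℂ) = ((n:ℝ):ℂ) * (1 + (s + 1) / n) := by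
      push_cast; field_simp; ring
    rw [e, Complex.log_ofReal_mul hn0 hne]
    ring
  have h3 : Tendsto (fun n : ℕ => (Complex.log (s + (n + 1 : ℕ)) - Complex.log s) -
      ∑ j ∈ Finset.range (n + 1), 1 / (s + j)) atTop
      (nhds (logDeriv Complex.Gamma s - Complex.log s)) := by
    have := (h1.add hlog).sub_const (Complex.log s)
    rw [add_zero] at this
    refine this.congr fun n => ?_
    ring
  refine le_of_tendsto h3.norm (Eventually.of_forall fun n => ?_)
  have e : Complex.log (s + (n + 1 : ℕ)) - Complex.log s =
      ∑ j ∈ Finset.range (n + 1), (Complex.log (s + (j + 1 : ℕ)) - Complex.log (s + j)) := by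
    rw [Finset.sum_range_sub (fun j : ℕ => Complex.log (s + j))]; simp
  rw [e, ← Finset.sum_sub_distrib]
  refine (norm_sum_le _ _).trans ?_
  have hterm : ∀ j ∈ Finset.range (n + 1),
      ‖Complex.log (s + (j + 1 : ℕ)) - Complex.log (s + j) - 1 / (s + j)‖ ≤ 1 / ((j:ℝ) + 1) ^ 2 := by
    intro j _
    have hre : 0 < (s + j).re := by simp; positivity
    have := log_step hre
    rw [add_assoc] at this
    push_cast
    refine this.trans ?_
    refine one_div_le_one_div_of_le (by positivity) ?_
    gcongr
    have := Complex.re_le_norm (s + j)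
    simp at this; linarith
  refine (Finset.sum_le_sum hterm).trans ?_
  have hsum : HasSum (fun n : ℕ => 1 / ((n:ℝ) + 1) ^ 2) (π ^ 2 / 6) := by
    have h := hasSum_zeta_two
    rw [← hasSum_nat_add_iff' 1] at h
    simpa using h
  refine (sum_le_hasSum _ (fun i _ => by positivity) hsum).trans ?_
  nlinarith [Real.pi_lt_d2, Real.pi_pos]
end PC

namespace PC

/-- sum of Lambda(n) n^{-3/2} norms -/
def CL : ℝ := ∑' n : ℕ, ‖LSeries.term (fun n => (ArithmeticFunction.vonMangoldt n : ℂ)) (3/2) n‖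

lemma logDeriv_zeta_bound {s : ℂ} (hs : s.re = 3/2) : ‖logDeriv riemannZeta s‖ ≤ CL := by
  have h1 : 1 < s.re := by rw [hs]; norm_num
  have h := ArithmeticFunction.LSeries_vonMangoldt_eq_deriv_riemannZeta_div h1
  rw [logDeriv_apply, ← norm_neg, ← neg_div, ← h, LSeries]
  have hsum := (ArithmeticFunction.LSeriesSummable_vonMangoldt (s := 3/2) (by norm_num)).norm
  refine tsum_of_norm_bounded hsum.hasSum fun n => le_of_eq ?_
  rw [LSeries.norm_term_eq, LSeries.norm_term_eq, hs]
  norm_num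

lemma cos_sin_norm {z : ℂ} (hz : z.re = 3 * π / 4) : ‖Complex.sin z‖ = ‖Complex.cos z‖ ∧ Complex.cos z ≠ 0 := by
  have h1 : Complex.cos z = - (starRingEnd ℂ) (Complex.sin z) := by
    rw [← Complex.sin_conj, ← Complex.sin_pi_sub, ← Complex.sin_pi_div_two_sub, ← Complex.sin_neg]
    congr 1
    apply Complex.ext
    · simp [hz]; ring
    · simp
  have h2 : ‖Complex.sin z‖ = ‖Complex.cos z‖ := by rw [h1]; simp
  refine ⟨h2, fun h0 => ?_⟩
  have h3 : Complex.sin z = 0 := by rw [← norm_eq_zero, h2, h0, norm_zero]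
  have := Complex.sin_sq_add_cos_sq z
  rw [h0, h3] at this; simp at this

lemma log_est {t : ℝ} : ‖Complex.log (3/2 - t * I) - (Real.log (1 + |t|) : ℂ)‖ ≤ π + 1 := by
  set s : ℂ := 3/2 - t * I with hs
  have hre : s.re = 3/2 := by simp [hs]
  have him : s.im = -t := by simp [hs]
  have hn1 : ‖s‖ ≤ 3/2 * (1 + |t|) := by
    have := Complex.norm_le_abs_re_add_abs_im s
    rw [hre, him, abs_neg] at this
    rw [abs_of_pos (by norm_num : (0:ℝ) < 3/2)] at this
    linarith [abs_nonneg t]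
  have hn2 : (1 + |t|) / 2 ≤ ‖s‖ := by
    have h1 := Complex.abs_re_le_norm s
    have h2 := Complex.abs_im_le_norm s
    rw [hre, abs_of_pos (by norm_num : (0:ℝ) < 3/2)] at h1
    rw [him, abs_neg] at h2
    linarith
  have hpos : 0 < 1 + |t| := by positivity
  have hsn : 0 < ‖s‖ := by linarith
  have hl : |Real.log ‖s‖ - Real.log (1 + |t|)| ≤ 1 := by
    rw [← Real.log_div hsn.ne' hpos.ne', abs_le]
    have hq : 0 < ‖s‖ / (1 + |t|) := by positivity
    have hq1 : ‖s‖ / (1 + |t|) ≤ 3/2 := by rw [div_le_iff₀ hpos]; exact hn1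
    have hq2 : 1/2 ≤ ‖s‖ / (1 + |t|) := by rw [le_div_iff₀ hpos]; linarith
    constructor
    · have := Real.one_sub_inv_le_log_of_pos hq
      have h3 : (‖s‖ / (1 + |t|))⁻¹ ≤ 2 := by
        rw [inv_le_comm₀ hq (by norm_num)]; linarith
      linarith
    · have := Real.log_le_sub_one_of_pos hq
      linarith
  have e : Complex.log s - (Real.log (1 + |t|) : ℂ) = ((Real.log ‖s‖ - Real.log (1 + |t|) : ℝ) : ℂ) + (Complex.arg s : ℂ) * I := by
    rw [Complex.log]; push_cast; ring
  rw [e]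
  refine (norm_add_le _ _).trans ?_
  rw [norm_mul, Complex.norm_I, mul_one, Complex.norm_real, Complex.norm_real, Real.norm_eq_abs, Real.norm_eq_abs]
  have := Complex.abs_arg_le_pi s
  linarith

lemma zeta_left_id (t : ℝ) : riemannZeta (-1/2 + t * I) ≠ 0 ∧
    -logDeriv riemannZeta (-1/2 + t * I) = -(Real.log (2 * π) : ℂ) + logDeriv Complex.Gamma (3/2 - t*I)
      - (π/2 : ℂ) * (Complex.sin (π * (3/2 - t*I)/2) / Complex.cos (π * (3/2 - t*I)/2)) + logDeriv riemannZeta (3/2 - t*I) := by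
  set s : ℂ := 3/2 - t * I with hs
  have hre : s.re = 3/2 := by simp [hs]
  have h1s : (-1/2 + t * I : ℂ) = 1 - s := by rw [hs]; ring
  rw [h1s]
  have hpi2 : (2 * π : ℂ) ≠ 0 := by simp [Real.pi_ne_zero]
  have hc : Complex.cos (π * s / 2) ≠ 0 := (cos_sin_norm (by
    have : (π * s / 2 : ℂ) = ((π/2 : ℝ) : ℂ) * s := by push_cast; ring
    rw [this, Complex.re_ofReal_mul, hre]; ring)).2
  have hG : Complex.Gamma s ≠ 0 := Complex.Gamma_ne_zero_of_re_pos (by rw [hre]; norm_num)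
  have hz : riemannZeta s ≠ 0 := riemannZeta_ne_zero_of_one_lt_re (by rw [hre]; norm_num)
  have hp : (2:ℂ) * (2 * π) ^ (-s) ≠ 0 := by
    refine mul_ne_zero two_ne_zero ?_
    rw [Ne, Complex.cpow_eq_zero_iff]; tauto
  have hne : ∀ z : ℂ, 1 < z.re → (∀ n : ℕ, z ≠ -n) ∧ z ≠ 1 := by
    intro z hz
    refine ⟨fun n h => ?_, fun h => ?_⟩
    · have := congrArg Complex.re h
      simp at this
      have h0 : (0:ℝ) ≤ n := n.cast_nonneg
      linarith
    · rw [h] at hz; simp at hz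
  have hs1 : 1 < s.re := by rw [hre]; norm_num
  have hfe := riemannZeta_one_sub (hne s hs1).1 (hne s hs1).2
  refine ⟨by rw [hfe]; exact mul_ne_zero (mul_ne_zero (mul_ne_zero hp hG) hc) hz, ?_⟩
  have d1 : HasDerivAt (fun z : ℂ => (2:ℂ) * (2 * π) ^ (-z)) (2 * ((2 * π) ^ (-s) * Complex.log (2*π) * (-1))) s := by
    exact ((hasDerivAt_neg s).const_cpow (Or.inl hpi2)).const_mul 2
  have d2 : DifferentiableAt ℂ Complex.Gamma s := Complex.differentiableAt_Gamma _ (hne s hs1).1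
  have d3 : HasDerivAt (fun z : ℂ => Complex.cos (π * z / 2)) (-Complex.sin (π * s / 2) * (π * 1 / 2)) s :=
    (((hasDerivAt_id s).const_mul (π:ℂ)).div_const 2).ccos
  have d4 : DifferentiableAt ℂ riemannZeta s := differentiableAt_riemannZeta (hne s hs1).2
  have d5 : DifferentiableAt ℂ riemannZeta (1 - s) := differentiableAt_riemannZeta (by
    intro h
    have := congrArg Complex.re h
    simp [hre] at this)
  have hev : (fun z => riemannZeta (1 - z)) =ᶠ[nhds s]
      fun z => 2 * (2 * π) ^ (-z) * Complex.Gamma z * Complex.cos (π * z / 2) * riemannZeta z := by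
    have : ∀ᶠ z in nhds s, 1 < z.re :=
      (continuous_re.isOpen_preimage _ isOpen_Ioi).mem_nhds hs1
    filter_upwards [this] with z hz
    exact riemannZeta_one_sub (hne z hz).1 (hne z hz).2
  have hl := (logDeriv_congr_nhds hev).self_of_nhds
  have hlc : logDeriv (fun z => riemannZeta (1 - z)) s = - logDeriv riemannZeta (1 - s) := by
    have := logDeriv_comp (f := riemannZeta) (g := fun z : ℂ => 1 - z) (x := s) d5 (by fun_prop)
    have h2 : deriv (fun z : ℂ => 1 - z) s = -1 := by
      simpa using ((hasDerivAt_id s).const_sub 1).deriv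
    rw [h2] at this
    rw [show (fun z => riemannZeta (1 - z)) = riemannZeta ∘ (fun z : ℂ => 1 - z) from rfl, this]; ring
  rw [← hlc, hl, logDeriv_mul (f := fun z : ℂ => 2 * (2 * π) ^ (-z) * Complex.Gamma z * Complex.cos (π * z / 2)) s (mul_ne_zero (mul_ne_zero hp hG) hc) hz
      ((d1.differentiableAt.mul d2).mul d3.differentiableAt) d4,
    logDeriv_mul (f := fun z : ℂ => 2 * (2 * π) ^ (-z) * Complex.Gamma z) (g := fun z : ℂ => Complex.cos (π * z / 2)) s (mul_ne_zero hp hG) hc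
      (d1.differentiableAt.mul d2) d3.differentiableAt,
    logDeriv_mul (f := fun z : ℂ => (2:ℂ) * (2 * (π:ℂ)) ^ (-z)) (g := Complex.Gamma) s hp hG d1.differentiableAt d2]
  have e1 : logDeriv (fun z : ℂ => (2:ℂ) * (2 * π) ^ (-z)) s = -(Real.log (2 * π) : ℂ) := by
    rw [logDeriv_apply, d1.deriv, Complex.ofReal_log (by positivity)]
    push_cast
    rw [div_eq_iff hp]; ring
  have e2 : logDeriv (fun z : ℂ => Complex.cos (π * z / 2)) s = - ((π/2 : ℂ) * (Complex.sin (π * s/2) / Complex.cos (π * s/2))) := by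
    rw [logDeriv_apply, d3.deriv]; ring
  rw [e1, e2]; ring

def CS : ℝ := Real.log (2*π) + 2 + (π + 1) + π/2 + CL

lemma zeta_left_bound (t : ℝ) :
    ‖-logDeriv riemannZeta (-1/2 + t * I) - (Real.log (1 + |t|) : ℂ)‖ ≤ CS := by
  rw [(zeta_left_id t).2]
  set s : ℂ := 3/2 - t * I with hs
  have hre : s.re = 3/2 := by simp [hs]
  have h1 := digamma_bound (s := s) (by rw [hre]; norm_num)
  have h2 := log_est (t := t)
  have h3 := logDeriv_zeta_bound hre
  have h4 : ‖Complex.sin (π * s / 2) / Complex.cos (π * s / 2)‖ = 1 := by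
    obtain ⟨ha, hb⟩ := cos_sin_norm (z := π * s / 2) (by
      have : (π * s / 2 : ℂ) = ((π/2 : ℝ) : ℂ) * s := by push_cast; ring
      rw [this, Complex.re_ofReal_mul, hre]; ring)
    rw [norm_div, ha, div_self (norm_ne_zero_iff.2 hb)]
  rw [← hs] at h2
  have e : -(Real.log (2 * π) : ℂ) + logDeriv Complex.Gamma s
      - (π/2 : ℂ) * (Complex.sin (π * s/2) / Complex.cos (π * s/2)) + logDeriv riemannZeta s - (Real.log (1 + |t|) : ℂ)
      = -(Real.log (2 * π) : ℂ) + (logDeriv Complex.Gamma s - Complex.log s) + (Complex.log s - (Real.log (1 + |t|) : ℂ))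
      + (-((π/2 : ℂ) * (Complex.sin (π * s/2) / Complex.cos (π * s/2)))) + logDeriv riemannZeta s := by ring
  rw [e]
  have h5 : ‖-(Real.log (2 * π) : ℂ)‖ = Real.log (2*π) := by
    rw [norm_neg, Complex.norm_real, Real.norm_eq_abs, abs_of_nonneg]
    exact Real.log_nonneg (by linarith [Real.pi_gt_three])
  have h6 : ‖-((π/2 : ℂ) * (Complex.sin (π * s/2) / Complex.cos (π * s/2)))‖ = π/2 := by
    rw [norm_neg, norm_mul, h4, mul_one, norm_div, Complex.norm_real, Real.norm_eq_abs, abs_of_pos Real.pi_pos]; simp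
  refine (norm_add_le _ _).trans ?_
  refine (add_le_add_left (norm_add_le _ _) _).trans ?_
  refine (add_le_add_left (add_le_add_left (norm_add_le _ _) _) _).trans ?_
  refine (add_le_add_left (add_le_add_left (add_le_add_left (norm_add_le _ _) _) _) _).trans ?_
  rw [h5, h6]; unfold CS; linarith
end PC

namespace PC

lemma norm_cexp_two {z : ℂ} (hz : z.re = 2) (y : ℝ) : ‖Complex.exp (-z * y)‖ = Real.exp (-2 * y) := by
  rw [Complex.norm_exp]; simp [hz]

lemma exp_int_bound (C : ℝ) : IntegrableOn (fun y : ℝ => C * Real.exp (-1 * y)) (Ioi 0) :=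
  (integrableOn_exp_mul_Ioi (by norm_num) 0).const_mul C

lemma laplace_integrable {h : ℝ → ℂ} {C : ℝ} (hc : ContinuousOn h (Ioi 0))
    (hb : ∀ y, 0 < y → ‖h y‖ ≤ C * Real.exp y) {z : ℂ} (hz : z.re = 2) :
    IntegrableOn (fun y : ℝ => Complex.exp (-z * y) * h y) (Ioi 0) := by
  refine Integrable.mono' (exp_int_bound C) ?_ ?_
  · refine ContinuousOn.aestronglyMeasurable ?_ measurableSet_Ioi
    refine ContinuousOn.mul ?_ hc
    fun_prop
  · refine (ae_restrict_iff' measurableSet_Ioi).2 (Eventually.of_forall fun y hy => ?_)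
    rw [norm_mul, norm_cexp_two hz]
    calc Real.exp (-2 * y) * ‖h y‖ ≤ Real.exp (-2*y) * (C * Real.exp y) := by
          gcongr; exact hb y hy
      _ = C * Real.exp (-1 * y) := by
          rw [show -1 * y = -2 * y + y by ring, Real.exp_add]; ring

lemma laplace_unique {h : ℝ → ℂ} {C : ℝ} (hc : ContinuousOn h (Ioi 0))
    (hb : ∀ y, 0 < y → ‖h y‖ ≤ C * Real.exp y)
    (hz : ∀ z : ℂ, z.re = 2 → ∫ y in Ioi (0:ℝ), Complex.exp (-z * y) * h y = 0) :
    ∀ y, 0 < y → h y = 0 := by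
  intro y hy
  set k : ℝ → ℂ := (Ioi (0:ℝ)).indicator (fun y => Complex.exp (-2 * y) * h y) with hk
  have hki : Integrable k := by
    rw [hk, integrable_indicator_iff measurableSet_Ioi]
    exact laplace_integrable hc hb (z := 2) (by simp)
  have hF : FourierTransform.fourier k = (fun _ => 0 : ℝ → ℂ) := by
    ext w
    rw [Real.fourier_real_eq_integral_exp_smul]
    have e : (fun v : ℝ => Complex.exp (↑(-2 * π * v * w) * Complex.I) • k v) =
        (Ioi (0:ℝ)).indicator (fun v => Complex.exp (-(2 + 2 * π * w * I) * v) * h v) := by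
      ext v
      by_cases hv : v ∈ Ioi (0:ℝ)
      · rw [hk, indicator_of_mem hv, indicator_of_mem hv, smul_eq_mul, ← mul_assoc, ← Complex.exp_add]
        congr 2; push_cast; ring
      · rw [hk, indicator_of_notMem hv, indicator_of_notMem hv, smul_zero]
    rw [e, integral_indicator measurableSet_Ioi]
    exact hz _ (by simp)
  have hev : k =ᶠ[nhds y] (fun y => Complex.exp (-2 * y) * h y) := by
    filter_upwards [Ioi_mem_nhds hy] with v hv
    rw [hk, indicator_of_mem hv]
  have hcont : ContinuousAt k y := by
    refine ContinuousAt.congr ?_ hev.symm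
    refine ContinuousAt.mul (by fun_prop) (hc.continuousAt (Ioi_mem_nhds hy))
  have := hki.fourierInv_fourier_eq (by rw [hF]; exact integrable_zero _ _ _) hcont
  rw [hev.self_of_nhds, hF] at this
  have h0 : (FourierTransformInv.fourierInv (fun _ => 0 : ℝ → ℂ)) y = 0 := by
    rw [Real.fourierInv_eq]; simp
  rw [h0] at this
  have h1 := (mul_eq_zero.1 this.symm).resolve_left (Complex.exp_ne_zero _)
  exact h1

lemma laplace_tsum {ι : Type*} [Countable ι] {g : ι → ℝ → ℂ} {B : ι → ℝ} (hB : Summable B)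
    (hc : ∀ i, Continuous (g i)) (hb : ∀ i y, 0 < y → ‖g i y‖ ≤ B i * Real.exp y) :
    ContinuousOn (fun y => ∑' i, g i y) (Ioi 0) ∧
    (∀ y, 0 < y → ‖∑' i, g i y‖ ≤ (∑' i, B i) * Real.exp y) ∧
    ∀ z : ℂ, z.re = 2 → HasSum (fun i => ∫ y in Ioi (0:ℝ), Complex.exp (-z * y) * g i y)
      (∫ y in Ioi (0:ℝ), Complex.exp (-z * y) * ∑' i, g i y) := by
  refine ⟨?_, ?_, ?_⟩
  · intro y hy
    have hy' : 0 < y := hy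
    have h1 : ContinuousOn (fun y => ∑' i, g i y) (Ioo 0 (y + 1)) := by
      refine continuousOn_tsum (u := fun i => B i * Real.exp (y + 1)) (fun i => (hc i).continuousOn)
        (hB.mul_right _) fun i v hv => ?_
      refine (hb i v hv.1).trans ?_
      have hBn : 0 ≤ B i := by
        have := (norm_nonneg _).trans (hb i v hv.1)
        exact nonneg_of_mul_nonneg_left this (Real.exp_pos _)
      gcongr; exact hv.2.le
    exact (h1.continuousAt (Ioo_mem_nhds hy' (by linarith))).continuousWithinAt
  · intro y hy
    refine tsum_of_norm_bounded (hB.hasSum.mul_right _) fun i => hb i y hy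
  · intro z hz
    have key := hasSum_integral_of_summable_integral_norm (μ := volume.restrict (Ioi (0:ℝ)))
      (F := fun i y => Complex.exp (-z * y) * g i y)
      (fun i => laplace_integrable (hc i).continuousOn (hb i) hz) (by
        refine Summable.of_nonneg_of_le (fun i => integral_nonneg fun y => norm_nonneg _) (fun i => ?_)
          (hB.mul_right (∫ y in Ioi (0:ℝ), Real.exp (-1 * y)))
        rw [← integral_const_mul]
        refine setIntegral_mono_on (laplace_integrable (hc i).continuousOn (hb i) hz).norm
          (exp_int_bound _) measurableSet_Ioi fun y hy => ?_
        rw [norm_mul, norm_cexp_two hz]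
        calc Real.exp (-2 * y) * ‖g i y‖ ≤ Real.exp (-2*y) * (B i * Real.exp y) := by
              gcongr; exact hb i y hy
          _ = B i * Real.exp (-1 * y) := by
              rw [show -1 * y = -2 * y + y by ring, Real.exp_add]; ring)
    simp_rw [tsum_mul_left] at key
    exact key

lemma laplace_exp {z q : ℂ} (hz : z.re = 2) (hq : q.re < 2) :
    ∫ y in Ioi (0:ℝ), Complex.exp (-z * y) * Complex.exp (q * y) = 1 / (z - q) := by
  have e : (fun y : ℝ => Complex.exp (-z * y) * Complex.exp (q * y)) = fun y : ℝ => Complex.exp ((q - z) * y) := by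
    ext y; rw [← Complex.exp_add]; congr 1; ring
  rw [e, integral_exp_mul_complex_Ioi (by simp [hz, hq])]
  simp only [Complex.ofReal_zero, mul_zero, Complex.exp_zero]
  rw [show z - q = -(q - z) by ring, div_neg, neg_div]

lemma laplace_peak {z : ℂ} (hz : z.re = 2) {l : ℝ} (hl : 0 ≤ l) :
    ∫ y in Ioi (0:ℝ), Complex.exp (-z * y) * (Real.exp (-|y - l|) : ℂ) =
      (Complex.exp (-l) - Complex.exp (-z * l)) / (z - 1) + Complex.exp (-z * l) / (z + 1) := by
  have hz1 : z - 1 ≠ 0 := by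
    intro h; have := congrArg Complex.re h; simp [hz] at this; norm_num at this
  have hz2 : z + 1 ≠ 0 := by
    intro h; have := congrArg Complex.re h; simp [hz] at this; norm_num at this
  have hIntg : IntegrableOn (fun y : ℝ => Complex.exp (-z * y) * (Real.exp (-|y - l|) : ℂ)) (Ioi 0) := by
    refine laplace_integrable (C := 1) (h := fun y : ℝ => (Real.exp (-|y - l|) : ℂ)) (by fun_prop) ?_ hz
    intro y hy
    rw [Complex.norm_real, Real.norm_eq_abs, Real.abs_exp, one_mul, Real.exp_le_exp]
    have := abs_nonneg (y - l); linarith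
  have hu : Ioi (0:ℝ) = Ioc 0 l ∪ Ioi l := (Ioc_union_Ioi_eq_Ioi hl).symm
  rw [hu] at hIntg ⊢
  rw [setIntegral_union (Ioc_disjoint_Ioi le_rfl) measurableSet_Ioi (hIntg.mono_set subset_union_left)
    (hIntg.mono_set subset_union_right)]
  congr 1
  · rw [← intervalIntegral.integral_of_le hl]
    have : ∫ y in (0:ℝ)..l, Complex.exp (-z * y) * (Real.exp (-|y - l|) : ℂ) =
        ∫ y in (0:ℝ)..l, Complex.exp (-l) * Complex.exp ((1 - z) * y) := by
      refine intervalIntegral.integral_congr fun y hy => ?_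
      rw [uIcc_of_le hl] at hy
      rw [abs_of_nonpos (by linarith [hy.2]), Complex.ofReal_exp, ← Complex.exp_add, ← Complex.exp_add]
      congr 1; push_cast; ring
    rw [this, intervalIntegral.integral_const_mul, integral_exp_mul_complex (by
      rw [show 1 - z = -(z-1) by ring]; exact neg_ne_zero.2 hz1)]
    have h1 : (1:ℂ) - z ≠ 0 := by rw [show 1 - z = -(z-1) by ring]; exact neg_ne_zero.2 hz1
    rw [show Complex.exp (-z * l) = Complex.exp (-l) * Complex.exp ((1-z)*l) by
      rw [← Complex.exp_add]; congr 1; ring]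
    simp only [Complex.ofReal_zero, mul_zero, Complex.exp_zero]
    field_simp
    ring
  · have : ∫ y in Ioi l, Complex.exp (-z * y) * (Real.exp (-|y - l|) : ℂ) =
        ∫ y in Ioi l, Complex.exp l * Complex.exp ((-z-1) * y) := by
      refine setIntegral_congr_fun measurableSet_Ioi fun y hy => ?_
      have hy : l < y := hy
      rw [abs_of_pos (by linarith), Complex.ofReal_exp, ← Complex.exp_add, ← Complex.exp_add]
      congr 1; push_cast; ring
    rw [this, integral_const_mul, integral_exp_mul_complex_Ioi (by simp [hz]; norm_num)]
    rw [show Complex.exp (-z * l) = Complex.exp l * Complex.exp ((-z-1)*l) by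
      rw [← Complex.exp_add]; congr 1; ring]
    have h1 : -z - 1 ≠ 0 := by rw [show -z-1 = -(z+1) by ring]; exact neg_ne_zero.2 hz2
    field_simp
    ring
end PC

namespace PC

abbrev Z := {a : ℂ // mm a ≠ 0}

instance : Countable Z := by
  have h : {a : ℂ | mm a ≠ 0} = ⋃ n : ℕ, (Metric.closedBall (0:ℂ) n ∩ {a | mm a ≠ 0}) := by
    ext a
    simp only [mem_iUnion, mem_inter_iff, Metric.mem_closedBall, dist_zero_right]
    constructor
    · intro ha
      obtain ⟨n, hn⟩ := exists_nat_ge ‖a‖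
      exact ⟨n, hn, ha⟩
    · rintro ⟨n, -, h⟩; exact h
  have : {a : ℂ | mm a ≠ 0}.Countable := by
    rw [h]; exact countable_iUnion fun n => (mm_fin n).countable
  exact this.to_subtype

def kz (t : ℝ) (a : ℂ) : ℂ := 1 / (3/2 + t * I - a) - 1 / (-1/2 + t * I - a)

lemma zeta1_right_ne {s : ℂ} (hs : 1 < s.re) : riemannZeta₁ s ≠ 0 := by
  have h1 : s ≠ 1 := by rintro rfl; simp at hs
  rw [zeta1_ne_one h1]
  exact mul_ne_zero (sub_ne_zero.2 h1) (riemannZeta_ne_zero_of_one_lt_re hs)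

lemma left_ne_one (t : ℝ) : (-1/2 + t * I : ℂ) ≠ 1 := by
  intro h; have := congrArg Complex.re h; simp at this; norm_num at this

lemma zeta1_left_ne (t : ℝ) : riemannZeta₁ (-1/2 + t * I) ≠ 0 := by
  rw [zeta1_ne_one (left_ne_one t)]
  exact mul_ne_zero (sub_ne_zero.2 (left_ne_one t)) (zeta_left_id t).1

lemma logDeriv_zeta1 {s : ℂ} (h1 : s ≠ 1) (h0 : riemannZeta s ≠ 0) :
    logDeriv riemannZeta₁ s = 1 / (s - 1) + logDeriv riemannZeta s := by
  have hev : riemannZeta₁ =ᶠ[nhds s] fun z => (z - 1) * riemannZeta z := by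
    filter_upwards [isOpen_ne.mem_nhds h1] with z hz
    exact zeta1_ne_one hz
  rw [(logDeriv_congr_nhds hev).self_of_nhds,
    logDeriv_mul (f := fun z : ℂ => z - 1) s (sub_ne_zero.2 h1) h0 (by fun_prop) (differentiableAt_riemannZeta h1)]
  congr 1
  rw [logDeriv_apply]; simp

lemma rr_re (t : ℝ) : (3/2 + t * I : ℂ).re = 3/2 := by simp

lemma kz_hasSum (t : ℝ) : HasSum (fun a : ℂ => (mm a : ℂ) * kz t a)
    (logDeriv riemannZeta₁ (3/2 + t*I) - logDeriv riemannZeta₁ (-1/2 + t*I)) :=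
  mm_hasSum (zeta1_right_ne (by rw [rr_re]; norm_num)) (zeta1_left_ne t)

lemma Z_hasSum {f : ℂ → ℂ} {s : ℂ} (hf : ∀ a, mm a = 0 → f a = 0) :
    HasSum f s ↔ HasSum (fun a : Z => f a) s := by
  have : Function.support f ⊆ {a : ℂ | mm a ≠ 0} := by
    intro a ha h; exact ha (hf a h)
  exact (hasSum_subtype_iff_of_support_subset this).symm

lemma kz_summable (t : ℝ) : Summable (fun a : Z => ‖(mm a : ℂ) * kz t a‖) :=
  ((Z_hasSum (by intro a h; simp [h])).1 (kz_hasSum t)).summable.norm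

lemma Z_ne (a : Z) {s : ℂ} (hs : riemannZeta₁ s ≠ 0) : s - a ≠ 0 := by
  intro h
  rw [sub_eq_zero.1 h] at hs
  exact hs ((mm_ne_zero_iff).1 a.2)

lemma Z_re (hRH : RiemannHypothesis) (a : Z) : (a:ℂ).re = 1/2 ∨ ∃ n : ℕ, (a:ℂ) = -2 * (n + 1) := by
  obtain ⟨h1, h2⟩ := mm_ne_zero_iff'.1 a.2
  by_cases h : ∃ n : ℕ, (a:ℂ) = -2 * (n + 1)
  · right; exact h
  · left; exact hRH a h2 h h1

lemma Z_re_le (hRH : RiemannHypothesis) (a : Z) : (a:ℂ).re ≤ 1/2 := by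
  rcases Z_re hRH a with h | ⟨n, h⟩
  · exact h.le
  · rw [h]; simp; 
    have : (0:ℝ) ≤ n := n.cast_nonneg
    linarith

def zterm (t y : ℝ) (a : ℂ) : ℂ := (mm a : ℂ) * kz t a * Complex.exp ((a - (1/2 + t * I)) * y)
def ZS (t y : ℝ) : ℂ := ∑' a : Z, zterm t y a
/-- real coefficients -/
def ac (y : ℝ) (n : ℕ) : ℝ := ArithmeticFunction.vonMangoldt n * Real.exp (-(Real.log n) / 2 - |y - Real.log n|)
def PS (t y : ℝ) : ℂ := ∑' n : ℕ, (ac y n : ℂ) * Complex.exp (-(t * Real.log n) * I)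

lemma vM_zero : ArithmeticFunction.vonMangoldt 0 = 0 := by simp

lemma term_exp (s : ℂ) (n : ℕ) : LSeries.term (fun n => (ArithmeticFunction.vonMangoldt n : ℂ)) s n =
    (ArithmeticFunction.vonMangoldt n : ℂ) * Complex.exp (-s * Real.log n) := by
  rcases Nat.eq_zero_or_pos n with rfl | hn
  · simp
  rw [LSeries.term_of_ne_zero hn.ne', Complex.cpow_def_of_ne_zero (by exact_mod_cast hn.ne'),
    div_eq_mul_inv, ← Complex.exp_neg, Complex.ofReal_log (by positivity)]
  congr 2; simp; ring

lemma vM_hasSum {s : ℂ} (hs : 1 < s.re) :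
    HasSum (fun n : ℕ => (ArithmeticFunction.vonMangoldt n : ℂ) * Complex.exp (-s * Real.log n)) (-logDeriv riemannZeta s) := by
  have h := (ArithmeticFunction.LSeriesSummable_vonMangoldt hs).hasSum
  have h2 := ArithmeticFunction.LSeries_vonMangoldt_eq_deriv_riemannZeta_div hs
  rw [LSeries] at h2
  rw [h2, neg_div, ← logDeriv_apply] at h
  refine h.congr_fun ?_ 
  intro n; exact (term_exp s n).symm

lemma vM_summable {σ : ℝ} (hs : 1 < σ) : Summable (fun n : ℕ => ArithmeticFunction.vonMangoldt n * Real.exp (-σ * Real.log n)) := by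
  have := (vM_hasSum (s := σ) (by simpa)).summable.norm
  refine this.congr fun n => ?_
  rw [norm_mul, show (-(σ:ℂ) * (Real.log n : ℂ)) = ((-σ * Real.log n : ℝ) : ℂ) by push_cast; ring, Complex.norm_exp,
    Complex.ofReal_re, Complex.norm_real, Real.norm_of_nonneg ArithmeticFunction.vonMangoldt_nonneg]

lemma log_nat_nonneg (n : ℕ) : 0 ≤ Real.log n := Real.log_natCast_nonneg n

lemma ac_nonneg (y : ℝ) (n : ℕ) : 0 ≤ ac y n := mul_nonneg ArithmeticFunction.vonMangoldt_nonneg (Real.exp_pos _).le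

lemma ac_le (y : ℝ) (n : ℕ) : ac y n ≤ ArithmeticFunction.vonMangoldt n * Real.exp (-(3/2) * Real.log n) * Real.exp y := by
  unfold ac
  rw [mul_assoc, ← Real.exp_add]
  refine mul_le_mul_of_nonneg_left (Real.exp_le_exp.2 ?_) ArithmeticFunction.vonMangoldt_nonneg
  have := neg_abs_le (y - Real.log n); linarith

lemma ac_summable (y : ℝ) : Summable (ac y) :=
  Summable.of_nonneg_of_le (ac_nonneg y) (ac_le y) ((vM_summable (by norm_num)).mul_right _)

lemma norm_pterm (y t : ℝ) (n : ℕ) : ‖(ac y n : ℂ) * Complex.exp (-(t * Real.log n) * I)‖ = ac y n := by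
  rw [norm_mul, show (-((t:ℂ) * (Real.log n : ℂ))) = ((-(t * Real.log n) : ℝ) : ℂ) by push_cast; ring,
    Complex.norm_exp_ofReal_mul_I, Complex.norm_real, Real.norm_of_nonneg (ac_nonneg y n), mul_one]

theorem explicit_formula (hRH : RiemannHypothesis) (t : ℝ) {y : ℝ} (hy : 0 < y) :
    ZS t y - kz t 1 * Complex.exp ((1/2 - t * I) * y) =
      - PS t y - logDeriv riemannZeta (-1/2 + t * I) * Complex.exp (-y) := by
  set c : ℂ := 1/2 + t * I with hc
  set s₁ : ℂ := 3/2 + t * I with hs₁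
  set s₂ : ℂ := -1/2 + t * I with hs₂
  obtain ⟨zc, zb, zl⟩ := laplace_tsum (g := fun (a : Z) y => zterm t y a) (kz_summable t)
    (fun a => by unfold zterm; fun_prop) (fun a y hy => by
      unfold zterm
      rw [norm_mul]
      refine mul_le_mul_of_nonneg_left ?_ (norm_nonneg _)
      rw [Complex.norm_exp]
      refine Real.exp_le_exp.2 ?_
      have := Z_re_le hRH a
      simp
      nlinarith)
  obtain ⟨pc, pb, pl⟩ := laplace_tsum (g := fun (n : ℕ) y => (ac y n : ℂ) * Complex.exp (-(t * Real.log n) * I))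
    (vM_summable (σ := 3/2) (by norm_num))
    (fun n => by unfold ac; fun_prop) (fun n y hy => by
      rw [norm_pterm]
      exact ac_le y n)
  have ec : Continuous (fun y : ℝ => kz t 1 * Complex.exp ((1/2 - t * I) * y)) := by fun_prop
  have eb : ∀ y : ℝ, 0 < y → ‖kz t 1 * Complex.exp ((1/2 - t * I) * y)‖ ≤ ‖kz t 1‖ * Real.exp y := by
    intro y hy
    rw [norm_mul, Complex.norm_exp]
    gcongr
    simp; linarith
  have lc : Continuous (fun y : ℝ => logDeriv riemannZeta s₂ * Complex.exp (-y)) := by fun_prop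
  have lb : ∀ y : ℝ, 0 < y → ‖logDeriv riemannZeta s₂ * Complex.exp (-y)‖ ≤ ‖logDeriv riemannZeta s₂‖ * Real.exp y := by
    intro y hy
    rw [norm_mul, Complex.norm_exp]
    gcongr
    simp; linarith
  have key := laplace_unique (h := fun y => (ZS t y - kz t 1 * Complex.exp ((1/2 - t * I) * y)) + (PS t y + logDeriv riemannZeta s₂ * Complex.exp (-y)))
    (C := ((∑' a : Z, ‖(mm a : ℂ) * kz t a‖) + ‖kz t 1‖) + ((∑' n : ℕ, ArithmeticFunction.vonMangoldt n * Real.exp (-(3/2) * Real.log n)) + ‖logDeriv riemannZeta s₂‖))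
    ((zc.sub ec.continuousOn).add (pc.add lc.continuousOn)) (fun y hy => by
      refine (norm_add_le _ _).trans ?_
      rw [add_mul, add_mul, add_mul]
      refine add_le_add ((norm_sub_le _ _).trans (add_le_add (zb y hy) (eb y hy))) ((norm_add_le _ _).trans (add_le_add (pb y hy) (lb y hy))))
    (fun z hz => by
      have hz1 : z - 1 ≠ 0 := by
        intro h; have := congrArg Complex.re h; simp [hz] at this; norm_num at this
      have hz2 : z + 1 ≠ 0 := by
        intro h; have := congrArg Complex.re h; simp [hz] at this; norm_num at this
      set s : ℂ := c + z with hs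
      have hsre : s.re = 5/2 := by simp [hs, hc, hz]; norm_num
      have hsn := zeta1_right_ne (s := s) (by rw [hsre]; norm_num)
      have hs1n : riemannZeta₁ s₁ ≠ 0 := zeta1_right_ne (by rw [rr_re]; norm_num)
      have hs2n : riemannZeta₁ s₂ ≠ 0 := zeta1_left_ne t
      have is₁ : s - s₁ = z - 1 := by rw [hs, hs₁, hc]; ring
      have is₂ : s - s₂ = z + 1 := by rw [hs, hs₂, hc]; ring
      have iz := laplace_integrable zc zb hz
      have ie := laplace_integrable ec.continuousOn eb hz
      have ip := laplace_integrable pc pb hz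
      have il := laplace_integrable lc.continuousOn lb hz
      simp_rw [mul_add, mul_sub]
      have pf : ∀ a : ℂ, s₁ - a ≠ 0 → s₂ - a ≠ 0 → s - a ≠ 0 →
          (1 / (s₁ - a) - 1 / (s₂ - a)) * (1 / (s - a)) =
          (1 / (s₁ - a) - 1 / (s - a)) / (z - 1) - (1 / (s₂ - a) - 1 / (s - a)) / (z + 1) := by
        intro a h1 h2 h3
        rw [← is₁, ← is₂] 
        rw [← is₁] at hz1
        rw [← is₂] at hz2
        field_simp
        ring
      have e1 : ∫ y in Ioi (0:ℝ), Complex.exp (-z * y) * ZS t y =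
          (logDeriv riemannZeta₁ s₁ - logDeriv riemannZeta₁ s) / (z - 1) - (logDeriv riemannZeta₁ s₂ - logDeriv riemannZeta₁ s) / (z + 1) := by
        refine (zl z hz).unique ?_
        have g1 := (Z_hasSum (by intro a h; simp [h])).1 (mm_hasSum hs1n hsn)
        have g2 := (Z_hasSum (by intro a h; simp [h])).1 (mm_hasSum hs2n hsn)
        refine ((g1.div_const (z - 1)).sub (g2.div_const (z + 1))).congr_fun ?_
        intro a
        have : ∀ y : ℝ, Complex.exp (-z * y) * zterm t y a = ((mm a : ℂ) * kz t a) * (Complex.exp (-z * y) * Complex.exp (((a:ℂ) - c) * y)) := by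
          intro y; unfold zterm; ring
        simp_rw [this]
        rw [integral_const_mul, laplace_exp hz (by
          have := Z_re_le hRH a
          simp [hc]; linarith), show z - ((a:ℂ) - c) = s - a by rw [hs]; ring, mul_assoc]
        have := pf a (Z_ne a hs1n) (Z_ne a hs2n) (Z_ne a hsn)
        unfold kz
        rw [← hs₁, ← hs₂, this]; ring
      have n1 : ∀ w : ℂ, w.re ≠ 1 → w - 1 ≠ 0 := by
        intro w hw h; apply hw; rw [sub_eq_zero.1 h]; simp
      have n11 : s₁ - 1 ≠ 0 := n1 _ (by rw [rr_re]; norm_num)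
      have n12 : s₂ - 1 ≠ 0 := n1 _ (by simp [hs₂]; norm_num)
      have n13 : s - 1 ≠ 0 := n1 _ (by rw [hsre]; norm_num)
      have e2 : ∫ y in Ioi (0:ℝ), Complex.exp (-z * y) * (kz t 1 * Complex.exp ((1/2 - t * I) * y)) =
          (1 / (s₁ - 1) - 1 / (s - 1)) / (z - 1) - (1 / (s₂ - 1) - 1 / (s - 1)) / (z + 1) := by
        have : ∀ y : ℝ, Complex.exp (-z * y) * (kz t 1 * Complex.exp ((1/2 - t * I) * y)) = kz t 1 * (Complex.exp (-z * y) * Complex.exp ((1/2 - t * I) * y)) := by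
          intro y; ring
        simp_rw [this]
        rw [integral_const_mul, laplace_exp hz (by simp; norm_num), show z - (1/2 - t * I) = s - 1 by rw [hs, hc]; ring]
        exact pf 1 n11 n12 n13
      have e4 : ∫ y in Ioi (0:ℝ), Complex.exp (-z * y) * (logDeriv riemannZeta s₂ * Complex.exp (-y)) = logDeriv riemannZeta s₂ / (z + 1) := by
        have : ∀ y : ℝ, Complex.exp (-z * y) * (logDeriv riemannZeta s₂ * Complex.exp (-y)) = logDeriv riemannZeta s₂ * (Complex.exp (-z * y) * Complex.exp ((-1:ℂ) * y)) := by
          intro y; rw [neg_one_mul]; ring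
        simp_rw [this]
        rw [integral_const_mul, laplace_exp hz (by simp; norm_num)]
        rw [sub_neg_eq_add]; ring
      have e3 : ∫ y in Ioi (0:ℝ), Complex.exp (-z * y) * PS t y =
          (-logDeriv riemannZeta s₁ - (-logDeriv riemannZeta s)) / (z - 1) + (-logDeriv riemannZeta s) / (z + 1) := by
        refine (pl z hz).unique ?_
        have g1 := vM_hasSum (s := s₁) (by rw [rr_re]; norm_num)
        have g2 := vM_hasSum (s := s) (by rw [hsre]; norm_num)
        refine (((g1.sub g2).div_const (z - 1)).add (g2.div_const (z + 1))).congr_fun ?_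
        intro n
        have : ∀ y : ℝ, Complex.exp (-z * y) * ((ac y n : ℂ) * Complex.exp (-(t * Real.log n) * I)) =
            ((ArithmeticFunction.vonMangoldt n : ℂ) * Complex.exp (-c * Real.log n)) * (Complex.exp (-z * y) * (Real.exp (-|y - Real.log n|) : ℂ)) := by
          intro y; unfold ac
          rw [show -c * Real.log n = (-(Real.log n)/2 : ℂ) + (-(t * Real.log n) * I) by rw [hc]; ring, Complex.exp_add,
            sub_eq_add_neg (-Real.log n / 2), Real.exp_add]
          push_cast; ring
        simp_rw [this]
        rw [integral_const_mul, laplace_peak hz (log_nat_nonneg n)]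
        rw [show -s₁ * Real.log n = -c * Real.log n + (-Real.log n) by rw [hs₁, hc]; ring,
          show -s * Real.log n = -c * Real.log n + (-z * Real.log n) by rw [hs]; ring, Complex.exp_add, Complex.exp_add]
        ring
      have hzs : riemannZeta s ≠ 0 := riemannZeta_ne_zero_of_one_lt_re (by rw [hsre]; norm_num)
      have hzs1 : riemannZeta s₁ ≠ 0 := riemannZeta_ne_zero_of_one_lt_re (by rw [rr_re]; norm_num)
      rw [logDeriv_zeta1 (sub_ne_zero.1 n11) hzs1, logDeriv_zeta1 (sub_ne_zero.1 n12) (zeta_left_id t).1,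
        logDeriv_zeta1 (sub_ne_zero.1 n13) hzs] at e1
      rw [integral_add, integral_sub, integral_add, e1, e2, e3, e4]
      · ring
      · exact ip
      · exact il
      · exact iz
      · exact ie
      · exact iz.sub ie
      · exact ip.add il) y hy
  have : PS t y + logDeriv riemannZeta s₂ * Complex.exp (-y) + (ZS t y - kz t 1 * Complex.exp ((1/2 - t * I) * y)) = 0 := by
    rw [add_comm]; exact key
  linear_combination this
end PC

namespace PC

/-- multiplicity of ordinates on the critical line -/
def MM (g : ℝ) : ℕ := mm (1/2 + g * I)

def CT : ℝ := ∑' a : ℂ, 4 * ((mm a : ℝ) * (1 / (1 + ‖a‖)^2))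

lemma CT_nonneg : 0 ≤ CT := tsum_nonneg fun a => by positivity

def cl (g : ℝ) : ℂ := 1/2 + g * I
lemma cl_inj : Function.Injective cl := by
  intro a b h
  have := congrArg Complex.im h
  simpa [cl] using this

lemma kz_line (t g : ℝ) : kz t (cl g) = ((2 / (1 + (t - g)^2) : ℝ) : ℂ) := by
  unfold kz cl
  have h1 : (3/2 + t * I - (1/2 + g * I) : ℂ) = 1 + ((t - g : ℝ) : ℂ) * I := by push_cast; ring
  have h2 : (-1/2 + t * I - (1/2 + g * I) : ℂ) = -1 + ((t - g : ℝ) : ℂ) * I := by push_cast; ring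
  rw [h1, h2]
  set u := t - g
  have n1 : (1 + (u:ℂ) * I) ≠ 0 := by
    intro h; have := congrArg Complex.re h; simp at this
  have n2 : (-1 + (u:ℂ) * I) ≠ 0 := by
    intro h; have := congrArg Complex.re h; simp at this
  have n3 : (1 + (u:ℂ)^2) ≠ 0 := by
    have : (0:ℝ) < 1 + u^2 := by positivity
    exact_mod_cast this.ne'
  push_cast
  field_simp
  have := Complex.I_sq
  linear_combination (-2 * (u:ℂ)^2) * this

/-- the zero term on the line -/
def gterm (t y g : ℝ) : ℂ := (MM g : ℂ) * ((2 / (1 + (t - g)^2) : ℝ) : ℂ) * Complex.exp (((g - t) * y : ℝ) * I)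

lemma zterm_line (t y g : ℝ) : zterm t y (cl g) = gterm t y g := by
  unfold zterm gterm
  rw [kz_line]
  congr 2
  unfold cl; push_cast; ring

lemma kz_triv (t : ℝ) (n : ℕ) : ‖kz t (-2 * (n + 1))‖ ≤ 4 * (1 / (1 + ‖(-2 * (n + 1) : ℂ)‖)^2) := by
  have hn : (0:ℝ) ≤ n := n.cast_nonneg
  have e : ‖(-2 * (n + 1) : ℂ)‖ = 2 * (n + 1) := by
    rw [norm_mul, show ((n:ℂ) + 1) = ((n + 1 : ℕ) : ℂ) by push_cast; ring, Complex.norm_natCast]; simp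
  rw [e]
  set s₁ : ℂ := 3/2 + t * I - (-2 * (n + 1)) with h1
  set s₂ : ℂ := -1/2 + t * I - (-2 * (n + 1)) with h2
  have r1 : 2 * n + 7/2 ≤ ‖s₁‖ := by
    refine le_trans (le_of_eq ?_) (Complex.re_le_norm _)
    simp [h1]; ring
  have r2 : 2 * n + 3/2 ≤ ‖s₂‖ := by
    refine le_trans (le_of_eq ?_) (Complex.re_le_norm _)
    simp [h2]; ring
  have n1 : s₁ ≠ 0 := norm_pos_iff.1 (by linarith)
  have n2 : s₂ ≠ 0 := norm_pos_iff.1 (by linarith)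
  have : kz t (-2 * (n+1)) = -2 / (s₁ * s₂) := by
    unfold kz
    rw [← h1, ← h2]
    field_simp
    rw [h1, h2]; ring
  rw [this, norm_div, norm_neg, norm_mul, Complex.norm_two]
  have h3 : (2 * n + 7/2) * (2 * n + 3/2) ≤ ‖s₁‖ * ‖s₂‖ := by gcongr
  have h4 : (0:ℝ) < (2 * n + 7/2) * (2 * n + 3/2) := by positivity
  rw [mul_one_div, div_le_div_iff₀ (by linarith) (by positivity)]
  nlinarith

lemma zterm_summable (hRH : RiemannHypothesis) (t : ℝ) {y : ℝ} (hy : 0 ≤ y) : Summable (zterm t y) := by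
  refine Summable.of_norm_bounded (kz_hasSum t).summable.norm fun a => ?_
  unfold zterm
  by_cases h : mm a = 0
  · simp [h]
  rw [norm_mul]
  refine mul_le_of_le_one_right (norm_nonneg _) ?_
  rw [Complex.norm_exp, Real.exp_le_one_iff]
  have := Z_re_le hRH ⟨a, h⟩
  simp at this ⊢
  nlinarith

lemma ZS_eq (t y : ℝ) : ZS t y = ∑' a : ℂ, zterm t y a := by
  unfold ZS
  exact tsum_subtype_eq_of_support_subset (f := zterm t y) (s := {a | mm a ≠ 0}) (by
    intro a ha h; apply ha; simp [zterm, h])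

lemma gterm_summable (hRH : RiemannHypothesis) (t : ℝ) {y : ℝ} (hy : 0 ≤ y) : Summable (gterm t y) := by
  have := (zterm_summable hRH t hy).comp_injective cl_inj
  refine this.congr fun g => zterm_line t y g

def bz (t y : ℝ) : ℂ := ∑' g : ℝ, gterm t y g

lemma split_sum (hRH : RiemannHypothesis) (t : ℝ) {y : ℝ} (hy : 0 ≤ y) : ‖ZS t y - bz t y‖ ≤ CT := by
  have h1 := zterm_summable hRH t hy
  have h2 := h1.tsum_subtype_add_tsum_subtype_compl (Set.range cl)
  have h3 : bz t y = ∑' a : Set.range cl, zterm t y a := by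
    unfold bz
    rw [tsum_range (zterm t y) cl_inj]
    exact tsum_congr fun g => (zterm_line t y g).symm
  rw [ZS_eq, ← h2, ← h3, add_sub_cancel_left]
  have hs : Summable fun a : ℂ => 4 * ((mm a : ℝ) * (1 / (1 + ‖a‖)^2)) := mm_summable.mul_left 4
  have hb : ∀ a : ((Set.range cl)ᶜ : Set ℂ), ‖zterm t y a‖ ≤ 4 * ((mm (a:ℂ) : ℝ) * (1 / (1 + ‖(a:ℂ)‖)^2)) := by
    rintro ⟨a, ha⟩
    by_cases h : mm a = 0
    · simp [zterm, h]
    rcases Z_re hRH ⟨a, h⟩ with h' | ⟨n, h'⟩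
    · exact absurd ⟨a.im, by
        have h'' : a.re = 1/2 := h'
        apply Complex.ext <;> simp [cl, h'']⟩ ha
    · simp only at h'
      simp only
      have hk := kz_triv t n
      rw [← h'] at hk
      unfold zterm
      rw [norm_mul, norm_mul, Complex.norm_natCast, Complex.norm_exp]
      have : Real.exp ((a - (1/2 + t * I)) * y : ℂ).re ≤ 1 := by
        rw [Real.exp_le_one_iff]
        have := Z_re_le hRH ⟨a, h⟩
        simp at this ⊢
        nlinarith
      calc (mm a : ℝ) * ‖kz t a‖ * Real.exp ((a - (1/2 + t * I)) * y : ℂ).re ≤ mm a * ‖kz t a‖ :=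
            mul_le_of_le_one_right (by positivity) this
        _ ≤ mm a * (4 * (1 / (1 + ‖a‖)^2)) := by gcongr
        _ = _ := by ring
  refine (tsum_of_norm_bounded (hs.subtype _).hasSum hb).trans ?_
  exact hs.tsum_subtype_le _ _ (fun a => by positivity)

def SS (t : ℝ) : ℝ := ∑' g : ℝ, (MM g : ℝ) * (2 / (1 + (t - g)^2))

lemma norm_gterm (t y g : ℝ) : ‖gterm t y g‖ = (MM g : ℝ) * (2 / (1 + (t - g)^2)) := by
  unfold gterm
  rw [norm_mul, norm_mul, Complex.norm_natCast, Complex.norm_exp_ofReal_mul_I, Complex.norm_real, Real.norm_of_nonneg (by positivity), mul_one]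

lemma SS_summable (hRH : RiemannHypothesis) (t : ℝ) : Summable fun g : ℝ => (MM g : ℝ) * (2 / (1 + (t - g)^2)) :=
  (gterm_summable hRH t (le_refl 0)).norm.congr fun g => norm_gterm t 0 g

def C0 : ℝ := CT + CS + CL + 3

lemma SS_est (hRH : RiemannHypothesis) (t : ℝ) : |SS t - Real.log (1 + |t|)| ≤ C0 := by
  have h1 := split_sum hRH t (le_refl 0)
  have hbz : bz t 0 = (SS t : ℂ) := by
    unfold bz SS
    rw [Complex.ofReal_tsum]
    refine tsum_congr fun g => ?_
    simp [gterm]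
  have hzs : ZS t 0 = logDeriv riemannZeta₁ (3/2 + t*I) - logDeriv riemannZeta₁ (-1/2 + t*I) := by
    rw [ZS_eq, ← (kz_hasSum t).tsum_eq]
    refine tsum_congr fun a => ?_
    simp [zterm]
  have n11 : (3/2 + t * I : ℂ) ≠ 1 := by
    intro h; have := congrArg Complex.re h; simp at this; norm_num at this
  have hzs1 : riemannZeta (3/2 + t * I) ≠ 0 := riemannZeta_ne_zero_of_one_lt_re (by rw [rr_re]; norm_num)
  rw [logDeriv_zeta1 n11 hzs1, logDeriv_zeta1 (left_ne_one t) (zeta_left_id t).1] at hzs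
  rw [hzs, hbz] at h1
  have b1 : ‖1 / ((3/2 + t * I : ℂ) - 1)‖ ≤ 2 := by
    rw [norm_div, norm_one, div_le_iff₀ (norm_pos_iff.2 (sub_ne_zero.2 n11))]
    have := Complex.re_le_norm ((3/2 + t * I : ℂ) - 1)
    simp at this
    linarith
  have b2 : ‖1 / ((-1/2 + t * I : ℂ) - 1)‖ ≤ 1 := by
    rw [norm_div, norm_one, div_le_iff₀ (norm_pos_iff.2 (sub_ne_zero.2 (left_ne_one t)))]
    have := Complex.abs_re_le_norm ((-1/2 + t * I : ℂ) - 1)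
    simp at this
    rw [abs_of_nonpos (by norm_num)] at this
    linarith
  have b3 := logDeriv_zeta_bound (s := 3/2 + t * I) (rr_re t)
  have b4 := zeta_left_bound t
  have e : ((SS t - Real.log (1 + |t|) : ℝ) : ℂ) =
     -((1 / ((3/2 + t * I : ℂ) - 1) + logDeriv riemannZeta (3/2 + t * I) - (1 / ((-1/2 + t * I : ℂ) - 1) + logDeriv riemannZeta (-1/2 + t * I))) - (SS t : ℂ))
     + (1 / ((3/2 + t * I : ℂ) - 1) + logDeriv riemannZeta (3/2 + t * I) + (-(1 / ((-1/2 + t * I : ℂ) - 1))) + (-logDeriv riemannZeta (-1/2 + t * I) - (Real.log (1 + |t|) : ℂ))) := by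
    push_cast; ring
  rw [← Real.norm_eq_abs, ← Complex.norm_real, e]
  refine (norm_add_le _ _).trans ?_
  rw [norm_neg]
  have := norm_add_le (1 / ((3/2 + t * I : ℂ) - 1) + logDeriv riemannZeta (3/2 + t * I) + (-(1 / ((-1/2 + t * I : ℂ) - 1)))) (-logDeriv riemannZeta (-1/2 + t * I) - (Real.log (1 + |t|) : ℂ))
  have h5 := norm_add_le (1 / ((3/2 + t * I : ℂ) - 1) + logDeriv riemannZeta (3/2 + t * I)) (-(1 / ((-1/2 + t * I : ℂ) - 1)))
  have h6 := norm_add_le (1 / ((3/2 + t * I : ℂ) - 1)) (logDeriv riemannZeta (3/2 + t * I))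
  rw [norm_neg] at h5
  unfold C0
  linarith

lemma kz_one (t : ℝ) : ‖kz t 1‖ ≤ 4 / (1 + t^2) := by
  set s₁ : ℂ := 3/2 + t * I - 1 with h1
  set s₂ : ℂ := -1/2 + t * I - 1 with h2
  have q1 : ‖s₁‖^2 = 1/4 + t^2 := by
    rw [Complex.sq_norm, Complex.normSq_apply]; simp [h1]; ring
  have q2 : ‖s₂‖^2 = 9/4 + t^2 := by
    rw [Complex.sq_norm, Complex.normSq_apply]; simp [h2]; ring
  have p1 : 0 < ‖s₁‖ := by
    by_contra h; have : ‖s₁‖ = 0 := le_antisymm (not_lt.1 h) (norm_nonneg _)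
    rw [this] at q1; nlinarith
  have p2 : 0 < ‖s₂‖ := by
    by_contra h; have : ‖s₂‖ = 0 := le_antisymm (not_lt.1 h) (norm_nonneg _)
    rw [this] at q2; nlinarith
  have n1 : s₁ ≠ 0 := norm_pos_iff.1 p1
  have n2 : s₂ ≠ 0 := norm_pos_iff.1 p2
  have : kz t 1 = -2 / (s₁ * s₂) := by
    unfold kz
    rw [← h1, ← h2]
    field_simp
    rw [h1, h2]; ring
  rw [this, norm_div, norm_neg, norm_mul, Complex.norm_two, div_le_div_iff₀ (by positivity) (by positivity)]
  have : (1 + t^2) / 2 ≤ ‖s₁‖ * ‖s₂‖ := by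
    refine le_of_sq_le_sq ?_ (by positivity)
    rw [mul_pow, q1, q2]; nlinarith [sq_nonneg t, sq_nonneg (t^2)]
  linarith

/-- main approximate formula -/
lemma bz_formula (hRH : RiemannHypothesis) (t : ℝ) {y : ℝ} (hy : 0 < y) :
    ‖bz t y - (-PS t y + ((Real.log (1 + |t|) * Real.exp (-y) : ℝ) : ℂ))‖ ≤ CT + CS + 4 / (1 + t^2) * Real.exp (y/2) := by
  have h1 := split_sum hRH t hy.le
  have h2 := explicit_formula hRH t hy
  have h3 := zeta_left_bound t
  have h4 := kz_one t
  have e : bz t y - (-PS t y + ((Real.log (1 + |t|) * Real.exp (-y) : ℝ) : ℂ)) =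
    -(ZS t y - bz t y) + (-logDeriv riemannZeta (-1/2 + t * I) - (Real.log (1 + |t|) : ℂ)) * Complex.exp (-y)
     + kz t 1 * Complex.exp ((1/2 - t * I) * y) := by
    push_cast
    linear_combination h2
  rw [e]
  refine (norm_add_le _ _).trans (add_le_add ((norm_add_le _ _).trans (add_le_add ?_ ?_)) ?_)
  · rw [norm_neg]; exact h1
  · rw [norm_mul, Complex.norm_exp]
    have : Real.exp ((-(y:ℂ)).re) ≤ 1 := by rw [Real.exp_le_one_iff]; simp [hy.le]
    calc _ ≤ CS * 1 := by
          refine mul_le_mul h3 this (Real.exp_pos _).le ((norm_nonneg _).trans h3)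
      _ = CS := mul_one _
  · rw [norm_mul, Complex.norm_exp]
    refine mul_le_mul h4 (Real.exp_le_exp.2 ?_) (Real.exp_pos _).le (by positivity)
    simp; linarith
end PC

namespace PC

lemma zint_fin (X : ℝ) : {g : ℝ | |g| ≤ X ∧ MM g ≠ 0}.Finite := by
  refine Set.Finite.of_finite_image (f := cl) ((mm_fin (1/2 + X)).subset ?_) cl_inj.injOn
  rintro _ ⟨g, ⟨h1, h2⟩, rfl⟩
  refine ⟨?_, h2⟩
  rw [Metric.mem_closedBall, dist_zero_right]
  unfold cl
  refine (norm_add_le _ _).trans ?_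
  rw [norm_mul, Complex.norm_I, Complex.norm_real, Real.norm_eq_abs]
  norm_num
  linarith

def zint (X : ℝ) : Finset ℝ := (zint_fin X).toFinset
lemma mem_zint {X g : ℝ} : g ∈ zint X ↔ |g| ≤ X ∧ MM g ≠ 0 := by simp [zint]

lemma zset_fin (T : ℝ) : {g : ℝ | 0 < g ∧ g ≤ T ∧ MM g ≠ 0}.Finite :=
  (zint_fin T).subset fun g ⟨h1, h2, h3⟩ => ⟨by rw [abs_of_pos h1]; exact h2, h3⟩

def zset (T : ℝ) : Finset ℝ := (zset_fin T).toFinset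
lemma mem_zset {T g : ℝ} : g ∈ zset T ↔ 0 < g ∧ g ≤ T ∧ MM g ≠ 0 := by simp [zset]

def NT (T : ℝ) : ℝ := ∑ g ∈ zset T, (MM g : ℝ)
lemma NT_nonneg (T : ℝ) : 0 ≤ NT T := Finset.sum_nonneg fun _ _ => by positivity

lemma SS_le (hRH : RiemannHypothesis) (t : ℝ) : SS t ≤ Real.log (1 + |t|) + C0 := by
  have := (abs_le.1 (SS_est hRH t)).2; linarith
lemma SS_ge (hRH : RiemannHypothesis) (t : ℝ) : Real.log (1 + |t|) - C0 ≤ SS t := by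
  have := (abs_le.1 (SS_est hRH t)).1; linarith
lemma SS_nonneg (t : ℝ) : 0 ≤ SS t := tsum_nonneg fun g => by positivity
lemma C0_nonneg (hRH : RiemannHypothesis) : 0 ≤ C0 := (abs_nonneg _).trans (SS_est hRH 0)

lemma sum_le_SS (hRH : RiemannHypothesis) (t : ℝ) (A : Finset ℝ) :
    ∑ g ∈ A, (MM g : ℝ) * (2 / (1 + (t - g)^2)) ≤ SS t :=
  (SS_summable hRH t).sum_le_tsum _ fun g _ => by positivity

lemma count_le (hRH : RiemannHypothesis) {X : ℝ} (hX : 0 ≤ X) :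
    ∑ g ∈ zint X, (MM g : ℝ) ≤ (2 * X + 5) * (Real.log (3 + X) + C0) := by
  set J : Finset ℤ := Finset.Icc (-⌈X⌉) ⌈X⌉ with hJ
  have h1 : ∑ g ∈ zint X, (MM g : ℝ) ≤ ∑ g ∈ zint X, ∑ j ∈ J, (MM g : ℝ) * (2 / (1 + ((j:ℝ) - g)^2)) := by
    refine Finset.sum_le_sum fun g hg => ?_
    obtain ⟨hg1, hg2⟩ := mem_zint.1 hg
    obtain ⟨hga, hgb⟩ := abs_le.1 hg1
    have hmem : ⌈g⌉ ∈ J := by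
      rw [hJ, Finset.mem_Icc]
      refine ⟨?_, Int.ceil_le_ceil hgb⟩
      rw [neg_le, ← Int.floor_neg]
      exact (Int.floor_le_ceil _).trans (Int.ceil_le_ceil (by linarith))
    refine le_trans ?_ (Finset.single_le_sum (f := fun j : ℤ => (MM g : ℝ) * (2 / (1 + ((j:ℝ) - g)^2))) (fun j _ => by positivity) hmem)
    refine le_mul_of_one_le_right (by positivity) ?_
    rw [le_div_iff₀ (by positivity)]
    have a1 := Int.le_ceil g
    have a2 := Int.ceil_lt_add_one g
    nlinarith
  refine h1.trans ?_
  rw [Finset.sum_comm]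
  have hb : ∀ j ∈ J, ∑ g ∈ zint X, (MM g : ℝ) * (2 / (1 + ((j:ℝ) - g)^2)) ≤ Real.log (3 + X) + C0 := by
    intro j hj
    refine (sum_le_SS hRH j _).trans ((SS_le hRH j).trans ?_)
    have hj' : |(j:ℝ)| ≤ X + 1 := by
      rw [hJ, Finset.mem_Icc] at hj
      have hc := (Int.ceil_lt_add_one X).le
      have a1 : (j:ℝ) ≤ ⌈X⌉ := by exact_mod_cast hj.2
      have a2 : -(⌈X⌉:ℝ) ≤ j := by exact_mod_cast hj.1
      rw [abs_le]; constructor <;> linarith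
    have : Real.log (1 + |(j:ℝ)|) ≤ Real.log (3 + X) := Real.log_le_log (by positivity) (by linarith)
    linarith
  refine (Finset.sum_le_card_nsmul _ _ _ hb).trans ?_
  rw [nsmul_eq_mul]
  have hc0 := C0_nonneg hRH
  have hl : 0 ≤ Real.log (3 + X) := Real.log_nonneg (by linarith)
  refine mul_le_mul_of_nonneg_right ?_ (by positivity)
  rw [hJ, Int.card_Icc]
  have hc := (Int.ceil_lt_add_one X).le
  have hn : 0 ≤ ⌈X⌉ := Int.ceil_nonneg hX
  have : ((⌈X⌉ + 1 - -⌈X⌉).toNat : ℝ) = 2 * ⌈X⌉ + 1 := by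
    have : ((⌈X⌉ + 1 - -⌈X⌉).toNat : ℤ) = 2 * ⌈X⌉ + 1 := by
      rw [Int.toNat_of_nonneg (by linarith)]; ring
    exact_mod_cast this
  rw [this]; linarith

lemma NT_le (hRH : RiemannHypothesis) {T : ℝ} (hT : 0 ≤ T) : NT T ≤ (2 * T + 5) * (Real.log (3 + T) + C0) := by
  refine le_trans ?_ (count_le hRH hT)
  refine Finset.sum_le_sum_of_subset_of_nonneg ?_ fun _ _ _ => by positivity
  intro g hg
  obtain ⟨h1, h2, h3⟩ := mem_zset.1 hg
  exact mem_zint.2 ⟨by rw [abs_of_pos h1]; exact h2, h3⟩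

/-! Cauchy kernel integral -/
lemma cauchy_prod_integrable (a b : ℝ) : Integrable fun t : ℝ => 1 / ((1 + (t - a)^2) * (1 + (t - b)^2)) := by
  have h := (integrable_inv_one_add_sq).comp_sub_right a
  refine h.mono' (by
    refine Continuous.aestronglyMeasurable ?_
    refine continuous_const.div (by fun_prop) fun t => by positivity) ?_
  refine Eventually.of_forall fun t => ?_
  rw [Real.norm_of_nonneg (by positivity), one_div]
  refine inv_anti₀ (by positivity) ?_
  have : 0 ≤ (t-b)^2 := sq_nonneg _
  have : 0 ≤ (t-a)^2 := sq_nonneg _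
  nlinarith

lemma tendsto_arctan_shift (d : ℝ) : Tendsto (fun u : ℝ => Real.arctan (u + d)) atTop (nhds (π/2)) ∧
    Tendsto (fun u : ℝ => Real.arctan (u + d)) atBot (nhds (-(π/2))) := by
  constructor
  · exact (tendsto_nhds_of_tendsto_nhdsWithin Real.tendsto_arctan_atTop).comp (tendsto_atTop_add_const_right _ d tendsto_id)
  · exact (tendsto_nhds_of_tendsto_nhdsWithin Real.tendsto_arctan_atBot).comp (tendsto_atBot_add_const_right _ d tendsto_id)

lemma tendsto_ratio (d : ℝ) {l : Filter ℝ} (hl : Tendsto (fun u : ℝ => u⁻¹) l (nhds 0)) (hne : ∀ᶠ u in l, u ≠ 0) :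
    Tendsto (fun u : ℝ => (1 + (u + d)^2) / (1 + u^2)) l (nhds 1) := by
  have h1 : Tendsto (fun u : ℝ => ((u⁻¹)^2 + (1 + d * u⁻¹)^2) / ((u⁻¹)^2 + 1)) l (nhds ((0^2 + (1 + d * 0)^2) / (0^2 + 1))) := by
    refine Tendsto.div ((hl.pow 2).add ((tendsto_const_nhds.add (hl.const_mul d)).pow 2)) ((hl.pow 2).add tendsto_const_nhds) (by norm_num)
  norm_num at h1
  refine h1.congr' ?_
  filter_upwards [hne] with u hu
  field_simp

lemma cauchy_prod_integral (a b : ℝ) : ∫ t : ℝ, 1 / ((1 + (t - a)^2) * (1 + (t - b)^2)) = 2 * π / (4 + (a - b)^2) := by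
  set d := a - b with hd
  have e : ∫ t : ℝ, 1 / ((1 + (t - a)^2) * (1 + (t - b)^2)) = ∫ u : ℝ, 1 / ((1 + u^2) * (1 + (u + d)^2)) := by
    rw [← integral_sub_right_eq_self (fun u : ℝ => 1 / ((1 + u^2) * (1 + (u + d)^2))) a]
    refine integral_congr_ae (Eventually.of_forall fun t => ?_)
    simp only [hd]; congr 3; ring
  have hIntg : Integrable (fun u : ℝ => 1 / ((1 + u^2) * (1 + (u + d)^2))) := by
    have := cauchy_prod_integrable 0 (-d)
    simpa using this
  rw [e]
  have hat : Tendsto (fun u : ℝ => u⁻¹) atTop (nhds 0) := tendsto_inv_atTop_zero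
  have hab : Tendsto (fun u : ℝ => u⁻¹) atBot (nhds 0) := tendsto_inv_atBot_zero
  obtain ⟨at1, ab1⟩ := tendsto_arctan_shift 0
  simp only [add_zero] at at1 ab1
  by_cases h0 : d = 0
  · rw [h0]
    rw [h0] at hIntg
    simp only [add_zero] at hIntg ⊢
    have hder : ∀ u : ℝ, HasDerivAt (fun u : ℝ => (u / (1 + u^2) + Real.arctan u) / 2) (1 / ((1 + u^2) * (1 + u^2))) u := by
      intro u
      have hp : (1 + u^2) ≠ 0 := by positivity
      have h1 : HasDerivAt (fun u : ℝ => 1 + u^2) (2 * u) u := by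
        simpa using ((hasDerivAt_id u).pow 2).const_add 1
      have h2 := (((hasDerivAt_id u).div h1 hp).add (Real.hasDerivAt_arctan u)).div_const 2
      refine h2.congr_deriv ?_
      simp only [id]
      field_simp
      ring
    have hq : ∀ {l : Filter ℝ}, Tendsto (fun u : ℝ => u⁻¹) l (nhds 0) → (∀ᶠ u in l, u ≠ 0) → Tendsto (fun u : ℝ => u / (1 + u^2)) l (nhds 0) := by
      intro l hl hne
      have h1 : Tendsto (fun u : ℝ => (u⁻¹) / ((u⁻¹)^2 + 1)) l (nhds (0 / (0^2 + 1))) :=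
        hl.div ((hl.pow 2).add tendsto_const_nhds) (by norm_num)
      norm_num at h1
      refine h1.congr' ?_
      filter_upwards [hne] with u hu
      field_simp
    rw [integral_of_hasDerivAt_of_tendsto hder hIntg
      (((hq hab (eventually_ne_atBot 0)).add ab1).div_const 2) (((hq hat (eventually_ne_atTop 0)).add at1).div_const 2)]
    ring
  · obtain ⟨at2, ab2⟩ := tendsto_arctan_shift d
    have h4 : (4 + d^2) ≠ 0 := by positivity
    have hder : ∀ u : ℝ, HasDerivAt (fun u : ℝ => (Real.log ((1 + (u + d)^2) / (1 + u^2)) / d + (Real.arctan u + Real.arctan (u + d))) / (4 + d^2))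
        (1 / ((1 + u^2) * (1 + (u + d)^2))) u := by
      intro u
      have hp : (1 + u^2) ≠ 0 := by positivity
      have hp2 : (1 + (u+d)^2) ≠ 0 := by positivity
      have h0' : HasDerivAt (fun u : ℝ => u + d) 1 u := (hasDerivAt_id u).add_const d
      have h1 : HasDerivAt (fun u : ℝ => 1 + u^2) (2 * u) u := by
        simpa using ((hasDerivAt_id u).pow 2).const_add 1
      have h2 : HasDerivAt (fun u : ℝ => 1 + (u + d)^2) (2 * (u + d)) u := by
        simpa using (h0'.pow 2).const_add 1
      have h3 := ((((h2.div h1 hp).log (div_ne_zero hp2 hp)).div_const d).add ((Real.hasDerivAt_arctan u).add h0'.arctan)).div_const (4 + d^2)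
      refine h3.congr_deriv ?_
      simp only [Pi.div_apply]
      field_simp
      ring
    have hlog : ∀ {l : Filter ℝ}, Tendsto (fun u : ℝ => u⁻¹) l (nhds 0) → (∀ᶠ u in l, u ≠ 0) → Tendsto (fun u : ℝ => Real.log ((1 + (u + d)^2) / (1 + u^2)) / d) l (nhds 0) := by
      intro l hl hne
      have := ((tendsto_ratio d hl hne).log one_ne_zero).div_const d
      simpa using this
    rw [integral_of_hasDerivAt_of_tendsto hder hIntg
      (((hlog hab (eventually_ne_atBot 0)).add (ab1.add ab2)).div_const _) (((hlog hat (eventually_ne_atTop 0)).add (at1.add at2)).div_const _)]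
    field_simp
    ring
end PC

namespace PC

lemma cl_im (g : ℝ) : (cl g).im = g := by simp [cl]
lemma cl_re (g : ℝ) : (cl g).re = 1/2 := by simp [cl]
lemma cl_ne_one (g : ℝ) : cl g ≠ 1 := by
  intro h; have := congrArg Complex.re h; rw [cl_re] at this; norm_num at this

lemma zetaMult_cl (g : ℝ) : zetaMult (cl g) = MM g := by
  rw [zetaMult_eq (cl_ne_one g)]; rfl

lemma mem_zerosUpTo (hRH : RiemannHypothesis) {T : ℝ} {a : ℂ} : a ∈ zerosUpTo T ↔ ∃ g ∈ zset T, cl g = a := by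
  constructor
  · rintro ⟨⟨h1, h2, h3⟩, h4, h5⟩
    have hne : a ≠ 1 := by rintro rfl; simp at h3
    have hm : mm a ≠ 0 := mm_ne_zero_iff'.2 ⟨hne, h1⟩
    have hre : a.re = 1/2 := by
      rcases Z_re hRH ⟨a, hm⟩ with h | ⟨n, h⟩
      · exact h
      · simp only at h
        rw [h] at h2
        exfalso
        have : ((-2 * (n+1) : ℂ)).re = -2 * ((n:ℝ)+1) := by simp
        rw [this] at h2
        have : (0:ℝ) ≤ n := by positivity
        linarith
    have hcl : cl a.im = a := by
      apply Complex.ext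
      · rw [cl_re, hre]
      · rw [cl_im]
    refine ⟨a.im, mem_zset.2 ⟨h4, h5, ?_⟩, hcl⟩
    have : MM a.im = mm (cl a.im) := rfl
    rw [this, hcl]; exact hm
  · rintro ⟨g, hg, rfl⟩
    obtain ⟨h1, h2, h3⟩ := mem_zset.1 hg
    refine ⟨⟨(mm_ne_zero_iff'.1 h3).2, by rw [cl_re]; norm_num, by rw [cl_re]; norm_num⟩, by rw [cl_im]; exact h1, by rw [cl_im]; exact h2⟩

def zequiv (hRH : RiemannHypothesis) (T : ℝ) : zset T ≃ zerosUpTo T :=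
  Equiv.ofBijective (fun g => ⟨cl g, (mem_zerosUpTo hRH).2 ⟨g, g.2, rfl⟩⟩) <| by
    constructor
    · intro g h hgh
      exact Subtype.ext (cl_inj (congrArg Subtype.val hgh))
    · rintro ⟨a, ha⟩
      obtain ⟨g, hg, rfl⟩ := (mem_zerosUpTo hRH).1 ha
      exact ⟨⟨g, hg⟩, rfl⟩

lemma tsum_zeros (hRH : RiemannHypothesis) (T : ℝ) {E : Type*} [NormedAddCommGroup E] (f : ℂ → ℂ → E) :
    ∑' p : zerosUpTo T × zerosUpTo T, f p.1 p.2 = ∑ g ∈ zset T, ∑ h ∈ zset T, f (cl g) (cl h) := by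
  rw [← (Equiv.prodCongr (zequiv hRH T) (zequiv hRH T)).tsum_eq (fun p : zerosUpTo T × zerosUpTo T => f p.1 p.2)]
  rw [tsum_fintype, Fintype.sum_prod_type]
  rw [← Finset.sum_coe_sort (zset T)]
  refine Finset.sum_congr rfl fun g _ => ?_
  rw [← Finset.sum_coe_sort (zset T)]
  rfl

/-- the real version of `FF` -/
def FR (T a : ℝ) : ℝ := (T / (2 * π) * Real.log T)⁻¹ *
  ∑ g ∈ zset T, ∑ h ∈ zset T, (MM g * MM h : ℝ) * (4 / (4 + (g - h)^2)) * Real.cos ((g - h) * (a * Real.log T))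

def bT (T t y : ℝ) : ℂ := ∑ g ∈ zset T, gterm t y g

lemma Fxt_eq (hRH : RiemannHypothesis) {T : ℝ} (hT : 0 < T) (a : ℝ) : Fxt (T ^ a) T =
    ∑ g ∈ zset T, ∑ h ∈ zset T, ((MM g * MM h : ℝ) * (4 / (4 + (g - h)^2)) : ℝ) * Complex.exp (((g - h) * (a * Real.log T) : ℝ) * I) := by
  unfold Fxt
  rw [tsum_zeros hRH T (fun z w => (zetaMult z * zetaMult w : ℂ) *
      Complex.exp (Complex.I * (((z : ℂ).im - (w : ℂ).im : ℝ) : ℂ) * (Real.log (T^a) : ℂ)) *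
      ((4 / (4 + ((z : ℂ).im - (w : ℂ).im) ^ 2) : ℝ) : ℂ))]
  refine Finset.sum_congr rfl fun g _ => Finset.sum_congr rfl fun h _ => ?_
  rw [zetaMult_cl, zetaMult_cl, cl_im, cl_im, Real.log_rpow hT]
  push_cast
  rw [show Complex.I * ((g:ℂ) - h) * (a * (Real.log T : ℂ)) = (g - h) * (a * (Real.log T:ℂ)) * I by ring]
  ring

lemma sq_norm_bT (T t y : ℝ) : ((‖bT T t y‖^2 : ℝ) : ℂ) = ∑ g ∈ zset T, ∑ h ∈ zset T,
    ((MM g * MM h : ℝ) * 4 * (1 / ((1 + (t - g)^2) * (1 + (t - h)^2))) : ℝ) * Complex.exp (((g - h) * y : ℝ) * I) := by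
  rw [Complex.ofReal_pow, ← Complex.mul_conj', bT, map_sum, Finset.sum_mul_sum]
  refine Finset.sum_congr rfl fun g _ => Finset.sum_congr rfl fun h _ => ?_
  unfold gterm
  rw [map_mul, map_mul, ← Complex.exp_conj, map_mul, Complex.conj_I, Complex.conj_ofReal, Complex.conj_ofReal, Complex.conj_natCast]
  rw [show (((g - h) * y : ℝ) * I : ℂ) = ((g - t) * y : ℝ) * I + ((h - t) * y : ℝ) * -I by push_cast; ring, Complex.exp_add]
  push_cast
  field_simp
  ring

lemma bT_sq_integrable (T y : ℝ) : Integrable (fun t => ‖bT T t y‖^2) := by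
  have : Integrable (fun t => ((‖bT T t y‖^2 : ℝ) : ℂ)) := by
    simp_rw [sq_norm_bT]
    refine integrable_finsetSum _ fun g _ => integrable_finsetSum _ fun h _ => ?_
    exact (((cauchy_prod_integrable g h).const_mul _).ofReal).mul_const _
  exact this.re.congr (Eventually.of_forall fun t => Complex.ofReal_re _)

lemma FF_eq_int (hRH : RiemannHypothesis) {T : ℝ} (hT : 1 < T) (a : ℝ) :
    FF a T = (((T * Real.log T)⁻¹ * ∫ t, ‖bT T t (a * Real.log T)‖^2 : ℝ) : ℂ) := by
  have hL : 0 < Real.log T := Real.log_pos hT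
  rw [FF, Fxt_eq hRH (by linarith)]
  have key : ((∫ t, ‖bT T t (a * Real.log T)‖^2 : ℝ) : ℂ) = 2 * π * ∑ g ∈ zset T, ∑ h ∈ zset T,
      ((MM g * MM h : ℝ) * (4 / (4 + (g - h)^2)) : ℝ) * Complex.exp (((g - h) * (a * Real.log T) : ℝ) * I) := by
    rw [← integral_complex_ofReal]
    simp_rw [sq_norm_bT]
    rw [integral_finsetSum _ fun g _ => integrable_finsetSum _ fun h _ =>
      (((cauchy_prod_integrable g h).const_mul _).ofReal).mul_const _, Finset.mul_sum]
    refine Finset.sum_congr rfl fun g _ => ?_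
    rw [integral_finsetSum _ fun h _ =>
      (((cauchy_prod_integrable g h).const_mul _).ofReal).mul_const _, Finset.mul_sum]
    refine Finset.sum_congr rfl fun h _ => ?_
    rw [integral_mul_const, integral_complex_ofReal, integral_const_mul, cauchy_prod_integral]
    push_cast
    ring
  rw [Complex.ofReal_mul (T * Real.log T)⁻¹ _, key]
  generalize (∑ g ∈ zset T, ∑ h ∈ zset T,
      (((MM g * MM h : ℝ) * (4 / (4 + (g - h)^2)) : ℝ) : ℂ) * Complex.exp (((g - h) * (a * Real.log T) : ℝ) * I)) = X
  push_cast
  have h1 : (π:ℂ) ≠ 0 := by exact_mod_cast Real.pi_ne_zero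
  have h2 : (T:ℂ) ≠ 0 := by exact_mod_cast (by linarith : T ≠ 0)
  have h3 : (Real.log T:ℂ) ≠ 0 := by exact_mod_cast hL.ne'
  field_simp

lemma FF_eq (hRH : RiemannHypothesis) {T : ℝ} (hT : 1 < T) (a : ℝ) : FF a T = (FR T a : ℂ) := by
  have h1 : FF a T = ((FF a T).re : ℂ) := by rw [FF_eq_int hRH hT]; simp
  rw [h1]
  congr 1
  rw [FF, Fxt_eq hRH (by linarith), ← Complex.ofReal_inv, Complex.re_ofReal_mul, FR]
  congr 1
  rw [Complex.re_sum]
  refine Finset.sum_congr rfl fun g _ => ?_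
  rw [Complex.re_sum]
  refine Finset.sum_congr rfl fun h _ => ?_
  rw [Complex.re_ofReal_mul, Complex.exp_ofReal_mul_I_re]

lemma FR_eq_int (hRH : RiemannHypothesis) {T : ℝ} (hT : 1 < T) (a : ℝ) :
    FR T a = (T * Real.log T)⁻¹ * ∫ t, ‖bT T t (a * Real.log T)‖^2 := by
  have := FF_eq hRH hT a
  rw [FF_eq_int hRH hT] at this
  exact_mod_cast this.symm

lemma FR_nonneg (hRH : RiemannHypothesis) {T : ℝ} (hT : 1 < T) (a : ℝ) : 0 ≤ FR T a := by
  rw [FR_eq_int hRH hT]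
  have := Real.log_pos hT
  have : 0 ≤ ∫ t, ‖bT T t (a * Real.log T)‖^2 := integral_nonneg fun t => by positivity
  positivity

lemma FR_neg (T a : ℝ) : FR T (-a) = FR T a := by
  unfold FR
  congr 1
  refine Finset.sum_congr rfl fun g _ => Finset.sum_congr rfl fun h _ => ?_
  rw [show (g - h) * (-a * Real.log T) = -((g - h) * (a * Real.log T)) by ring, Real.cos_neg]

lemma FR_cont (T : ℝ) : Continuous (FR T) := by
  unfold FR; fun_prop

lemma Npair_eq (hRH : RiemannHypothesis) (T β : ℝ) : Npair T β = (T / (2 * π) * Real.log T)⁻¹ *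
    ∑ g ∈ zset T, ∑ h ∈ zset T, if 0 < h - g ∧ h - g ≤ 2 * π * β / Real.log T then (MM g * MM h : ℝ) else 0 := by
  unfold Npair
  rw [tsum_zeros hRH T (fun z w => if 0 < (w : ℂ).im - (z : ℂ).im ∧
          (w : ℂ).im - (z : ℂ).im ≤ 2 * π * β / Real.log T
      then (zetaMult z * zetaMult w : ℝ) else 0)]
  simp_rw [zetaMult_cl, cl_im]

end PC

namespace PC

def CC : ℝ := 3 + C0

lemma one_le_log {T : ℝ} (hT : 3 ≤ T) : 1 ≤ Real.log T := by
  rw [Real.le_log_iff_exp_le (by linarith)]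
  have := Real.exp_one_lt_d9
  linarith

lemma log_big (hRH : RiemannHypothesis) {T : ℝ} (hT : 3 ≤ T) : Real.log (3 + 2 * T) + C0 ≤ CC * Real.log T := by
  have h1 := one_le_log hT
  have h2 : Real.log (3 + 2 * T) ≤ 3 * Real.log T := by
    have : Real.log (3 + 2 * T) ≤ Real.log (T^3) := by
      apply Real.log_le_log (by linarith)
      nlinarith [sq_nonneg (T-3), mul_nonneg (by linarith : 0 ≤ T - 3) (by linarith : 0 ≤ T - 3), mul_nonneg (mul_nonneg (by linarith : 0 ≤ T - 3) (by linarith : 0 ≤ T - 3)) (by linarith : 0 ≤ T - 3)]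
    rwa [Real.log_pow] at this
  have h3 := C0_nonneg hRH
  unfold CC
  nlinarith

lemma CC_pos (hRH : RiemannHypothesis) : 0 < CC := by
  have := C0_nonneg hRH; unfold CC; linarith

lemma SS_le' (hRH : RiemannHypothesis) {T t : ℝ} (hT : 3 ≤ T) (ht : |t| ≤ 2 * T) : SS t ≤ CC * Real.log T := by
  refine (SS_le hRH t).trans (le_trans ?_ (log_big hRH hT))
  have : Real.log (1 + |t|) ≤ Real.log (3 + 2 * T) := Real.log_le_log (by positivity) (by linarith)
  linarith

lemma NT_le' (hRH : RiemannHypothesis) {T : ℝ} (hT : 3 ≤ T) : NT T ≤ 4 * T * (CC * Real.log T) := by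
  have h := one_le_log hT
  have hc := CC_pos hRH
  refine (NT_le hRH (by linarith)).trans (mul_le_mul (by linarith) ?_ ?_ (by positivity))
  · refine le_trans ?_ (log_big hRH hT)
    have : Real.log (3 + T) ≤ Real.log (3 + 2 * T) := Real.log_le_log (by linarith) (by linarith)
    linarith
  · have := C0_nonneg hRH
    have := Real.log_nonneg (by linarith : 1 ≤ 3 + T)
    linarith

lemma count_le' (hRH : RiemannHypothesis) {T : ℝ} (hT : 3 ≤ T) : ∑ g ∈ zint (2 * T), (MM g : ℝ) ≤ 6 * T * (CC * Real.log T) := by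
  have h := one_le_log hT
  have hc := CC_pos hRH
  refine (count_le hRH (by linarith)).trans (mul_le_mul (by linarith) (log_big hRH hT) ?_ (by positivity))
  have := C0_nonneg hRH
  have := Real.log_nonneg (by linarith : 1 ≤ 3 + 2 * T)
  linarith

lemma norm_bT_le (hRH : RiemannHypothesis) (T t y : ℝ) : ‖bT T t y‖ ≤ SS t := by
  refine (norm_sum_le _ _).trans ?_
  simp_rw [norm_gterm]
  exact sum_le_SS hRH t _

def tl (T t g : ℝ) : ℝ := if g ∈ zset T then 0 else (MM g : ℝ) * (2 / (1 + (t - g)^2))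

lemma tl_nonneg (T t g : ℝ) : 0 ≤ tl T t g := by unfold tl; split_ifs <;> positivity
lemma tl_le (T t g : ℝ) : tl T t g ≤ (MM g : ℝ) * (2 / (1 + (t - g)^2)) := by
  unfold tl; split_ifs
  · positivity
  · exact le_rfl

lemma tl_summable (hRH : RiemannHypothesis) (T t : ℝ) : Summable (tl T t) :=
  Summable.of_nonneg_of_le (tl_nonneg T t) (tl_le T t) (SS_summable hRH t)

lemma tail_le (hRH : RiemannHypothesis) (T t : ℝ) {y : ℝ} (hy : 0 ≤ y) :
    ‖bz t y - bT T t y‖ ≤ ∑' g, tl T t g := by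
  have h1 : bz t y - bT T t y = ∑' g, (gterm t y g - if g ∈ zset T then gterm t y g else 0) := by
    rw [Summable.tsum_sub (gterm_summable hRH t hy)]
    · congr 1
      rw [tsum_eq_sum (s := zset T)]
      · exact Finset.sum_congr rfl fun g hg => by rw [if_pos hg]
      · intro g hg; rw [if_neg hg]
    · exact summable_of_ne_finset_zero (s := zset T) fun g hg => by rw [if_neg hg]
  rw [h1]
  refine tsum_of_norm_bounded (tl_summable hRH T t).hasSum fun g => ?_
  unfold tl
  split_ifs
  · simp
  · rw [sub_zero, norm_gterm]

lemma tail_le_SS (hRH : RiemannHypothesis) (T t : ℝ) {y : ℝ} (hy : 0 ≤ y) :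
    ‖bz t y - bT T t y‖ ≤ SS t :=
  (tail_le hRH T t hy).trans ((tl_summable hRH T t).tsum_le_tsum (tl_le T t) (SS_summable hRH t))

lemma tail_mid (hRH : RiemannHypothesis) {T t y K : ℝ} (hy : 0 ≤ y) (hK : 0 < K) (h1 : K ≤ t) (h2 : t ≤ T - K) :
    ‖bz t y - bT T t y‖ ≤ 4 * SS 0 + 2 / K^2 * ∑ g ∈ zint (2 * T), (MM g : ℝ) := by
  refine (tail_le hRH T t hy).trans ?_
  have hs2 : HasSum (fun g => if g ∈ zint (2 * T) then 2 / K^2 * (MM g : ℝ) else 0) (2 / K^2 * ∑ g ∈ zint (2 * T), (MM g : ℝ)) := by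
    rw [Finset.mul_sum]
    have := hasSum_sum_of_ne_finset_zero (L := SummationFilter.unconditional ℝ) (f := fun g => if g ∈ zint (2 * T) then 2 / K^2 * (MM g : ℝ) else 0) (s := zint (2*T)) fun g hg => by rw [if_neg hg]
    convert this using 1
    exact Finset.sum_congr rfl fun g hg => by rw [if_pos hg]
  have hs := ((SS_summable hRH 0).hasSum.mul_left 4).add hs2
  refine hasSum_le (fun g => ?_) (tl_summable hRH T t).hasSum hs
  by_cases hg : g ∈ zset T
  · unfold tl
    rw [if_pos hg]
    split_ifs <;> positivity
  by_cases hM : MM g = 0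
  · unfold tl
    rw [if_neg hg, hM]
    simp
  have hfar : g ≤ 0 ∨ T < g := by
    by_contra hc
    push Not at hc
    exact hg (mem_zset.2 ⟨hc.1, hc.2, hM⟩)
  have hd : K^2 ≤ (t - g)^2 := by
    rcases hfar with h | h
    · apply pow_le_pow_left₀ hK.le; linarith
    · rw [← neg_sq (t - g)]; apply pow_le_pow_left₀ hK.le; linarith
  unfold tl
  rw [if_neg hg]
  by_cases hz : g ∈ zint (2 * T)
  · rw [if_pos hz]
    have : (MM g : ℝ) * (2 / (1 + (t - g)^2)) ≤ 2 / K^2 * (MM g : ℝ) := by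
      rw [mul_comm]
      gcongr
      linarith
    have : 0 ≤ 4 * ((MM g : ℝ) * (2 / (1 + (0 - g)^2))) := by positivity
    linarith
  · rw [if_neg hz, add_zero]
    have hb : 2 * T < |g| := by
      by_contra hc
      exact hz (mem_zint.2 ⟨by linarith, hM⟩)
    have hsq : g^2 / 4 ≤ (t - g)^2 := by
      have : |g| / 2 ≤ |t - g| := by
        have h3 : |g| ≤ |t - g| + |t| := by
          have := abs_sub_abs_le_abs_sub g t
          rw [abs_sub_comm] at this; linarith
        rw [abs_of_pos (by linarith : 0 < t)] at h3
        linarith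
      have := pow_le_pow_left₀ (by positivity) this 2
      rw [sq_abs, div_pow, sq_abs] at this
      linarith
    rw [show 4 * ((MM g : ℝ) * (2 / (1 + (0 - g)^2))) = (MM g : ℝ) * (2 / ((1 + g^2) / 4)) by field_simp; ring]
    gcongr
    linarith

lemma norm_bT_far {T t y : ℝ} (ht : t ≤ 0) : ‖bT T t y‖ ≤ 2 * NT T / (1 + t^2) := by
  refine (norm_sum_le _ _).trans ?_
  simp_rw [norm_gterm]
  rw [NT, mul_div_assoc, mul_comm, Finset.sum_div, Finset.sum_mul]
  refine Finset.sum_le_sum fun g hg => ?_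
  obtain ⟨h1, h2, -⟩ := mem_zset.1 hg
  rw [div_mul_eq_mul_div, ← mul_div_assoc]
  gcongr 1
  nlinarith [mul_nonneg h1.le (neg_nonneg.2 ht)]

lemma norm_bT_far' {T t y : ℝ} (ht : T ≤ t) : ‖bT T t y‖ ≤ 2 * NT T / (1 + (t - T)^2) := by
  refine (norm_sum_le _ _).trans ?_
  simp_rw [norm_gterm]
  rw [NT, mul_div_assoc, mul_comm, Finset.sum_div, Finset.sum_mul]
  refine Finset.sum_le_sum fun g hg => ?_
  obtain ⟨h1, h2, -⟩ := mem_zset.1 hg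
  rw [div_mul_eq_mul_div, ← mul_div_assoc]
  gcongr 1
  have : (t - T)^2 ≤ (t - g)^2 := pow_le_pow_left₀ (by linarith) (by linarith) 2
  linarith

lemma outside (hRH : RiemannHypothesis) {T y K : ℝ} (hT : 3 ≤ T) (hK : 0 < K) (hKT : K ≤ T) :
    |(∫ t, ‖bT T t y‖^2) - ∫ t in (0:ℝ)..T, ‖bT T t y‖^2| ≤ 2 * K * (CC * Real.log T)^2 + 8 * π * (NT T)^2 / K^2 := by
  have hi := bT_sq_integrable T y
  rw [intervalIntegral.integral_of_le (by linarith), ← integral_add_compl (measurableSet_Ioc (a := 0) (b := T)) hi, add_sub_cancel_left]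
  rw [abs_of_nonneg (integral_nonneg fun t => by positivity)]
  set D := 4 * (NT T)^2 / K^2 with hD
  have hD0 : 0 ≤ D := by positivity
  set M := (CC * Real.log T)^2 with hM
  have hM0 : 0 ≤ M := by positivity
  have i1 : Integrable (fun t : ℝ => (Icc (-K) 0).indicator (fun _ => M) t) :=
    (integrable_indicator_iff measurableSet_Icc).2 (integrableOn_const (by simp) )
  have i2 : Integrable (fun t : ℝ => (Icc T (T + K)).indicator (fun _ => M) t) :=
    (integrable_indicator_iff measurableSet_Icc).2 (integrableOn_const (by simp) )
  have i3 : Integrable (fun t : ℝ => D * (1 + t^2)⁻¹) := integrable_inv_one_add_sq.const_mul D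
  have i4 : Integrable (fun t : ℝ => D * (1 + (t - T)^2)⁻¹) := (integrable_inv_one_add_sq.comp_sub_right T).const_mul D
  have i12 : Integrable (fun t : ℝ => (Icc (-K) 0).indicator (fun _ => M) t + (Icc T (T + K)).indicator (fun _ => M) t) := i1.add i2
  have i123 : Integrable (fun t : ℝ => (Icc (-K) 0).indicator (fun _ => M) t + (Icc T (T + K)).indicator (fun _ => M) t + D * (1 + t^2)⁻¹) := i12.add i3
  have itot := i123.add i4
  have n1 : ∀ t, 0 ≤ (Icc (-K) 0).indicator (fun _ => M) t := fun t => indicator_nonneg (fun _ _ => hM0) t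
  have n2 : ∀ t, 0 ≤ (Icc T (T+K)).indicator (fun _ => M) t := fun t => indicator_nonneg (fun _ _ => hM0) t
  have hst : ∀ d : ℝ, K ≤ |d| → ∀ v : ℝ, 0 ≤ v → v ≤ 2 * NT T / (1 + d^2) → v^2 ≤ D * (1 + d^2)⁻¹ := by
    intro d hd v hv hvd
    refine (pow_le_pow_left₀ hv hvd 2).trans ?_
    rw [div_pow, hD, div_mul_eq_mul_div, ← div_eq_mul_inv, div_div, mul_pow, sq (1 + d^2)]
    rw [show (2:ℝ)^2 = 4 by norm_num]
    have : K^2 ≤ d^2 := by rw [← sq_abs d]; exact pow_le_pow_left₀ hK.le hd 2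
    apply div_le_div_of_nonneg_left (by positivity) (by positivity)
    nlinarith [sq_nonneg d]
  calc ∫ t in (Ioc 0 T)ᶜ, ‖bT T t y‖^2 ≤ ∫ t in (Ioc 0 T)ᶜ, ((Icc (-K) 0).indicator (fun _ => M) t + (Icc T (T + K)).indicator (fun _ => M) t + D * (1 + t^2)⁻¹ + D * (1 + (t - T)^2)⁻¹) := by
        refine setIntegral_mono_on hi.integrableOn itot.integrableOn measurableSet_Ioc.compl fun t ht => ?_
        have a3 : 0 ≤ D * (1 + t^2)⁻¹ := by positivity
        have a4 : 0 ≤ D * (1 + (t - T)^2)⁻¹ := by positivity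
        have b1 := n1 t
        have b2 := n2 t
        have hc : t ≤ 0 ∨ T < t := by
          by_contra hc
          push Not at hc
          exact ht ⟨hc.1, hc.2⟩
        rcases hc with h | h
        · by_cases hk : -K ≤ t
          · rw [indicator_of_mem (show t ∈ Icc (-K) 0 from ⟨hk, h⟩)]
            have : ‖bT T t y‖ ≤ CC * Real.log T := (norm_bT_le hRH T t y).trans (SS_le' hRH hT (by rw [abs_le]; constructor <;> linarith))
            have := pow_le_pow_left₀ (norm_nonneg _) this 2
            linarith
          · have := hst t (by rw [abs_of_nonpos h]; linarith) _ (norm_nonneg _) (norm_bT_far (T := T) (y := y) h)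
            linarith
        · by_cases hk : t ≤ T + K
          · rw [indicator_of_mem (show t ∈ Icc T (T + K) from ⟨h.le, hk⟩)]
            have : ‖bT T t y‖ ≤ CC * Real.log T := (norm_bT_le hRH T t y).trans (SS_le' hRH hT (by rw [abs_le]; constructor <;> linarith))
            have := pow_le_pow_left₀ (norm_nonneg _) this 2
            linarith
          · have := hst (t - T) (by rw [abs_of_nonneg (by linarith)]; linarith) _ (norm_nonneg _) (norm_bT_far' (T := T) (y := y) h.le)
            linarith
    _ ≤ ∫ t, ((Icc (-K) 0).indicator (fun _ => M) t + (Icc T (T + K)).indicator (fun _ => M) t + D * (1 + t^2)⁻¹ + D * (1 + (t - T)^2)⁻¹) := by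
        refine setIntegral_le_integral itot (Eventually.of_forall fun t => ?_)
        have a3 : 0 ≤ D * (1 + t^2)⁻¹ := by positivity
        have a4 : 0 ≤ D * (1 + (t - T)^2)⁻¹ := by positivity
        exact add_nonneg (add_nonneg (add_nonneg (n1 t) (n2 t)) a3) a4
    _ = 2 * K * M + 8 * π * (NT T)^2 / K^2 := by
        rw [integral_add i123 i4, integral_add i12 i3, integral_add i1 i2,
          integral_indicator measurableSet_Icc, integral_indicator measurableSet_Icc, integral_const_mul, integral_const_mul,
          integral_sub_right_eq_self (fun t : ℝ => (1 + t^2)⁻¹) T, integral_univ_inv_one_add_sq]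
        simp only [setIntegral_const, smul_eq_mul, Measure.real, Real.volume_Icc]
        rw [ENNReal.toReal_ofReal (by linarith), ENNReal.toReal_ofReal (by linarith), hD]
        ring

end PC

namespace PC

lemma PS_cont (y : ℝ) : Continuous (fun t : ℝ => PS t y) := by
  unfold PS
  refine continuous_tsum (fun n => by fun_prop) (ac_summable y) fun n t => ?_
  rw [norm_pterm]

lemma bT_cont (T y : ℝ) : Continuous (fun t : ℝ => bT T t y) := by
  unfold bT gterm
  refine continuous_finsetSum _ fun g _ => ?_
  have : Continuous fun t : ℝ => (2 / (1 + (t - g)^2) : ℝ) := by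
    refine continuous_const.div (by fun_prop) fun t => by positivity
  fun_prop

def C1 : ℝ := 4 * SS 0 + 24 * CC

lemma log_le_two_sqrt {T : ℝ} (hT : 0 < T) : Real.log T ≤ 2 * √T := by
  have := Real.log_le_self (Real.sqrt_nonneg T)
  rw [Real.log_sqrt hT.le] at this
  linarith

lemma K_sq {T : ℝ} (hT : 0 < T) : (T ^ (3/4:ℝ))^2 = T * √T := by
  rw [← Real.rpow_natCast, ← Real.rpow_mul hT.le, Real.sqrt_eq_rpow, ← Real.rpow_one_add' hT.le (by norm_num)]
  norm_num

lemma tail_sq (hRH : RiemannHypothesis) {T t y : ℝ} (hT : 3 ≤ T) (hy : 0 ≤ y) (h0 : 0 ≤ t) (h1 : t ≤ T) :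
    ‖bz t y - bT T t y‖^2 ≤ C1^2 + (Icc 0 (T^(3/4:ℝ))).indicator (fun _ => (CC * Real.log T)^2) t
      + (Icc (T - T^(3/4:ℝ)) T).indicator (fun _ => (CC * Real.log T)^2) t := by
  set K := T^(3/4:ℝ) with hK
  have hK0 : 0 < K := Real.rpow_pos_of_pos (by linarith) _
  have n1 : 0 ≤ (Icc 0 K).indicator (fun _ => (CC * Real.log T)^2) t := indicator_nonneg (fun _ _ => by positivity) t
  have n2 : 0 ≤ (Icc (T - K) T).indicator (fun _ => (CC * Real.log T)^2) t := indicator_nonneg (fun _ _ => by positivity) t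
  have hb : ‖bz t y - bT T t y‖^2 ≤ (CC * Real.log T)^2 := by
    apply pow_le_pow_left₀ (norm_nonneg _)
    exact (tail_le_SS hRH T t hy).trans (SS_le' hRH hT (by rw [abs_of_nonneg h0]; linarith))
  have hc1 : 0 ≤ C1^2 := by positivity
  by_cases hA : t ≤ K
  · rw [indicator_of_mem (show t ∈ Icc 0 K from ⟨h0, hA⟩)]
    linarith
  by_cases hB : T - K ≤ t
  · rw [indicator_of_mem (show t ∈ Icc (T - K) T from ⟨hB, h1⟩)]
    linarith
  push Not at hA hB
  have h2 : ‖bz t y - bT T t y‖ ≤ C1 := by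
    refine (tail_mid hRH hy hK0 hA.le hB.le).trans ?_
    unfold C1
    have hcc := CC_pos hRH
    have : 2 / K^2 * ∑ g ∈ zint (2 * T), (MM g : ℝ) ≤ 24 * CC := by
      calc _ ≤ 2 / K^2 * (6 * T * (CC * (2 * √T))) := by
            refine mul_le_mul_of_nonneg_left ((count_le' hRH hT).trans ?_) (by positivity)
            have := log_le_two_sqrt (by linarith : 0 < T)
            have : 0 < T := by linarith
            gcongr
        _ = 24 * CC := by
            rw [hK, K_sq (by linarith)]
            have : 0 < T := by linarith
            have : 0 < √T := Real.sqrt_pos.2 this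
            field_simp
            norm_num
    linarith
  have := pow_le_pow_left₀ (norm_nonneg _) h2 2
  linarith

lemma log_diff_sq {T t : ℝ} (hT : 3 ≤ T) (h0 : 0 ≤ t) (h1 : t ≤ T) :
    (Real.log (1 + |t|) - Real.log T)^2 ≤ 16 * (√(1 + T) / √(1 + t)) := by
  rw [abs_of_nonneg h0]
  set v := (1 + T) / (1 + t) with hv
  have hv1 : 1 ≤ v := by rw [hv, le_div_iff₀ (by linarith)]; linarith
  have hs : √(1 + T) / √(1 + t) = √v := by rw [hv, Real.sqrt_div (by linarith)]
  rw [hs]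
  have hss : 1 ≤ √(√v) := Real.one_le_sqrt.2 (Real.one_le_sqrt.2 hv1)
  have hlv : Real.log v ≤ 4 * √(√v) := by
    have := Real.log_le_self (Real.sqrt_nonneg (√v))
    rw [Real.log_sqrt (Real.sqrt_nonneg _), Real.log_sqrt (by linarith)] at this
    linarith
  have hld : Real.log v = Real.log (1 + T) - Real.log (1 + t) := by rw [hv, Real.log_div (by linarith) (by linarith)]
  have e1 : Real.log (1 + t) ≤ Real.log (1 + T) := Real.log_le_log (by linarith) (by linarith)
  have e2 : Real.log (1 + T) ≤ Real.log T + 1 := by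
    have : Real.log ((1 + T) / T) ≤ (1 + T) / T - 1 := Real.log_le_sub_one_of_pos (by positivity)
    rw [Real.log_div (by linarith) (by linarith)] at this
    have h3 : (1 + T) / T - 1 = 1 / T := by field_simp; ring
    have h4 : 1 / T ≤ 1 := by rw [div_le_one (by linarith)]; linarith
    linarith
  have e3 : Real.log T ≤ Real.log (1 + T) := Real.log_le_log (by linarith) (by linarith)
  have : |Real.log (1 + t) - Real.log T| ≤ 4 * √(√v) := by
    rw [abs_le]; constructor <;> linarith
  have h5 := pow_le_pow_left₀ (abs_nonneg _) this 2
  rw [sq_abs, mul_pow, Real.sq_sqrt (Real.sqrt_nonneg _)] at h5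
  linarith

lemma int_inv_sqrt {T : ℝ} (hT : 0 ≤ T) : IntervalIntegrable (fun t : ℝ => √(1 + T) / √(1 + t)) volume 0 T ∧
    ∫ t in (0:ℝ)..T, √(1 + T) / √(1 + t) ≤ 2 * (1 + T) := by
  have hc : ContinuousOn (fun t : ℝ => √(1 + T) / √(1 + t)) (uIcc 0 T) := by
    rw [uIcc_of_le hT]
    refine ContinuousOn.div (by fun_prop) (by fun_prop) fun t ht => ?_
    have : 0 < 1 + t := by linarith [ht.1]
    exact (Real.sqrt_pos.2 this).ne'
  refine ⟨hc.intervalIntegrable, ?_⟩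
  rw [intervalIntegral.integral_eq_sub_of_hasDerivAt (f := fun t => 2 * √(1 + T) * √(1 + t)) _ hc.intervalIntegrable]
  · have := Real.mul_self_sqrt (by linarith : 0 ≤ 1 + T)
    have := Real.sqrt_nonneg (1 + T)
    simp only [add_zero, Real.sqrt_one]
    nlinarith
  · intro t ht
    rw [uIcc_of_le hT] at ht
    have : 0 < 1 + t := by linarith [ht.1]
    have h := (((hasDerivAt_id t).const_add 1).sqrt this.ne').const_mul (2 * √(1 + T))
    have h8 := Real.sqrt_pos.2 this
    have h9 : √(1 + T) / √(1 + t) = 2 * √(1 + T) * (1 / (2 * √(1 + t))) := by field_simp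
    rw [h9]
    exact h

def EE (T y t : ℝ) : ℂ := bT T t y - (-PS t y + ((Real.log T * Real.exp (-y) : ℝ) : ℂ))

lemma EE_cont (T y : ℝ) : Continuous (EE T y) := by
  unfold EE
  have := PS_cont y
  have := bT_cont T y
  fun_prop

lemma EE_sq (hRH : RiemannHypothesis) {T t y : ℝ} (hT : 3 ≤ T) (hy : 0 < y) (hyL : y ≤ Real.log T) (h0 : 0 ≤ t) (h1 : t ≤ T) :
    ‖EE T y t‖^2 ≤ 4 * ((C1^2 + (Icc 0 (T^(3/4:ℝ))).indicator (fun _ => (CC * Real.log T)^2) t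
      + (Icc (T - T^(3/4:ℝ)) T).indicator (fun _ => (CC * Real.log T)^2) t) + (CT + CS)^2 + 16 * T * (1 + t^2)⁻¹
      + 16 * (√(1 + T) / √(1 + t))) := by
  have a1 := tail_sq hRH hT hy.le h0 h1
  have a2 := log_diff_sq hT h0 h1
  have a3 := bz_formula hRH t hy
  have hd : EE T y t = -(bz t y - bT T t y) + (bz t y - (-PS t y + ((Real.log (1+|t|) * Real.exp (-y):ℝ):ℂ)))
      + (((Real.log (1 + |t|) - Real.log T) * Real.exp (-y) : ℝ) : ℂ) := by
    unfold EE; push_cast; ring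
  have h4 : ‖(((Real.log (1 + |t|) - Real.log T) * Real.exp (-y) : ℝ) : ℂ)‖ ≤ |Real.log (1 + |t|) - Real.log T| := by
    rw [Complex.norm_real, Real.norm_eq_abs, abs_mul, abs_of_pos (Real.exp_pos _)]
    exact mul_le_of_le_one_right (abs_nonneg _) (Real.exp_le_one_iff.2 (by linarith))
  have h5 : ‖EE T y t‖ ≤ ‖bz t y - bT T t y‖ + (CT + CS) + 4 / (1 + t^2) * Real.exp (y/2) + |Real.log (1 + |t|) - Real.log T| := by
    rw [hd]
    refine (norm_add₃_le).trans ?_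
    rw [norm_neg]
    linarith
  have h6 : (4 / (1 + t^2) * Real.exp (y/2))^2 ≤ 16 * T * (1 + t^2)⁻¹ := by
    rw [mul_pow, ← Real.exp_nat_mul]
    have : Real.exp ((2:ℕ) * (y/2)) ≤ T := by
      rw [← Real.le_log_iff_exp_le (by linarith)]; push_cast; linarith
    calc (4 / (1 + t^2))^2 * Real.exp ((2:ℕ) * (y/2)) ≤ (4 / (1 + t^2))^2 * T := by gcongr
      _ = 16 * T * ((1 + t^2)⁻¹ * (1 + t^2)⁻¹) := by field_simp; ring
      _ ≤ 16 * T * ((1 + t^2)⁻¹ * 1) := by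
        have : (1 + t^2)⁻¹ ≤ 1 := inv_le_one_of_one_le₀ (by nlinarith)
        gcongr
      _ = _ := by ring
  have h7 := pow_le_pow_left₀ (norm_nonneg _) h5 2
  rw [← sq_abs (Real.log (1 + |t|) - Real.log T)] at a2
  set A := ‖bz t y - bT T t y‖
  set B := CT + CS
  set C := 4 / (1 + t^2) * Real.exp (y/2)
  set D := |Real.log (1 + |t|) - Real.log T|
  have h8 : (A + B + C + D)^2 ≤ 4 * (A^2 + B^2 + C^2 + D^2) := by
    nlinarith [sq_nonneg (A - B), sq_nonneg (A - C), sq_nonneg (A - D), sq_nonneg (B - C), sq_nonneg (B - D), sq_nonneg (C - D)]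
  linarith

def CE : ℝ := 4 * (C1^2 + (CT + CS)^2 + 16 * π + 64 + 2 * CC^2)

lemma CE_nonneg : 0 ≤ CE := by unfold CE; positivity

lemma EE_int (hRH : RiemannHypothesis) {T y : ℝ} (hT : 3 ≤ T) (hy : 0 < y) (hyL : y ≤ Real.log T) :
    ∫ t in (0:ℝ)..T, ‖EE T y t‖^2 ≤ CE * (T + T^(3/4:ℝ) * (Real.log T)^2) := by
  have hT0 : (0:ℝ) ≤ T := by linarith
  set K := T^(3/4:ℝ) with hK
  have hK0 : 0 < K := Real.rpow_pos_of_pos (by linarith) _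
  set M := (CC * Real.log T)^2 with hM
  have hM0 : 0 ≤ M := by positivity
  have i1 : Integrable (fun t : ℝ => (Icc 0 K).indicator (fun _ => M) t) :=
    (integrable_indicator_iff measurableSet_Icc).2 (integrableOn_const (by simp) )
  have i2 : Integrable (fun t : ℝ => (Icc (T - K) T).indicator (fun _ => M) t) :=
    (integrable_indicator_iff measurableSet_Icc).2 (integrableOn_const (by simp) )
  have i3 : Integrable (fun t : ℝ => 16 * T * (1 + t^2)⁻¹) := integrable_inv_one_add_sq.const_mul _
  obtain ⟨i4, b4⟩ := int_inv_sqrt hT0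
  have b1 : ∫ t in (0:ℝ)..T, (Icc 0 K).indicator (fun _ => M) t ≤ K * M := by
    rw [intervalIntegral.integral_of_le hT0]
    refine (setIntegral_le_integral i1 (Eventually.of_forall fun t => indicator_nonneg (fun _ _ => hM0) t)).trans ?_
    rw [integral_indicator measurableSet_Icc]
    simp only [setIntegral_const, smul_eq_mul, Measure.real, Real.volume_Icc]
    rw [ENNReal.toReal_ofReal (by linarith), sub_zero]
  have b2 : ∫ t in (0:ℝ)..T, (Icc (T - K) T).indicator (fun _ => M) t ≤ K * M := by
    rw [intervalIntegral.integral_of_le hT0]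
    refine (setIntegral_le_integral i2 (Eventually.of_forall fun t => indicator_nonneg (fun _ _ => hM0) t)).trans ?_
    rw [integral_indicator measurableSet_Icc]
    simp only [setIntegral_const, smul_eq_mul, Measure.real, Real.volume_Icc]
    rw [ENNReal.toReal_ofReal (by linarith), sub_sub_cancel]
  have b3 : ∫ t in (0:ℝ)..T, 16 * T * (1 + t^2)⁻¹ ≤ 16 * T * π := by
    rw [intervalIntegral.integral_of_le hT0]
    refine (setIntegral_le_integral i3 (Eventually.of_forall fun t => ?_)).trans ?_
    · change (0:ℝ) ≤ 16 * T * (1 + t^2)⁻¹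
      positivity
    · rw [integral_const_mul, integral_univ_inv_one_add_sq]
  have j1 := i1.intervalIntegrable (a := 0) (b := T)
  have j2 := i2.intervalIntegrable (a := 0) (b := T)
  have j3 := i3.intervalIntegrable (a := 0) (b := T)
  have jc : ∀ c : ℝ, IntervalIntegrable (fun _ : ℝ => c) volume 0 T := fun c => intervalIntegrable_const
  have k12 : IntervalIntegrable (fun t => C1^2 + (Icc 0 K).indicator (fun _ => M) t) volume 0 T := (jc _).add j1
  have k123 : IntervalIntegrable (fun t => C1^2 + (Icc 0 K).indicator (fun _ => M) t + (Icc (T - K) T).indicator (fun _ => M) t) volume 0 T := k12.add j2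
  have k4 : IntervalIntegrable (fun t => (C1^2 + (Icc 0 K).indicator (fun _ => M) t + (Icc (T - K) T).indicator (fun _ => M) t) + (CT + CS)^2) volume 0 T := k123.add (jc _)
  have k5 : IntervalIntegrable (fun t => (C1^2 + (Icc 0 K).indicator (fun _ => M) t + (Icc (T - K) T).indicator (fun _ => M) t) + (CT + CS)^2 + 16 * T * (1 + t^2)⁻¹) volume 0 T := k4.add j3
  have k6 := k5.add (i4.const_mul 16)
  have hIntg : IntervalIntegrable (fun t => ‖EE T y t‖^2) volume 0 T := ((EE_cont T y).norm.pow 2).intervalIntegrable _ _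
  refine (intervalIntegral.integral_mono_on hT0 hIntg (k6.const_mul 4) fun t ht => EE_sq hRH hT hy hyL ht.1 ht.2).trans ?_
  rw [intervalIntegral.integral_const_mul, intervalIntegral.integral_add k5 (i4.const_mul 16), intervalIntegral.integral_add k4 j3,
    intervalIntegral.integral_add k123 (jc _), intervalIntegral.integral_add k12 j2, intervalIntegral.integral_add (jc _) j1,
    intervalIntegral.integral_const, intervalIntegral.integral_const, intervalIntegral.integral_const_mul 16]
  simp only [smul_eq_mul, sub_zero]
  have hKM : K * M = CC^2 * (K * (Real.log T)^2) := by rw [hM]; ring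
  have hX : 0 ≤ K * (Real.log T)^2 := by positivity
  unfold CE
  set X := K * (Real.log T)^2
  have hpi := Real.pi_pos
  calc _ ≤ 4 * (T * C1^2 + CC^2 * X + CC^2 * X + T * (CT + CS)^2 + 16 * T * π + 16 * (2 * (1 + T))) := by linarith
    _ ≤ _ := by
      have : 0 ≤ (C1^2 + (CT + CS)^2 + 16 * π + 64) * X := by positivity
      have : 0 ≤ CC^2 * T := by positivity
      nlinarith

lemma norm_expand {s θ B : ℝ} (hs : 0 < s) (hθ : 0 < θ) (hθ1 : θ ≤ 1) (hB : 0 ≤ B) (P E : ℂ) :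
    |‖E + (-P + (B : ℂ))‖^2 - ‖P‖^2 - B^2| ≤ (s + θ) * ‖P‖^2 + (1 / s + θ) * B^2 + 3 / θ * ‖E‖^2 := by
  have h1 : ‖E + (-P + (B : ℂ))‖^2 = ‖E‖^2 + ‖P‖^2 + B^2 - 2 * (P.re * E.re + P.im * E.im) + 2 * (B * E.re) - 2 * (B * P.re) := by
    rw [Complex.sq_norm, Complex.sq_norm, Complex.sq_norm, Complex.normSq_apply, Complex.normSq_apply, Complex.normSq_apply]
    simp
    ring
  have hPE : |P.re * E.re + P.im * E.im| ≤ ‖P‖ * ‖E‖ := by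
    have : P.re * E.re + P.im * E.im = (P * (starRingEnd ℂ) E).re := by simp
    rw [this]
    refine (Complex.abs_re_le_norm _).trans ?_
    rw [norm_mul, RCLike.norm_conj]
  have hBE : |B * E.re| ≤ B * ‖E‖ := by
    rw [abs_mul, abs_of_nonneg hB]; exact mul_le_mul_of_nonneg_left (Complex.abs_re_le_norm _) hB
  have hBP : |B * P.re| ≤ B * ‖P‖ := by
    rw [abs_mul, abs_of_nonneg hB]; exact mul_le_mul_of_nonneg_left (Complex.abs_re_le_norm _) hB
  have y1 : ∀ a b c : ℝ, 0 < c → 2 * (a * b) ≤ c * a^2 + 1 / c * b^2 := by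
    intro a b c hc
    have : 0 ≤ (c * a - b)^2 / c := by positivity
    have e : (c * a - b)^2 / c = c * a^2 + 1 / c * b^2 - 2 * (a * b) := by field_simp; ring
    linarith
  have z1 := y1 ‖P‖ ‖E‖ θ hθ
  have z2 := y1 B ‖E‖ θ hθ
  have z3 := y1 ‖P‖ B s hs
  have z4 : ‖E‖^2 ≤ 1 / θ * ‖E‖^2 := le_mul_of_one_le_left (by positivity) (by rw [le_div_iff₀ hθ]; linarith)
  obtain ⟨p1, p2⟩ := abs_le.1 hPE
  obtain ⟨p3, p4⟩ := abs_le.1 hBE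
  obtain ⟨p5, p6⟩ := abs_le.1 hBP
  have z5 : 3 / θ * ‖E‖^2 = 3 * (1 / θ * ‖E‖^2) := by ring
  have : 0 ≤ ‖E‖^2 := by positivity
  rw [h1, z5, abs_le]
  constructor <;> nlinarith

lemma inside (hRH : RiemannHypothesis) {T y s θ : ℝ} (hT : 3 ≤ T) (hy : 0 < y) (hyL : y ≤ Real.log T)
    (hs : 0 < s) (hθ : 0 < θ) (hθ1 : θ ≤ 1) :
    |(∫ t in (0:ℝ)..T, ‖bT T t y‖^2) - (∫ t in (0:ℝ)..T, ‖PS t y‖^2) - T * (Real.log T * Real.exp (-y))^2| ≤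
      (s + θ) * (∫ t in (0:ℝ)..T, ‖PS t y‖^2) + (1 / s + θ) * (T * (Real.log T * Real.exp (-y))^2)
        + 3 / θ * (CE * (T + T^(3/4:ℝ) * (Real.log T)^2)) := by
  have hT0 : (0:ℝ) ≤ T := by linarith
  set B := Real.log T * Real.exp (-y) with hB
  have hB0 : 0 ≤ B := by have := one_le_log hT; positivity
  have ib : IntervalIntegrable (fun t => ‖bT T t y‖^2) volume 0 T := ((bT_cont T y).norm.pow 2).intervalIntegrable _ _
  have ip : IntervalIntegrable (fun t => ‖PS t y‖^2) volume 0 T := ((PS_cont y).norm.pow 2).intervalIntegrable _ _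
  have ie : IntervalIntegrable (fun t => ‖EE T y t‖^2) volume 0 T := ((EE_cont T y).norm.pow 2).intervalIntegrable _ _
  have ic : ∀ c : ℝ, IntervalIntegrable (fun _ : ℝ => c) volume 0 T := fun c => intervalIntegrable_const
  have e1 : (∫ t in (0:ℝ)..T, ‖bT T t y‖^2) - (∫ t in (0:ℝ)..T, ‖PS t y‖^2) - T * B^2
      = ∫ t in (0:ℝ)..T, (‖bT T t y‖^2 - ‖PS t y‖^2 - B^2) := by
    rw [intervalIntegral.integral_sub (ib.sub ip) (ic _), intervalIntegral.integral_sub ib ip, intervalIntegral.integral_const]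
    simp
  rw [e1]
  refine (intervalIntegral.abs_integral_le_integral_abs hT0).trans ?_
  have k1 : IntervalIntegrable (fun t => (s + θ) * ‖PS t y‖^2 + (1 / s + θ) * B^2) volume 0 T := (ip.const_mul _).add (ic _)
  refine (intervalIntegral.integral_mono_on hT0 ((ib.sub ip).sub (ic _)).abs (k1.add (ie.const_mul (3 / θ))) fun t ht => ?_).trans ?_
  · have := norm_expand hs hθ hθ1 hB0 (PS t y) (EE T y t)
    have e2 : EE T y t + (-PS t y + (B:ℂ)) = bT T t y := by unfold EE; rw [hB]; ring
    rw [e2] at this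
    exact this
  · rw [intervalIntegral.integral_add k1 (ie.const_mul _), intervalIntegral.integral_add (ip.const_mul _) (ic _),
      intervalIntegral.integral_const_mul (s + θ), intervalIntegral.integral_const_mul (3 / θ), intervalIntegral.integral_const, smul_eq_mul, sub_zero]
    have := mul_le_mul_of_nonneg_left (EE_int hRH hT hy hyL) (by positivity : 0 ≤ 3 / θ)
    linarith

end PC

namespace PC
open ArithmeticFunction (vonMangoldt)

def wk (n : ℕ) : ℕ := ⌊Real.log n⌋₊

lemma window {f v : ℕ → ℝ} (hf : ∀ n, 0 ≤ f n) (hv0 : ∀ k, 0 ≤ v k)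
    (h : ∀ N k, ∑ n ∈ Finset.range N with wk n = k, f n ≤ v k) (hv : Summable v) :
    Summable f ∧ ∑' n, f n ≤ ∑' k, v k := by
  have key : ∀ N, ∑ n ∈ Finset.range N, f n ≤ ∑' k, v k := by
    intro N
    rw [← Finset.sum_fiberwise_of_maps_to (t := (Finset.range N).image wk) (g := wk) (fun n hn => Finset.mem_image_of_mem _ hn)]
    refine (Finset.sum_le_sum fun k _ => h N k).trans ?_
    exact hv.sum_le_tsum _ fun k _ => hv0 k
  exact ⟨summable_of_sum_range_le hf key, Real.tsum_le_of_sum_range_le hf key⟩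

lemma wk_bounds {n k : ℕ} (hk : wk n = k) : (k:ℝ) ≤ Real.log n ∧ Real.log n < k + 1 := by
  unfold wk at hk
  have := Nat.floor_le (log_nat_nonneg n)
  have := Nat.lt_floor_add_one (Real.log n)
  rw [hk] at *
  exact ⟨by assumption, by assumption⟩

lemma window_psi (N k : ℕ) : ∑ n ∈ Finset.range N with wk n = k, vonMangoldt n ≤ Chebyshev.psi (Real.exp (k+1)) := by
  rw [Chebyshev.psi_eq_sum_Icc]
  refine Finset.sum_le_sum_of_subset_of_nonneg (fun n hn => ?_) fun _ _ _ => ArithmeticFunction.vonMangoldt_nonneg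
  rw [Finset.mem_filter] at hn
  rw [Finset.mem_Icc]
  refine ⟨Nat.zero_le _, Nat.le_floor ?_⟩
  have := (wk_bounds hn.2).2
  rcases Nat.eq_zero_or_pos n with h | h
  · rw [h]; simp; positivity
  · exact (Real.log_le_iff_le_exp (by exact_mod_cast h)).1 this.le

lemma summable_exp_abs : Summable fun j : ℤ => Real.exp (-(1/4) * |(j:ℝ)|) := by
  have h : Summable fun n : ℕ => Real.exp (-(1/4) * (n:ℝ)) := by
    have := Real.summable_exp_nat_mul_iff.2 (show (-(1/4):ℝ) < 0 by norm_num)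
    refine this.congr fun n => by rw [mul_comm]
  refine Summable.of_nat_of_neg ?_ ?_ <;> simpa using h

def CWZ : ℝ := ∑' j : ℤ, Real.exp (-(1/4) * |(j:ℝ)|)

lemma sum_exp_window {y : ℝ} : Summable (fun k : ℕ => Real.exp (-(1/4) * |y - k|)) ∧
    ∑' k : ℕ, Real.exp (-(1/4) * |y - k|) ≤ Real.exp 1 * CWZ := by
  have hinj : Function.Injective (fun k : ℕ => (k:ℤ) - ⌊y⌋) := by
    intro a b hab; simp at hab; exact hab
  have hs : Summable (fun k : ℕ => Real.exp 1 * Real.exp (-(1/4) * |(((k:ℤ) - ⌊y⌋ : ℤ) : ℝ)|)) :=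
    (summable_exp_abs.comp_injective hinj).mul_left _
  have hle : ∀ k : ℕ, Real.exp (-(1/4) * |y - k|) ≤ Real.exp 1 * Real.exp (-(1/4) * |(((k:ℤ) - ⌊y⌋ : ℤ) : ℝ)|) := by
    intro k
    rw [← Real.exp_add]
    apply Real.exp_le_exp.2
    push_cast
    have h1 := Int.floor_le y
    have h2 := Int.lt_floor_add_one y
    have : |(k:ℝ) - ⌊y⌋| ≤ |y - k| + 1 := by
      have : |(k:ℝ) - ⌊y⌋| ≤ |k - y| + |y - ⌊y⌋| := abs_sub_le _ _ _
      rw [abs_sub_comm (k:ℝ) y] at this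
      have h3 : |y - ⌊y⌋| ≤ 1 := by rw [abs_le]; constructor <;> linarith
      linarith
    linarith
  have hs2 := Summable.of_nonneg_of_le (fun k => (Real.exp_pos _).le) hle hs
  refine ⟨hs2, (hs2.tsum_le_tsum hle hs).trans ?_⟩
  rw [tsum_mul_left]
  refine mul_le_mul_of_nonneg_left ?_ (Real.exp_pos _).le
  exact (summable_exp_abs.comp_injective hinj).tsum_le_tsum_of_inj _ hinj (fun c _ => (Real.exp_pos _).le) (fun i => le_rfl) summable_exp_abs

/-- weights -/
def wt (y : ℝ) (n : ℕ) : ℝ := vonMangoldt n / n * Real.exp (-(1/4) * |y - Real.log n|)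
lemma wt_nonneg (y : ℝ) (n : ℕ) : 0 ≤ wt y n := by
  unfold wt
  have : 0 ≤ vonMangoldt n := ArithmeticFunction.vonMangoldt_nonneg
  positivity

def CW : ℝ := (Real.log 4 + 4) * Real.exp 2 * (Real.exp 1 * CWZ)

lemma CW_nonneg : 0 ≤ CW := by
  have : 0 ≤ CWZ := tsum_nonneg fun _ => (Real.exp_pos _).le
  have : 0 ≤ Real.log 4 := Real.log_nonneg (by norm_num)
  unfold CW; positivity

lemma wt_bound (y : ℝ) : Summable (wt y) ∧ ∑' n, wt y n ≤ CW := by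
  obtain ⟨s1, s2⟩ := sum_exp_window (y := y)
  have h4 : 0 ≤ Real.log 4 := Real.log_nonneg (by norm_num)
  have := window (f := wt y) (v := fun k => (Real.log 4 + 4) * Real.exp 2 * Real.exp (-(1/4) * |y - k|)) (wt_nonneg y)
    (fun k => by positivity) ?_ (s1.mul_left _)
  · refine ⟨this.1, this.2.trans ?_⟩
    rw [tsum_mul_left]
    unfold CW
    gcongr
  intro N k
  calc ∑ n ∈ Finset.range N with wk n = k, wt y n ≤ ∑ n ∈ Finset.range N with wk n = k, vonMangoldt n * (Real.exp (-k) * Real.exp (1 - (1/4) * |y - k|)) := by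
        refine Finset.sum_le_sum fun n hn => ?_
        rw [Finset.mem_filter] at hn
        obtain ⟨b1, b2⟩ := wk_bounds hn.2
        rcases Nat.eq_zero_or_pos n with h | h
        · simp [h, wt]
        have hn0 : (0:ℝ) < n := by exact_mod_cast h
        unfold wt
        rw [div_mul_eq_mul_div, mul_div_assoc]
        refine mul_le_mul_of_nonneg_left ?_ ArithmeticFunction.vonMangoldt_nonneg
        rw [div_le_iff₀ hn0]
        have hen : (n:ℝ) = Real.exp (Real.log n) := (Real.exp_log hn0).symm
        refine le_of_le_of_eq ?_ (congrArg (fun z => Real.exp (-k) * Real.exp (1 - (1/4) * |y - k|) * z) hen.symm)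
        rw [← Real.exp_add, ← Real.exp_add]
        apply Real.exp_le_exp.2
        have : |y - k| ≤ |y - Real.log n| + 1 := by
          have : |y - k| ≤ |y - Real.log n| + |Real.log n - k| := abs_sub_le _ _ _
          have h3 : |Real.log n - k| ≤ 1 := by rw [abs_le]; constructor <;> linarith
          linarith
        linarith
    _ = (∑ n ∈ Finset.range N with wk n = k, vonMangoldt n) * (Real.exp (-k) * Real.exp (1 - (1/4) * |y - k|)) := by rw [Finset.sum_mul]
    _ ≤ ((Real.log 4 + 4) * Real.exp (k+1)) * (Real.exp (-k) * Real.exp (1 - (1/4) * |y - k|)) := by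
        refine mul_le_mul_of_nonneg_right ?_ (by positivity)
        exact (window_psi N k).trans (Chebyshev.psi_le_const_mul_self (Real.exp_pos _).le)
    _ = _ := by
        rw [mul_assoc, mul_assoc, ← Real.exp_add, ← Real.exp_add, ← Real.exp_add]
        congr 2
        ring

/-- `ΣΛ²/n e^{-|y-log n|/2}` -/
def qt (y : ℝ) (n : ℕ) : ℝ := vonMangoldt n ^ 2 / n * Real.exp (-(1/2) * |y - Real.log n|)
lemma qt_nonneg (y : ℝ) (n : ℕ) : 0 ≤ qt y n := by unfold qt; positivity

lemma qt_le {y : ℝ} (hy : 0 ≤ y) (n : ℕ) : qt y n ≤ (y + 4) * wt y n := by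
  unfold qt wt
  set v := |y - Real.log n|
  have hv : Real.log n ≤ y + v := by have := neg_abs_le (y - Real.log n); linarith
  have h1 : vonMangoldt n ≤ y + v := ArithmeticFunction.vonMangoldt_le_log.trans hv
  have h2 : y + v ≤ (y + 4) * Real.exp ((1/4) * v) := by
    have a := Real.add_one_le_exp ((1/4) * v)
    have b : 0 ≤ v := abs_nonneg _
    nlinarith
  have h3 : Real.exp ((1/4) * v) * Real.exp (-(1/2) * v) = Real.exp (-(1/4) * v) := by rw [← Real.exp_add]; ring_nf
  have h0 : 0 ≤ vonMangoldt n := ArithmeticFunction.vonMangoldt_nonneg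
  calc vonMangoldt n ^ 2 / n * Real.exp (-(1/2) * v) = (vonMangoldt n / n) * Real.exp (-(1/2) * v) * vonMangoldt n := by ring
    _ ≤ (vonMangoldt n / n) * Real.exp (-(1/2) * v) * ((y + 4) * Real.exp ((1/4) * v)) := by gcongr; linarith
    _ = (y + 4) * (vonMangoldt n / n * (Real.exp ((1/4) * v) * Real.exp (-(1/2) * v))) := by ring
    _ = _ := by rw [h3]

lemma qt_bound {y : ℝ} (hy : 0 ≤ y) : Summable (qt y) ∧ ∑' n, qt y n ≤ CW * (y + 4) := by
  obtain ⟨a, b⟩ := wt_bound y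
  have s := Summable.of_nonneg_of_le (qt_nonneg y) (qt_le hy) (a.mul_left _)
  refine ⟨s, (s.tsum_le_tsum (qt_le hy) (a.mul_left _)).trans ?_⟩
  rw [tsum_mul_left, mul_comm]
  gcongr

lemma ac_sum_le (y : ℝ) : ∑' n, ac y n ≤ CW * Real.exp (y/2) := by
  obtain ⟨a, b⟩ := wt_bound y
  have hle : ∀ n, ac y n ≤ Real.exp (y/2) * wt y n := by
    intro n
    rcases Nat.eq_zero_or_pos n with h | h
    · simp [h, wt, ac]
    have hn0 : (0:ℝ) < n := by exact_mod_cast h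
    have : 1 / (n:ℝ) = Real.exp (-Real.log n) := by rw [Real.exp_neg, Real.exp_log hn0, one_div]
    unfold ac wt
    rw [show Real.exp (y/2) * (vonMangoldt n / n * Real.exp (-(1/4) * |y - Real.log n|)) = vonMangoldt n * (Real.exp (y/2) * (1 / (n:ℝ)) * Real.exp (-(1/4) * |y - Real.log n|)) by ring, this]
    refine mul_le_mul_of_nonneg_left ?_ ArithmeticFunction.vonMangoldt_nonneg
    rw [← Real.exp_add, ← Real.exp_add]
    apply Real.exp_le_exp.2
    have h1 := neg_abs_le (y - Real.log n)
    have h2 := abs_nonneg (y - Real.log n)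
    linarith
  refine ((ac_summable y).tsum_le_tsum hle (a.mul_left _)).trans ?_
  rw [tsum_mul_left, mul_comm]
  gcongr

/-- bound for `Σ a_n² n^p`, `0 ≤ p ≤ 3/2`. -/
lemma ac_sq_rpow {y p : ℝ} (hy : 0 ≤ y) (hp0 : 0 ≤ p) (hp : p ≤ 3/2) :
    Summable (fun n : ℕ => ac y n ^ 2 * (n:ℝ)^p) ∧ ∑' n : ℕ, ac y n ^ 2 * (n:ℝ)^p ≤ CW * (y + 4) * Real.exp (p * y) := by
  obtain ⟨a, b⟩ := qt_bound hy
  have hle : ∀ n : ℕ, ac y n ^ 2 * (n:ℝ)^p ≤ Real.exp (p * y) * qt y n := by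
    intro n
    rcases Nat.eq_zero_or_pos n with h | h
    · simp [h, qt, ac]
    have hn0 : (0:ℝ) < n := by exact_mod_cast h
    have h1 : (n:ℝ)⁻¹ = Real.exp (-Real.log n) := by rw [Real.exp_neg, Real.exp_log hn0]
    unfold ac qt
    rw [Real.rpow_def_of_pos hn0, mul_pow, ← Real.exp_nat_mul, div_eq_mul_inv (vonMangoldt n ^ 2), h1]
    rw [show ∀ a b c d : ℝ, a * (b * c * d) = b * (a * c * d) by intros; ring, mul_assoc]
    refine mul_le_mul_of_nonneg_left ?_ (by positivity)
    rw [← Real.exp_add, ← Real.exp_add, ← Real.exp_add]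
    apply Real.exp_le_exp.2
    have h1 := neg_abs_le (y - Real.log n)
    have h2 := abs_nonneg (y - Real.log n)
    push_cast
    nlinarith
  have hs := Summable.of_nonneg_of_le (fun n => by positivity) hle (a.mul_left _)
  refine ⟨hs, (hs.tsum_le_tsum hle (a.mul_left _)).trans ?_⟩
  rw [tsum_mul_left, mul_comm]
  gcongr

def QQ (y : ℝ) : ℝ := ∑' n : ℕ, ac y n ^ 2

lemma QQ_summable {y : ℝ} (hy : 0 ≤ y) : Summable (fun n : ℕ => ac y n ^ 2) := by
  simpa using (ac_sq_rpow hy le_rfl (by norm_num)).1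
lemma QQ_nonneg (y : ℝ) : 0 ≤ QQ y := tsum_nonneg fun n => by positivity
lemma QQ_le {y : ℝ} (hy : 0 ≤ y) : QQ y ≤ CW * (y + 4) := by
  simpa [QQ] using (ac_sq_rpow hy le_rfl (by norm_num)).2

end PC

namespace PC
open ArithmeticFunction (vonMangoldt)

def rp (p : ℝ) (j : ℤ) : ℝ := |(j:ℝ)| ^ (-p)
lemma rp_nonneg (p : ℝ) (j : ℤ) : 0 ≤ rp p j := Real.rpow_nonneg (abs_nonneg _) _
lemma rp_summable {p : ℝ} (hp : 1 < p) : Summable (rp p) := Real.summable_abs_int_rpow hp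
def Zp (p : ℝ) : ℝ := ∑' j, rp p j
lemma Zp_nonneg (p : ℝ) : 0 ≤ Zp p := tsum_nonneg (rp_nonneg p)

lemma conv_row {p : ℝ} (hp : 1 < p) (m : ℕ) : Summable (fun n : ℕ => rp p ((m:ℤ) - n)) ∧ ∑' n : ℕ, rp p ((m:ℤ) - n) ≤ Zp p := by
  have hinj : Function.Injective (fun n : ℕ => (m:ℤ) - n) := by
    intro a b hab; simp at hab; exact hab
  have hs := (rp_summable hp).comp_injective hinj
  exact ⟨hs, hs.tsum_le_tsum_of_inj _ hinj (fun c _ => rp_nonneg p c) (fun i => le_rfl) (rp_summable hp)⟩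

lemma conv_summable {p : ℝ} (hp : 1 < p) {s : ℕ → ℝ} (hs0 : ∀ n, 0 ≤ s n) (hs : Summable s) :
    Summable (fun q : ℕ × ℕ => s q.1 * rp p ((q.1:ℤ) - q.2)) ∧
    ∑' q : ℕ × ℕ, s q.1 * rp p ((q.1:ℤ) - q.2) ≤ (∑' n, s n) * Zp p := by
  have hle : ∀ m : ℕ, ∑' n : ℕ, s m * rp p ((m:ℤ) - n) ≤ s m * Zp p := by
    intro m
    rw [tsum_mul_left]
    exact mul_le_mul_of_nonneg_left (conv_row hp m).2 (hs0 m)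
  have hsum : Summable (fun q : ℕ × ℕ => s q.1 * rp p ((q.1:ℤ) - q.2)) := by
    refine (summable_prod_of_nonneg (fun q => mul_nonneg (hs0 _) (rp_nonneg _ _))).2 ⟨fun m => ?_, ?_⟩
    · exact (conv_row hp m).1.mul_left (s m)
    · exact Summable.of_nonneg_of_le (fun m => tsum_nonneg fun n => mul_nonneg (hs0 _) (rp_nonneg _ _)) hle (hs.mul_right _)
  refine ⟨hsum, ?_⟩
  rw [hsum.tsum_prod, ← tsum_mul_right]
  exact hsum.prod.tsum_le_tsum hle (hs.mul_right _)

lemma log_diff_ge {m n : ℕ} (hm : 0 < m) (hn : 0 < n) : |(m:ℝ) - n| / max (m:ℝ) n ≤ |Real.log m - Real.log n| := by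
  have key : ∀ a b : ℝ, 0 < a → a ≤ b → (b - a) / b ≤ Real.log b - Real.log a := by
    intro a b ha hab
    have hb : 0 < b := by linarith
    have := Real.log_le_sub_one_of_pos (show 0 < a / b by positivity)
    rw [Real.log_div (by linarith) (by linarith)] at this
    have h2 : (b - a) / b = 1 - a / b := by field_simp
    linarith
  have hm' : (0:ℝ) < m := by exact_mod_cast hm
  have hn' : (0:ℝ) < n := by exact_mod_cast hn
  rcases le_total (m:ℝ) n with h | h
  · rw [max_eq_right h, abs_sub_comm, abs_of_nonneg (by linarith)]
    refine (key _ _ hm' h).trans ?_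
    rw [abs_sub_comm]; exact le_abs_self _
  · rw [max_eq_left h, abs_of_nonneg (by linarith)]
    exact (key _ _ hn' h).trans (le_abs_self _)

/-- off-diagonal terms -/
def od (p y : ℝ) (q : ℕ × ℕ) : ℝ := ac y q.1 * ac y q.2 * |Real.log q.1 - Real.log q.2| ^ (-p)

lemma od_nonneg (p y : ℝ) (q : ℕ × ℕ) : 0 ≤ od p y q :=
  mul_nonneg (mul_nonneg (ac_nonneg _ _) (ac_nonneg _ _)) (Real.rpow_nonneg (abs_nonneg _) _)

lemma ac_zero (y : ℝ) : ac y 0 = 0 := by simp [ac]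
lemma ac_one (y : ℝ) : ac y 1 = 0 := by simp [ac]

lemma od_le {p y : ℝ} (hp : 1 < p) (hp2 : p ≤ 3/2) (q : ℕ × ℕ) :
    od p y q ≤ 4 * (ac y q.1 * ac y q.2) + 2 * (ac y q.1 ^ 2 * (q.1:ℝ)^p * rp p ((q.1:ℤ) - q.2))
      + 2 * (ac y q.2 ^ 2 * (q.2:ℝ)^p * rp p ((q.2:ℤ) - q.1)) := by
  obtain ⟨m, n⟩ := q
  simp only
  have hA := ac_nonneg y m
  have hB := ac_nonneg y n
  have t1 : 0 ≤ 4 * (ac y m * ac y n) := by positivity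
  have t2 : 0 ≤ 2 * (ac y m ^ 2 * (m:ℝ)^p * rp p ((m:ℤ) - n)) := by have := rp_nonneg p ((m:ℤ) - n); positivity
  have t3 : 0 ≤ 2 * (ac y n ^ 2 * (n:ℝ)^p * rp p ((n:ℤ) - m)) := by have := rp_nonneg p ((n:ℤ) - m); positivity
  by_cases hmn : m = n
  · have : od p y (m, n) = 0 := by
      unfold od; rw [hmn]; simp only [sub_self, abs_zero]; rw [Real.zero_rpow (by linarith), mul_zero]
    rw [this]; linarith
  rcases Nat.eq_zero_or_pos m with h | hm
  · have : od p y (m, n) = 0 := by unfold od; simp [h, ac_zero]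
    rw [this]; linarith
  rcases Nat.eq_zero_or_pos n with h | hn
  · have : od p y (m, n) = 0 := by unfold od; simp [h, ac_zero]
    rw [this]; linarith
  have hm' : (0:ℝ) < m := by exact_mod_cast hm
  have hn' : (0:ℝ) < n := by exact_mod_cast hn
  have hd : 0 < |(m:ℝ) - n| := abs_pos.2 (sub_ne_zero.2 (by exact_mod_cast hmn))
  set M := max (m:ℝ) n with hM
  have hM0 : 0 < M := lt_max_of_lt_left hm'
  set d := |(m:ℝ) - n| with hdd
  have hlam : |Real.log m - Real.log n| ^ (-p) ≤ (M / d) ^ p := by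
    calc |Real.log m - Real.log n| ^ (-p) ≤ (d / M) ^ (-p) :=
          Real.rpow_le_rpow_of_nonpos (by positivity) (log_diff_ge hm hn) (by linarith)
      _ = (M / d) ^ p := by rw [Real.rpow_neg (by positivity), ← Real.inv_rpow (by positivity), inv_div]
  have h2p : (2:ℝ)^p ≤ 4 := by
    calc (2:ℝ)^p ≤ (2:ℝ)^(2:ℝ) := Real.rpow_le_rpow_of_exponent_le (by norm_num) (by linarith)
      _ = 4 := by norm_num
  have hod : od p y (m, n) ≤ ac y m * ac y n * (M / d)^p := by
    unfold od; exact mul_le_mul_of_nonneg_left hlam (by positivity)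
  refine hod.trans ?_
  by_cases hc : M / 2 ≤ d
  · have : (M / d)^p ≤ 4 := by
      refine le_trans (Real.rpow_le_rpow (by positivity) ?_ (by linarith)) h2p
      rw [div_le_iff₀ hd]; linarith
    have : ac y m * ac y n * (M / d)^p ≤ ac y m * ac y n * 4 := by gcongr
    linarith
  · push Not at hc
    have hmM : M ≤ 2 * m ∧ M ≤ 2 * n := by
      rcases le_total (m:ℝ) n with h | h
      · rw [max_eq_right h] at hM
        rw [hdd, abs_sub_comm, abs_of_nonneg (by linarith)] at hc
        constructor <;> linarith
      · rw [max_eq_left h] at hM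
        rw [hdd, abs_of_nonneg (by linarith)] at hc
        constructor <;> linarith
    have e1 : M ^ p ≤ 4 * (m:ℝ)^p := by
      refine (Real.rpow_le_rpow hM0.le hmM.1 (by linarith)).trans ?_
      rw [Real.mul_rpow (by norm_num) hm'.le]; gcongr
    have e2 : M ^ p ≤ 4 * (n:ℝ)^p := by
      refine (Real.rpow_le_rpow hM0.le hmM.2 (by linarith)).trans ?_
      rw [Real.mul_rpow (by norm_num) hn'.le]; gcongr
    have r1 : rp p ((m:ℤ) - n) = d ^ (-p) := by unfold rp; push_cast; rfl
    have r2 : rp p ((n:ℤ) - m) = d ^ (-p) := by unfold rp; push_cast; rw [abs_sub_comm]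
    rw [Real.div_rpow hM0.le hd.le, div_eq_mul_inv, ← Real.rpow_neg hd.le, r1, r2]
    have hdp : 0 ≤ d ^ (-p) := by positivity
    set X := d ^ (-p)
    have am : ac y m * ac y n * M^p ≤ 2 * (ac y m ^ 2 * (m:ℝ)^p) + 2 * (ac y n ^ 2 * (n:ℝ)^p) := by
      have hMp : 0 ≤ M^p := by positivity
      have : ac y m * ac y n * M^p ≤ (ac y m ^ 2 * M^p + ac y n ^ 2 * M^p) / 2 := by
        nlinarith [mul_nonneg (sq_nonneg (ac y m - ac y n)) hMp]
      have f1 := mul_le_mul_of_nonneg_left e1 (sq_nonneg (ac y m))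
      have f2 := mul_le_mul_of_nonneg_left e2 (sq_nonneg (ac y n))
      linarith
    have := mul_le_mul_of_nonneg_right am hdp
    linarith

def Dp (p : ℝ) : ℝ := 4 * CW^2 + 4 * (CW * Zp p)

lemma Dp_nonneg (p : ℝ) : 0 ≤ Dp p := by
  have := CW_nonneg
  have := Zp_nonneg p
  unfold Dp; positivity

lemma acac_summable (y : ℝ) : Summable (fun q : ℕ × ℕ => ac y q.1 * ac y q.2) ∧
    ∑' q : ℕ × ℕ, ac y q.1 * ac y q.2 = (∑' n, ac y n)^2 := by
  have h := (ac_summable y).mul_of_nonneg (ac_summable y) (ac_nonneg y) (ac_nonneg y)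
  exact ⟨h, by rw [sq, (ac_summable y).tsum_mul_tsum (ac_summable y) h]⟩

lemma acac_le (y : ℝ) : ∑' q : ℕ × ℕ, ac y q.1 * ac y q.2 ≤ CW^2 * Real.exp y := by
  rw [(acac_summable y).2]
  have := pow_le_pow_left₀ (tsum_nonneg (ac_nonneg y)) (ac_sum_le y) 2
  rw [mul_pow, ← Real.exp_nat_mul] at this
  refine this.trans (le_of_eq ?_)
  congr 2; push_cast; ring

lemma od_sum {p y : ℝ} (hy : 0 ≤ y) (hp : 1 < p) (hp2 : p ≤ 3/2) : Summable (od p y) ∧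
    ∑' q, od p y q ≤ Dp p * ((y + 4) * Real.exp (p * y)) := by
  obtain ⟨s1, b1⟩ := ac_sq_rpow hy (by linarith : 0 ≤ p) hp2
  obtain ⟨s2, b2⟩ := conv_summable hp (s := fun n : ℕ => ac y n ^ 2 * (n:ℝ)^p) (fun n => by positivity) s1
  have s3 := (Equiv.prodComm ℕ ℕ).summable_iff.2 s2
  have e3 := (Equiv.prodComm ℕ ℕ).tsum_eq (fun q : ℕ × ℕ => ac y q.1 ^ 2 * (q.1:ℝ)^p * rp p ((q.1:ℤ) - q.2))
  have s3' : Summable (fun q : ℕ × ℕ => ac y q.2 ^ 2 * (q.2:ℝ)^p * rp p ((q.2:ℤ) - q.1)) := s3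
  have e3' : ∑' q : ℕ × ℕ, ac y q.2 ^ 2 * (q.2:ℝ)^p * rp p ((q.2:ℤ) - q.1) = ∑' q : ℕ × ℕ, ac y q.1 ^ 2 * (q.1:ℝ)^p * rp p ((q.1:ℤ) - q.2) := e3
  have stot := (((acac_summable y).1.mul_left 4).add (s2.mul_left 2)).add (s3'.mul_left 2)
  have hs := Summable.of_nonneg_of_le (od_nonneg p y) (od_le hp hp2) stot
  refine ⟨hs, (hs.tsum_le_tsum (od_le hp hp2) stot).trans ?_⟩
  rw [Summable.tsum_add (((acac_summable y).1.mul_left 4).add (s2.mul_left 2)) (s3'.mul_left 2),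
    Summable.tsum_add ((acac_summable y).1.mul_left 4) (s2.mul_left 2), tsum_mul_left, tsum_mul_left, tsum_mul_left, e3']
  have h1 := acac_le y
  have hz := Zp_nonneg p
  have h2 : (∑' n : ℕ, ac y n ^ 2 * (n:ℝ)^p) * Zp p ≤ CW * (y + 4) * Real.exp (p * y) * Zp p := by gcongr
  have h3 : Real.exp y ≤ (y + 4) * Real.exp (p * y) := by
    have : Real.exp y ≤ Real.exp (p * y) := Real.exp_le_exp.2 (by nlinarith)
    nlinarith [Real.exp_pos (p * y)]
  have h4 := mul_le_mul_of_nonneg_left h3 (sq_nonneg CW)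
  unfold Dp
  linarith

lemma PS_sq (t y : ℝ) : HasSum (fun q : ℕ × ℕ => ac y q.1 * ac y q.2 * Real.cos (t * (Real.log q.1 - Real.log q.2))) (‖PS t y‖^2) := by
  have hn : Summable fun n : ℕ => ‖(ac y n : ℂ) * Complex.exp (-(t * Real.log n) * I)‖ := by
    simp_rw [norm_pterm]; exact ac_summable y
  have hn' : Summable fun n : ℕ => ‖(starRingEnd ℂ) ((ac y n : ℂ) * Complex.exp (-(t * Real.log n) * I))‖ := by
    simp_rw [RCLike.norm_conj]; exact hn
  have h1 := (summable_mul_of_summable_norm hn hn').hasSum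
  rw [← tsum_mul_tsum_of_summable_norm hn hn', ← Complex.conj_tsum] at h1
  change HasSum _ (PS t y * (starRingEnd ℂ) (PS t y)) at h1
  rw [Complex.mul_conj', ← Complex.ofReal_pow] at h1
  have h2 := (Complex.hasSum_re h1)
  rw [Complex.ofReal_re] at h2
  refine h2.congr_fun fun q => ?_
  rw [map_mul, Complex.conj_ofReal, ← Complex.exp_conj]
  have : (starRingEnd ℂ) (-(t * Real.log q.2) * I : ℂ) = ((t * Real.log q.2 : ℝ) : ℂ) * I := by
    rw [map_mul, Complex.conj_I, map_neg, map_mul, Complex.conj_ofReal, Complex.conj_ofReal]; push_cast; ring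
  rw [this, show ∀ a b c d : ℂ, a * b * (c * d) = a * c * (b * d) by intros; ring, ← Complex.exp_add, ← Complex.ofReal_mul,
    show (-(t * Real.log q.1) * I + ((t * Real.log q.2 : ℝ) : ℂ) * I : ℂ) = ((-(t * (Real.log q.1 - Real.log q.2)) : ℝ) : ℂ) * I by push_cast; ring,
    Complex.re_ofReal_mul, Complex.exp_ofReal_mul_I_re, Real.cos_neg]

lemma PS_int {φ : ℝ → ℝ} (hφ : Integrable φ) (y : ℝ) :
    HasSum (fun q : ℕ × ℕ => ac y q.1 * ac y q.2 * ∫ t, φ t * Real.cos (t * (Real.log q.1 - Real.log q.2))) (∫ t, φ t * ‖PS t y‖^2) := by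
  have hi : ∀ q : ℕ × ℕ, Integrable (fun t => ac y q.1 * ac y q.2 * (φ t * Real.cos (t * (Real.log q.1 - Real.log q.2)))) := by
    intro q
    refine (hφ.mul_bdd (c := 1) (by fun_prop) (Eventually.of_forall fun t => ?_)).const_mul _
    rw [Real.norm_eq_abs]; exact Real.abs_cos_le_one _
  have := hasSum_integral_of_summable_integral_norm (μ := volume) (F := fun q : ℕ × ℕ => fun t => ac y q.1 * ac y q.2 * (φ t * Real.cos (t * (Real.log q.1 - Real.log q.2)))) hi ?_
  · have e : (fun t => φ t * ‖PS t y‖^2) = fun t => ∑' q : ℕ × ℕ, ac y q.1 * ac y q.2 * (φ t * Real.cos (t * (Real.log q.1 - Real.log q.2))) := by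
      funext t
      rw [← ((PS_sq t y).mul_left (φ t)).tsum_eq]
      refine tsum_congr fun q => by ring
    rw [e]
    refine this.congr_fun fun q => ?_
    exact (integral_const_mul _ _).symm
  · refine Summable.of_nonneg_of_le (fun q => integral_nonneg fun t => norm_nonneg _) (fun q => ?_) ((acac_summable y).1.mul_right (∫ t, ‖φ t‖))
    rw [← integral_const_mul]
    refine integral_mono (hi q).norm (hφ.norm.const_mul _) fun t => ?_
    have := mul_nonneg (ac_nonneg y q.1) (ac_nonneg y q.2)
    change ‖ac y q.1 * ac y q.2 * (φ t * Real.cos (t * (Real.log q.1 - Real.log q.2)))‖ ≤ ac y q.1 * ac y q.2 * ‖φ t‖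
    rw [norm_mul (ac y q.1*ac y q.2), Real.norm_of_nonneg this, norm_mul]
    refine mul_le_mul_of_nonneg_left (mul_le_of_le_one_right (norm_nonneg _) ?_) this
    rw [Real.norm_eq_abs]; exact Real.abs_cos_le_one _

end PC

namespace PC
open ArithmeticFunction (vonMangoldt)

lemma int_cos_bound {T l p : ℝ} (hl : l ≠ 0) (hp : 1 ≤ p) : |∫ t in (0:ℝ)..T, Real.cos (t * l)| ≤ |l|^(-p) + 1 := by
  have h : ∫ t in (0:ℝ)..T, Real.cos (t * l) = Real.sin (T * l) / l := by
    rw [intervalIntegral.integral_comp_mul_right (fun t => Real.cos t) hl, integral_cos]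
    simp [div_eq_inv_mul]
  have hl' : 0 < |l| := abs_pos.2 hl
  rw [h, abs_div]
  have h1 : |Real.sin (T * l)| / |l| ≤ 1 / |l| := by
    gcongr; exact Real.abs_sin_le_one _
  refine h1.trans ?_
  rcases le_total |l| 1 with h2 | h2
  · have : |l|^(-1:ℝ) ≤ |l|^(-p) := Real.rpow_le_rpow_of_exponent_ge hl' h2 (by linarith)
    rw [Real.rpow_neg_one] at this
    rw [one_div]; linarith
  · have : 1 / |l| ≤ 1 := by rw [div_le_one hl']; exact h2
    have := Real.rpow_nonneg hl'.le (-p)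
    linarith

lemma log_ne_of_ac {y : ℝ} {q : ℕ × ℕ} (h : ac y q.1 * ac y q.2 ≠ 0) (hq : q.1 ≠ q.2) : Real.log q.1 - Real.log q.2 ≠ 0 := by
  intro h0
  have h1 : q.1 ≠ 0 := by rintro h1; rw [h1, ac_zero, zero_mul] at h; exact h rfl
  have h2 : q.2 ≠ 0 := by rintro h1; rw [h1, ac_zero, mul_zero] at h; exact h rfl
  have : (q.1:ℝ) = q.2 := Real.log_injOn_pos (Set.mem_Ioi.2 (by positivity)) (Set.mem_Ioi.2 (by positivity)) (sub_eq_zero.1 h0)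
  exact hq (by exact_mod_cast this)

lemma diag_hasSum {y : ℝ} (hy : 0 ≤ y) (T : ℝ) : HasSum (fun q : ℕ × ℕ => if q.1 = q.2 then ac y q.1 * ac y q.2 * T else 0) (T * QQ y) := by
  have hinj : Function.Injective (fun n : ℕ => (n, n)) := fun a b h => (Prod.mk.inj h).1
  refine (hinj.hasSum_iff ?_).1 ?_
  · rintro ⟨a, b⟩ hx
    rw [if_neg]
    rintro (rfl : a = b)
    exact hx ⟨a, rfl⟩
  · have := (QQ_summable hy).hasSum.mul_left T
    refine this.congr_fun fun n => ?_
    simp only [Function.comp, if_true]; ring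

lemma mv_sharp {T y p : ℝ} (hT : 0 < T) (hy : 0 ≤ y) (hp : 1 < p) (hp2 : p ≤ 3/2) :
    |(∫ t in (0:ℝ)..T, ‖PS t y‖^2) - T * QQ y| ≤ (Dp p + CW^2) * ((y + 4) * Real.exp (p * y)) := by
  have hφ : Integrable (indicator (Ioc 0 T) (fun _ => (1:ℝ))) :=
    (integrable_indicator_iff measurableSet_Ioc).2 (integrableOn_const (by simp))
  have key : ∀ f : ℝ → ℝ, ∫ t, indicator (Ioc 0 T) (fun _ => (1:ℝ)) t * f t = ∫ t in (0:ℝ)..T, f t := by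
    intro f
    rw [intervalIntegral.integral_of_le hT.le, ← integral_indicator measurableSet_Ioc]
    congr 1; funext t
    by_cases ht : t ∈ Ioc 0 T
    · simp [ht]
    · simp [ht]
  have h1 := PS_int hφ y
  simp only [key] at h1
  have h2 := h1.sub (diag_hasSum hy T)
  obtain ⟨so, bo⟩ := od_sum hy hp hp2
  have sa := (acac_summable y).1
  have hb : ∀ q : ℕ × ℕ, |ac y q.1 * ac y q.2 * (∫ t in (0:ℝ)..T, Real.cos (t * (Real.log q.1 - Real.log q.2))) - (if q.1 = q.2 then ac y q.1 * ac y q.2 * T else 0)|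
      ≤ od p y q + ac y q.1 * ac y q.2 := by
    intro q
    have h0 := mul_nonneg (ac_nonneg y q.1) (ac_nonneg y q.2)
    have h00 := od_nonneg p y q
    by_cases hq : q.1 = q.2
    · simp only [hq, sub_self, mul_zero, Real.cos_zero, if_true]
      rw [hq] at h0
      simp; linarith
    · rw [if_neg hq, sub_zero, abs_mul, abs_of_nonneg h0]
      by_cases hz : ac y q.1 * ac y q.2 = 0
      · rw [hz]; simp [h00]
      · have := mul_le_mul_of_nonneg_left (int_cos_bound (T := T) (log_ne_of_ac hz hq) hp.le) h0
        unfold od; linarith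
  have h3 := h2.tsum_eq
  rw [← h3]
  have hs := so.add sa
  have h4 : Summable (fun q : ℕ × ℕ => |ac y q.1 * ac y q.2 * (∫ t in (0:ℝ)..T, Real.cos (t * (Real.log q.1 - Real.log q.2))) - (if q.1 = q.2 then ac y q.1 * ac y q.2 * T else 0)|) :=
    Summable.of_nonneg_of_le (fun q => abs_nonneg _) hb hs
  have h5 := norm_tsum_le_tsum_norm (f := fun q : ℕ × ℕ => ac y q.1 * ac y q.2 * (∫ t in (0:ℝ)..T, Real.cos (t * (Real.log q.1 - Real.log q.2))) - (if q.1 = q.2 then ac y q.1 * ac y q.2 * T else 0)) h4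
  simp only [Real.norm_eq_abs] at h5
  refine h5.trans ((h4.tsum_le_tsum hb hs).trans ?_)
  rw [so.tsum_add sa]
  have h6 := (acac_le y)
  have h3 : Real.exp y ≤ (y + 4) * Real.exp (p * y) := by
    have : Real.exp y ≤ Real.exp (p * y) := Real.exp_le_exp.2 (by nlinarith)
    nlinarith [Real.exp_pos (p * y)]
  have h4 := mul_le_mul_of_nonneg_left h3 (sq_nonneg CW)
  linarith

lemma int_exp_cos {T : ℝ} (hT : 0 < T) (l : ℝ) : ∫ t in Ioi (0:ℝ), Real.exp (-t/T) * Real.cos (t * l) = (1/T) / ((1/T)^2 + l^2) := by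
  have ha : ((-(1/T):ℝ) + (l:ℝ) * I : ℂ).re < 0 := by simp; exact hT
  have h := integral_exp_mul_complex_Ioi ha 0
  have hi := integrableOn_exp_mul_complex_Ioi ha 0
  have h2 := integral_re hi
  rw [h] at h2
  have e : ∀ t : ℝ, RCLike.re (Complex.exp (((-(1/T):ℝ) + (l:ℝ) * I : ℂ) * t)) = Real.exp (-t/T) * Real.cos (t * l) := by
    intro t
    change (Complex.exp _).re = _
    rw [Complex.exp_re]
    congr 2
    · simp; ring
    · simp; ring
  simp only [e] at h2
  rw [h2]
  change (Complex.re _) = _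
  simp only [Complex.ofReal_zero, mul_zero, Complex.exp_zero]
  rw [Complex.div_re, Complex.normSq_apply]
  have : 0 < (1/T)^2 + l^2 := by positivity
  simp
  field_simp
  

lemma PS_norm_le (t y : ℝ) : ‖PS t y‖ ≤ ∑' n, ac y n := by
  have hn : Summable fun n : ℕ => ‖(ac y n : ℂ) * Complex.exp (-(t * Real.log n) * I)‖ := by
    simp_rw [norm_pterm]; exact ac_summable y
  refine (norm_tsum_le_tsum_norm hn).trans (le_of_eq ?_)
  exact tsum_congr fun n => norm_pterm _ _ _

lemma lor_bound {T l : ℝ} (hT : 0 < T) (hl : l ≠ 0) : (1/T) / ((1/T)^2 + l^2) ≤ T^(-(1/2):ℝ) * |l|^(-(3/2):ℝ) := by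
  have hl' : 0 < |l| := abs_pos.2 hl
  set v := T * |l| with hv
  have hv0 : 0 < v := by positivity
  have e : (1/T) / ((1/T)^2 + l^2) = T / (1 + v^2) := by
    rw [hv, mul_pow, sq_abs]; field_simp
  have e2 : T^(-(1/2):ℝ) * |l|^(-(3/2):ℝ) = T * v^(-(3/2):ℝ) := by
    rw [hv, Real.mul_rpow hT.le hl'.le, ← mul_assoc]
    congr 1
    nth_rewrite 2 [← Real.rpow_one T]
    rw [← Real.rpow_add hT]; norm_num
  rw [e, e2, div_eq_mul_inv]
  refine mul_le_mul_of_nonneg_left ?_ hT.le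
  rw [Real.rpow_neg hv0.le]
  refine inv_anti₀ (by positivity) ?_
  rcases le_total v 1 with h | h
  · have := Real.rpow_le_one hv0.le h (by norm_num : (0:ℝ) ≤ 3/2)
    nlinarith [sq_nonneg v]
  · have := Real.rpow_le_rpow_of_exponent_le h (by norm_num : (3/2:ℝ) ≤ 2)
    rw [Real.rpow_two] at this
    linarith

def CP : ℝ := Real.exp 1 * (CW + Dp (3/2))
lemma CP_nonneg : 0 ≤ CP := mul_nonneg (Real.exp_pos _).le (add_nonneg CW_nonneg (Dp_nonneg _))

lemma mv_crude {T y : ℝ} (hT : 1 ≤ T) (hy : 0 ≤ y) (hyT : y ≤ Real.log T) :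
    (∫ t in (0:ℝ)..T, ‖PS t y‖^2) ≤ CP * (T * (y + 4)) := by
  have hT0 : 0 < T := by linarith
  have hexp : IntegrableOn (fun t : ℝ => Real.exp (-t/T)) (Ioi 0) := by
    have := exp_neg_integrableOn_Ioi 0 (show 0 < 1/T by positivity)
    refine this.congr_fun (fun t _ => ?_) measurableSet_Ioi
    change Real.exp (-(1/T) * t) = Real.exp (-t/T)
    congr 1; ring
  have hφ : Integrable (indicator (Ioi 0) (fun t : ℝ => Real.exp (-t/T))) :=
    (integrable_indicator_iff measurableSet_Ioi).2 hexp
  have key : ∀ f : ℝ → ℝ, ∫ t, indicator (Ioi 0) (fun t : ℝ => Real.exp (-t/T)) t * f t = ∫ t in Ioi (0:ℝ), Real.exp (-t/T) * f t := by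
    intro f
    rw [← integral_indicator measurableSet_Ioi]
    congr 1; funext t
    by_cases ht : t ∈ Ioi (0:ℝ)
    · simp only [ht, indicator_of_mem]
    · simp only [ht, not_false_eq_true, indicator_of_notMem, zero_mul]
  have h1 := PS_int hφ y
  simp only [key, int_exp_cos hT0] at h1
  obtain ⟨so, bo⟩ := od_sum hy (by norm_num : (1:ℝ) < 3/2) le_rfl
  have hs := (diag_hasSum hy T).summable.add (so.mul_left (T^(-(1/2):ℝ)))
  have hb : ∀ q : ℕ × ℕ, ac y q.1 * ac y q.2 * ((1/T) / ((1/T)^2 + (Real.log q.1 - Real.log q.2)^2)) ≤ 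
     (if q.1 = q.2 then ac y q.1 * ac y q.2 * T else 0) + T^(-(1/2):ℝ) * od (3/2) y q := by
    intro q
    have h0 := mul_nonneg (ac_nonneg y q.1) (ac_nonneg y q.2)
    have h00 : 0 ≤ T^(-(1/2):ℝ) * od (3/2) y q := mul_nonneg (Real.rpow_nonneg hT0.le _) (od_nonneg _ y q)
    by_cases hq : q.1 = q.2
    · rw [if_pos hq, hq, sub_self]
      have : (1/T) / ((1/T)^2 + 0^2) = T := by field_simp; simp
      rw [this]; linarith
    · rw [if_neg hq, zero_add]
      by_cases hz : ac y q.1 * ac y q.2 = 0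
      · rw [hz, zero_mul]; exact h00
      · have := mul_le_mul_of_nonneg_left (lor_bound hT0 (log_ne_of_ac hz hq)) h0
        refine this.trans (le_of_eq ?_)
        unfold od; ring
  have h2 := h1.summable.tsum_le_tsum hb hs
  rw [h1.tsum_eq, (diag_hasSum hy T).summable.tsum_add (so.mul_left _), (diag_hasSum hy T).tsum_eq, tsum_mul_left] at h2
  have h3 : (∫ t in (0:ℝ)..T, ‖PS t y‖^2) ≤ Real.exp 1 * ∫ t in Ioi (0:ℝ), Real.exp (-t/T) * ‖PS t y‖^2 := by
    rw [intervalIntegral.integral_of_le hT0.le, ← integral_const_mul]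
    have i1 : IntegrableOn (fun t => Real.exp 1 * (Real.exp (-t/T) * ‖PS t y‖^2)) (Ioi 0) := by
      refine Integrable.const_mul ?_ _
      refine hexp.mul_bdd (c := (∑' n, ac y n)^2) ((PS_cont y).norm.pow 2).aestronglyMeasurable (Eventually.of_forall fun t => ?_)
      rw [norm_pow, norm_norm]
      exact pow_le_pow_left₀ (norm_nonneg _) (PS_norm_le t y) 2
    refine (setIntegral_mono_on (((PS_cont y).norm.pow 2).integrableOn_Ioc) (i1.mono_set Ioc_subset_Ioi_self) measurableSet_Ioc ?_).trans
      (setIntegral_mono_set i1 (Eventually.of_forall fun t => by positivity) (Ioc_subset_Ioi_self.eventuallyLE))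
    intro t ht
    rw [← mul_assoc, ← Real.exp_add]
    refine le_mul_of_one_le_left (sq_nonneg _) (Real.one_le_exp ?_)
    have : t / T ≤ 1 := (div_le_one hT0).2 ht.2
    rw [neg_div]; linarith
  have h4 : T^(-(1/2):ℝ) * Real.exp (3/2*y) ≤ T := by
    have : Real.exp (3/2*y) ≤ T^(3/2:ℝ) := by
      rw [Real.rpow_def_of_pos hT0]; exact Real.exp_le_exp.2 (by linarith)
    calc T^(-(1/2):ℝ) * Real.exp (3/2*y) ≤ T^(-(1/2):ℝ) * T^(3/2:ℝ) := by
          exact mul_le_mul_of_nonneg_left this (Real.rpow_nonneg hT0.le _)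
      _ = T := by rw [← Real.rpow_add hT0]; norm_num
  have h5 := QQ_le hy
  have hD := Dp_nonneg (3/2)
  have h6 : T^(-(1/2):ℝ) * ∑' q, od (3/2) y q ≤ Dp (3/2) * (T * (y+4)) := by
    refine (mul_le_mul_of_nonneg_left bo (Real.rpow_nonneg hT0.le _)).trans ?_
    calc T^(-(1/2):ℝ) * (Dp (3/2) * ((y+4) * Real.exp (3/2*y))) = Dp (3/2) * ((T^(-(1/2):ℝ) * Real.exp (3/2*y)) * (y+4)) := by ring
      _ ≤ Dp (3/2) * (T * (y+4)) := mul_le_mul_of_nonneg_left (mul_le_mul_of_nonneg_right h4 (by linarith)) hD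
  have h7 : T * QQ y ≤ CW * (T * (y+4)) := by
    have := mul_le_mul_of_nonneg_left h5 hT0.le
    linarith
  refine h3.trans ?_
  unfold CP
  rw [mul_assoc]
  refine mul_le_mul_of_nonneg_left ?_ (Real.exp_pos _).le
  linarith

end PC

namespace PC
open ArithmeticFunction (vonMangoldt)

def eps (T : ℝ) : ℝ := 1 / Real.log T + T^(-(1/4):ℝ) * Real.log T
def C2 : ℝ := 2 * CC^2 + 128 * π * CC^2
lemma C2_nonneg : 0 ≤ C2 := by unfold C2; positivity
def PP (T y : ℝ) : ℝ := ∫ t in (0:ℝ)..T, ‖PS t y‖^2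

lemma PP_nonneg {T : ℝ} (hT : 0 ≤ T) (y : ℝ) : 0 ≤ PP T y :=
  intervalIntegral.integral_nonneg hT fun _ _ => sq_nonneg _

lemma eps_tendsto : Tendsto eps atTop (nhds 0) := by
  have h1 : Tendsto (fun T : ℝ => 1 / Real.log T) atTop (nhds 0) := by
    simp_rw [one_div]; exact Real.tendsto_log_atTop.inv_tendsto_atTop
  have h2 : Tendsto (fun T : ℝ => T^(-(1/4):ℝ) * Real.log T) atTop (nhds 0) := by
    have := (isLittleO_log_rpow_atTop (show (0:ℝ) < 1/4 by norm_num)).tendsto_div_nhds_zero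
    refine this.congr' ?_
    filter_upwards [eventually_gt_atTop 0] with T hT
    rw [Real.rpow_neg hT.le]; field_simp
  have := h1.add h2
  rw [add_zero] at this
  exact this

lemma eps_nonneg {T : ℝ} (hT : 3 ≤ T) : 0 ≤ eps T := by
  have := one_le_log hT
  have := Real.rpow_nonneg (by linarith : 0 ≤ T) (-(1/4):ℝ)
  unfold eps; positivity

lemma y_exp {y : ℝ} (_hy : 0 ≤ y) : (y + 4) * Real.exp (-y) ≤ 4 * Real.exp (-(y/2)) := by
  have h1 := Real.add_one_le_exp (y/2)
  have e : Real.exp (-y) = Real.exp (-(y/2)) * Real.exp (-(y/2)) := by rw [← Real.exp_add]; congr 1; ring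
  have e2 : Real.exp (y/2) * Real.exp (-(y/2)) = 1 := by rw [← Real.exp_add]; simp
  have hp := Real.exp_pos (-(y/2))
  have : (y + 4) * Real.exp (-(y/2)) ≤ 4 := by
    calc (y + 4) * Real.exp (-(y/2)) ≤ (4 * Real.exp (y/2)) * Real.exp (-(y/2)) := by gcongr; linarith
      _ = 4 := by rw [mul_assoc, e2, mul_one]
  rw [e, ← mul_assoc]
  exact mul_le_mul_of_nonneg_right this hp.le

lemma FRa (hRH : RiemannHypothesis) {T a θ : ℝ} (hT : 3 ≤ T) (ha : 0 < a) (ha1 : a ≤ 1) (hθ : 0 < θ) (hθ1 : θ ≤ 1) :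
    |FR T a - PP T (a * Real.log T) / (T * Real.log T) - Real.log T * Real.exp (-(2 * (a * Real.log T)))| ≤
      θ * (5 * CP + Real.log T * Real.exp (-(2 * (a * Real.log T)))) + 4 * (CP + 1) * Real.exp (-(a * Real.log T / 2))
        + (3 * CE / θ + C2) * eps T := by
  have hL := one_le_log hT
  have hT0 : 0 < T := by linarith
  set L := Real.log T with hLd
  set y := a * L with hy
  have hy0 : 0 < y := by positivity
  have hyL : y ≤ L := by nlinarith
  have hs : 0 < L * Real.exp (-y) := by positivity
  have h1 := inside hRH hT hy0 hyL hs hθ hθ1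
  have hK0 : 0 < T^(3/4:ℝ) := Real.rpow_pos_of_pos hT0 _
  have hKT : T^(3/4:ℝ) ≤ T := by
    nth_rewrite 2 [← Real.rpow_one T]
    exact Real.rpow_le_rpow_of_exponent_le (by linarith) (by norm_num)
  have h2 := outside hRH (y := y) hT hK0 hKT
  have h3 := NT_le' hRH hT
  have h3' := NT_nonneg T
  have hP := mv_crude (by linarith : 1 ≤ T) hy0.le hyL
  have hP0 := PP_nonneg hT0.le y
  have hCP := CP_nonneg
  change PP T y ≤ _ at hP
  rw [FR_eq_int hRH (by linarith)]
  rw [← hLd] at h1 h2 h3 ⊢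
  rw [← hy]
  change |_ - PP T y - _| ≤ _ * PP T y + _ + _ at h1
  set I := ∫ t, ‖bT T t y‖^2
  set J := ∫ t in (0:ℝ)..T, ‖bT T t y‖^2
  set P := PP T y
  have hTL : 0 < T * L := by positivity
  have hE2 : Real.exp (-(2*y)) = Real.exp (-y) ^ 2 := by rw [← Real.exp_nat_mul]; congr 1; push_cast; ring
  have e0 : (T*L)⁻¹ * I - P / (T*L) - L * Real.exp (-(2*y)) = (I - P - T * (L * Real.exp (-y))^2) / (T*L) := by
    rw [hE2]; field_simp
  rw [e0, abs_div, abs_of_pos hTL, div_le_iff₀ hTL]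
  have h4 : |I - P - T * (L * Real.exp (-y))^2| ≤ |I - J| + |J - P - T * (L * Real.exp (-y))^2| := by
    refine le_trans (le_of_eq ?_) (abs_add_le _ _); congr 1; ring
  refine h4.trans ((add_le_add h2 h1).trans ?_)
  -- pieces
  have hK4 : T^(3/4:ℝ) = T * T^(-(1/4):ℝ) := by
    nth_rewrite 2 [← Real.rpow_one T]
    rw [← Real.rpow_add hT0]; norm_num
  set k := T^(-(1/4):ℝ) with hk
  have hk0 : 0 < k := Real.rpow_pos_of_pos hT0 _
  have hk1 : k ≤ 1 := Real.rpow_le_one_of_one_le_of_nonpos (by linarith) (by norm_num)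
  have hKs : (T^(3/4:ℝ))^2 = T^2 * k^2 := by rw [hK4]; ring
  have hk4 : k^4 = T⁻¹ := by
    rw [hk, ← Real.rpow_natCast, ← Real.rpow_mul hT0.le]; norm_num [Real.rpow_neg_one]
  have p1 : 8 * π * (NT T)^2 / (T^(3/4:ℝ))^2 ≤ 128 * π * CC^2 * (T * L * (k * L)) := by
    rw [hKs, div_le_iff₀ (by positivity)]
    have : (NT T)^2 ≤ (4*T*(CC*L))^2 := pow_le_pow_left₀ h3' h3 2
    have e : T * k^3 ≥ 0 := by positivity
    have e5 : T * k^4 = 1 := by rw [hk4]; field_simp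
    have e6 : (1:ℝ) ≤ T * k^3 := by
      calc (1:ℝ) = T * k^3 * k := by rw [← e5]; ring
        _ ≤ T * k^3 * 1 := by gcongr
        _ = _ := by ring
    calc 8 * π * (NT T)^2 ≤ 8 * π * (4*T*(CC*L))^2 := by gcongr
      _ = (128 * π * CC^2 * T^2 * L^2) * 1 := by ring
      _ ≤ (128 * π * CC^2 * T^2 * L^2) * (T * k^3) := by gcongr
      _ = _ := by ring
  have p2 : 2 * T^(3/4:ℝ) * (CC * L)^2 = 2 * CC^2 * (T * L * (k * L)) := by rw [hK4]; ring
  have p3 : L * Real.exp (-y) * P ≤ CP * (4 * Real.exp (-(y/2))) * (T * L) := by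
    calc L * Real.exp (-y) * P ≤ L * Real.exp (-y) * (CP * (T * (y+4))) := by gcongr
      _ = CP * ((y + 4) * Real.exp (-y)) * (T * L) := by ring
      _ ≤ _ := by have := y_exp hy0.le; gcongr
  have p4 : θ * P ≤ θ * (5 * CP) * (T * L) := by
    calc θ * P ≤ θ * (CP * (T * (5 * L))) := by
          refine mul_le_mul_of_nonneg_left (hP.trans ?_) hθ.le
          gcongr; linarith
      _ = _ := by ring
  have p5 : 1 / (L * Real.exp (-y)) * (T * (L * Real.exp (-y))^2) ≤ 4 * Real.exp (-(y/2)) * (T * L) := by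
    have : Real.exp (-y) ≤ 4 * Real.exp (-(y/2)) := by
      have := y_exp hy0.le
      nlinarith [Real.exp_pos (-y)]
    calc 1 / (L * Real.exp (-y)) * (T * (L * Real.exp (-y))^2) = Real.exp (-y) * (T * L) := by field_simp
      _ ≤ _ := by gcongr
  have p6 : θ * (T * (L * Real.exp (-y))^2) = θ * (L * Real.exp (-(2*y))) * (T * L) := by rw [hE2]; ring
  have p7 : 3 / θ * (CE * (T + T^(3/4:ℝ) * L^2)) = 3 * CE / θ * eps T * (T * L) := by
    unfold eps
    rw [hK4, ← hLd, ← hk]; field_simp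
  have p8 : 128 * π * CC^2 * (T * L * (k * L)) + 2 * CC^2 * (T * L * (k * L)) ≤ C2 * eps T * (T * L) := by
    have : k * L ≤ eps T := by
      unfold eps
      rw [← hLd, ← hk]
      have : 0 ≤ 1 / L := by positivity
      linarith
    calc _ = C2 * (k * L) * (T * L) := by unfold C2; ring
      _ ≤ _ := by have := C2_nonneg; gcongr
  calc _ = (2 * T^(3/4:ℝ) * (CC * L)^2 + 8 * π * (NT T)^2 / (T^(3/4:ℝ))^2) + (L * Real.exp (-y) * P + θ * P)
        + (1 / (L * Real.exp (-y)) * (T * (L * Real.exp (-y))^2) + θ * (T * (L * Real.exp (-y))^2)) + 3 / θ * (CE * (T + T^(3/4:ℝ) * L^2)) := by ring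
    _ ≤ (2 * CC^2 * (T * L * (k * L)) + 128 * π * CC^2 * (T * L * (k * L))) + (CP * (4 * Real.exp (-(y/2))) * (T * L) + θ * (5 * CP) * (T * L))
        + (4 * Real.exp (-(y/2)) * (T * L) + θ * (L * Real.exp (-(2*y))) * (T * L)) + 3 * CE / θ * eps T * (T * L) := by
          rw [p2, p6, p7]; linarith
    _ ≤ _ := by linarith

lemma PP_sharp {T a δ : ℝ} (hT : 3 ≤ T) (ha : 0 < a) (ha1 : a ≤ 1 - δ) (hδ : 0 < δ) (hδ1 : δ ≤ 1/2) :
    |PP T (a * Real.log T) / (T * Real.log T) - QQ (a * Real.log T) / Real.log T| ≤ 5 * (Dp (1+δ) + CW^2) * T^(-δ^2) := by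
  have hL := one_le_log hT
  have hT0 : 0 < T := by linarith
  have hD := Dp_nonneg (1+δ)
  have hy0 : 0 < a * Real.log T := by positivity
  have h := mv_sharp hT0 hy0.le (by linarith : 1 < 1 + δ) (by linarith)
  change |PP T _ - _| ≤ _ at h
  have hyL : a * Real.log T ≤ (1-δ) * Real.log T := by gcongr
  set y := a * Real.log T
  have e : PP T y / (T * Real.log T) - QQ y / Real.log T = (PP T y - T * QQ y) / (T * Real.log T) := by field_simp
  rw [e, abs_div, abs_of_pos (by positivity : 0 < T * Real.log T), div_le_iff₀ (by positivity)]
  refine h.trans ?_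
  have h1 : Real.exp ((1+δ) * y) ≤ T^(-δ^2) * T := by
    have : T^(-δ^2) * T = T^(-δ^2 + 1) := by rw [Real.rpow_add hT0, Real.rpow_one]
    rw [this, Real.rpow_def_of_pos hT0]
    refine Real.exp_le_exp.2 ?_
    nlinarith
  calc (Dp (1+δ) + CW^2) * ((y+4) * Real.exp ((1+δ)*y)) ≤ (Dp (1+δ) + CW^2) * ((5 * Real.log T) * (T^(-δ^2) * T)) := by
        gcongr; nlinarith
    _ = _ := by ring

/-- boundedness on `[1/2,1]` -/
lemma FR_bdd (hRH : RiemannHypothesis) : ∃ M : ℝ, ∀ᶠ T in atTop, ∀ a, 1/2 ≤ a → a ≤ 1 → FR T a ≤ M := by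
  refine ⟨5 * CP + 1 + (5 * CP + 1) + 4 * (CP + 1) + (3 * CE + C2) * 1, ?_⟩
  filter_upwards [eventually_ge_atTop 3, eps_tendsto.eventually (gt_mem_nhds (show (0:ℝ) < 1 by norm_num))] with T hT hE a ha ha1
  have hL := one_le_log hT
  have hT0 : 0 < T := by linarith
  have h := FRa hRH hT (by linarith : 0 < a) ha1 one_pos le_rfl
  have hP := mv_crude (y := a * Real.log T) (by linarith : 1 ≤ T) (by positivity) (by nlinarith)
  change PP T _ ≤ _ at hP
  have hCP := CP_nonneg
  have hCE := CE_nonneg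
  have hC2 := C2_nonneg
  have h1 : PP T (a * Real.log T) / (T * Real.log T) ≤ 5 * CP := by
    rw [div_le_iff₀ (by positivity)]
    refine hP.trans ?_
    calc CP * (T * (a * Real.log T + 4)) ≤ CP * (T * (5 * Real.log T)) := by gcongr; nlinarith
      _ = _ := by ring
  have h2 : Real.log T * Real.exp (-(2 * (a * Real.log T))) ≤ 1 := by
    have h3 : Real.exp (-(2 * (a * Real.log T))) ≤ Real.exp (-Real.log T) := Real.exp_le_exp.2 (by nlinarith)
    have h4 := Real.add_one_le_exp (Real.log T)
    have h5 : Real.exp (Real.log T) * Real.exp (-Real.log T) = 1 := by rw [← Real.exp_add]; simp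
    calc _ ≤ Real.exp (Real.log T) * Real.exp (-Real.log T) := by gcongr; linarith
      _ = 1 := h5
  have h3 : Real.exp (-(a * Real.log T / 2)) ≤ 1 := Real.exp_le_one_iff.2 (by have : 0 < a * Real.log T := by positivity
                                                                              linarith)
  have h4 := (abs_le.1 h).2
  have h5 : 4 * (CP + 1) * Real.exp (-(a * Real.log T / 2)) ≤ 4 * (CP + 1) := mul_le_of_le_one_right (by positivity) h3
  have h6 : (3 * CE / 1 + C2) * eps T ≤ (3 * CE + C2) * 1 := by
    rw [div_one]; gcongr
  linarith

end PC

namespace PC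
open ArithmeticFunction (vonMangoldt)

lemma log_fact (N : ℕ) : Real.log (N.factorial) = ∑ n ∈ Finset.Ioc 0 N, Real.log n := by
  induction N with
  | zero => simp
  | succ k ih =>
    rw [Nat.factorial_succ, Finset.sum_Ioc_succ_top (by omega), ← ih]
    push_cast
    rw [Real.log_mul (by positivity) (by positivity), add_comm]

lemma log_fact_vM (N : ℕ) : Real.log (N.factorial) = ∑ d ∈ Finset.Ioc 0 N, vonMangoldt d * ((N / d : ℕ) : ℝ) := by
  rw [log_fact]
  have h1 : ∀ n ∈ Finset.Ioc 0 N, Real.log n = ∑ d ∈ Finset.Ioc 0 N, if d ∣ n then vonMangoldt d else 0 := by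
    intro n hn
    rw [Finset.mem_Ioc] at hn
    rw [← ArithmeticFunction.vonMangoldt_sum, ← Finset.sum_filter]
    refine Finset.sum_congr ?_ fun _ _ => rfl
    ext d
    simp only [Nat.mem_divisors, Finset.mem_filter, Finset.mem_Ioc]
    constructor
    · rintro ⟨h, _⟩
      exact ⟨⟨Nat.pos_of_dvd_of_pos h hn.1, (Nat.le_of_dvd hn.1 h).trans hn.2⟩, h⟩
    · rintro ⟨_, h⟩; exact ⟨h, by omega⟩
  rw [Finset.sum_congr rfl h1, Finset.sum_comm]
  refine Finset.sum_congr rfl fun d _ => ?_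
  rw [← Finset.sum_filter, Finset.sum_const, Nat.Ioc_filter_dvd_card_eq_div, nsmul_eq_mul, mul_comm]

def M1 (N : ℕ) : ℝ := ∑ n ∈ Finset.Ioc 0 N, vonMangoldt n / n

lemma M1_bound {N : ℕ} (hN : 0 < N) : Real.log N - 1 ≤ M1 N ∧ M1 N ≤ Real.log N + (Real.log 4 + 4) := by
  have hN' : (0:ℝ) < N := by exact_mod_cast hN
  have h := log_fact_vM N
  have e : (N:ℝ) * M1 N = ∑ d ∈ Finset.Ioc 0 N, vonMangoldt d * ((N:ℝ) / d) := by
    rw [M1, Finset.mul_sum]; exact Finset.sum_congr rfl fun d _ => by ring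
  have hup : Real.log N.factorial ≤ N * M1 N := by
    rw [h, e]
    refine Finset.sum_le_sum fun d _ => mul_le_mul_of_nonneg_left Nat.cast_div_le ArithmeticFunction.vonMangoldt_nonneg
  have hlo : N * M1 N - Chebyshev.psi N ≤ Real.log N.factorial := by
    have : Chebyshev.psi N = ∑ d ∈ Finset.Ioc 0 N, vonMangoldt d := by rw [Chebyshev.psi, Nat.floor_natCast]
    rw [h, e, this, ← Finset.sum_sub_distrib]
    refine Finset.sum_le_sum fun d hd => ?_
    rw [Finset.mem_Ioc] at hd
    have hd' : (0:ℝ) < d := by exact_mod_cast hd.1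
    have h1 : (N:ℝ) / d - 1 ≤ ((N / d : ℕ):ℝ) := by
      rw [← Nat.floor_div_eq_div (K := ℝ)]
      have := Nat.lt_floor_add_one ((N:ℝ)/d)
      linarith
    have := mul_le_mul_of_nonneg_left h1 (ArithmeticFunction.vonMangoldt_nonneg (n := d))
    linarith
  have hpsi := Chebyshev.psi_le_const_mul_self hN'.le
  have f1 : Real.log N.factorial ≤ N * Real.log N := by
    rw [← Real.log_pow]
    refine Real.log_le_log (by positivity) ?_
    exact_mod_cast Nat.factorial_le_pow N
  have f2 : N * Real.log N - N ≤ Real.log N.factorial := by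
    have := Real.pow_div_factorial_le_exp N hN'.le N
    have h2 := Real.log_le_log (by positivity) this
    rw [Real.log_exp, Real.log_div (by positivity) (by positivity), Real.log_pow] at h2
    linarith
  constructor
  · have : (N:ℝ) * (Real.log N - 1) ≤ N * M1 N := by linarith
    exact le_of_mul_le_mul_left this hN'
  · have : (N:ℝ) * M1 N ≤ N * (Real.log N + (Real.log 4 + 4)) := by linarith
    exact le_of_mul_le_mul_left this hN'

def AA (Y : ℝ) : ℝ := M1 ⌊Real.exp Y⌋₊

lemma AA_bound {Y : ℝ} (hY : 0 ≤ Y) : |AA Y - Y| ≤ Real.log 4 + 4 := by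
  have h1 : 1 ≤ Real.exp Y := Real.one_le_exp hY
  have hN : 0 < ⌊Real.exp Y⌋₊ := Nat.floor_pos.2 h1
  obtain ⟨a, b⟩ := M1_bound hN
  have c1 := Nat.floor_le (Real.exp_pos Y).le
  have c2 := Nat.lt_floor_add_one (Real.exp Y)
  set N := ⌊Real.exp Y⌋₊
  have hN' : (1:ℝ) ≤ N := by exact_mod_cast hN
  have d1 : Real.log N ≤ Y := by
    have := Real.log_le_log (by linarith) c1; rwa [Real.log_exp] at this
  have d2 : Y ≤ Real.log N + Real.log 2 := by
    rw [← Real.log_mul (by positivity) (by norm_num)]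
    have := Real.log_le_log (Real.exp_pos Y) (show Real.exp Y ≤ N * 2 by linarith)
    rwa [Real.log_exp] at this
  have hl2 : Real.log 2 ≤ 1 := by have := Real.log_two_lt_d9; linarith
  have hl4 : 0 ≤ Real.log 4 := Real.log_nonneg (by norm_num)
  change |M1 N - Y| ≤ _
  rw [abs_le]; constructor <;> linarith

/-- finite index set `log n ≤ Y`. -/
def NY (Y : ℝ) : Finset ℕ := Finset.Ioc 0 ⌊Real.exp Y⌋₊

lemma mem_NY {Y : ℝ} {n : ℕ} : n ∈ NY Y ↔ 0 < n ∧ Real.log n ≤ Y := by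
  unfold NY
  rw [Finset.mem_Ioc, Nat.le_floor_iff (Real.exp_pos Y).le]
  refine and_congr_right fun h => ?_
  rw [Real.log_le_iff_le_exp (by exact_mod_cast h)]

def B1 (Y : ℝ) : ℝ := ∑ n ∈ NY Y, vonMangoldt n / n * Real.log n

lemma B1_bound {Y : ℝ} (hY : 0 ≤ Y) : |B1 Y - Y^2/2| ≤ 2 * (Real.log 4 + 4) * Y := by
  have h1 : B1 Y = ∫ v in (0:ℝ)..Y, ∑ n ∈ NY Y, vonMangoldt n / n * (indicator (Iio (Real.log n)) (fun _ => (1:ℝ)) v) := by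
    rw [intervalIntegral.integral_finsetSum]
    · refine Finset.sum_congr rfl fun n hn => ?_
      obtain ⟨h0, h2⟩ := mem_NY.1 hn
      rw [intervalIntegral.integral_const_mul]
      congr 1
      rw [intervalIntegral.integral_of_le hY, setIntegral_indicator measurableSet_Iio]
      have : Ioc 0 Y ∩ Iio (Real.log n) = Ioo 0 (Real.log n) := by
        ext v; simp only [mem_inter_iff, mem_Ioc, mem_Iio, mem_Ioo]
        constructor
        · rintro ⟨⟨a, b⟩, c⟩; exact ⟨a, c⟩
        · rintro ⟨a, c⟩; exact ⟨⟨a, by linarith⟩, c⟩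
      rw [this]; simp [log_nat_nonneg n]
    · intro n _
      refine IntervalIntegrable.const_mul ?_ _
      rw [intervalIntegrable_iff]
      exact (integrable_indicator_iff measurableSet_Iio).2 (integrableOn_const (by
        rw [Measure.restrict_apply measurableSet_Iio]
        refine ne_top_of_le_ne_top ?_ (measure_mono inter_subset_right); simp [uIoc_of_le hY]))
  have h2 : ∀ v ∈ Icc 0 Y, ∑ n ∈ NY Y, vonMangoldt n / n * (indicator (Iio (Real.log n)) (fun _ => (1:ℝ)) v) = AA Y - AA v := by
    intro v hv
    have e1 : AA v = ∑ n ∈ NY Y, vonMangoldt n / n * (if Real.log n ≤ v then 1 else 0) := by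
      simp_rw [mul_ite, mul_one, mul_zero]
      rw [← Finset.sum_filter]
      change ∑ n ∈ NY v, vonMangoldt n / n = _
      refine Finset.sum_congr ?_ fun _ _ => rfl
      ext n
      rw [Finset.mem_filter, mem_NY, mem_NY]
      constructor
      · rintro ⟨a, b⟩; exact ⟨⟨a, b.trans hv.2⟩, b⟩
      · rintro ⟨⟨a, _⟩, b⟩; exact ⟨a, b⟩
    have e2 : AA Y = ∑ n ∈ NY Y, vonMangoldt n / n := rfl
    rw [e1, e2, ← Finset.sum_sub_distrib]
    refine Finset.sum_congr rfl fun n _ => ?_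
    by_cases h : Real.log n ≤ v
    · rw [indicator_of_notMem (by simpa using h), if_pos h]; ring
    · rw [indicator_of_mem (by simpa using h), if_neg h]; ring
  have h3 : Y^2/2 = ∫ v in (0:ℝ)..Y, (Y - v) := by
    rw [intervalIntegral.integral_sub (by simp) (by simp)]; simp; ring
  have hb : ∀ v ∈ uIoc (0:ℝ) Y, ‖(∑ n ∈ NY Y, vonMangoldt n / n * (indicator (Iio (Real.log n)) (fun _ => (1:ℝ)) v)) - (Y - v)‖ ≤ 2 * (Real.log 4 + 4) := by
    intro v hv
    rw [uIoc_of_le hY] at hv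
    rw [h2 v ⟨hv.1.le, hv.2⟩, Real.norm_eq_abs]
    have a := abs_le.1 (AA_bound hY)
    have b := abs_le.1 (AA_bound hv.1.le)
    rw [abs_le]; constructor <;> linarith
  have := intervalIntegral.norm_integral_le_of_norm_le_const hb
  rw [intervalIntegral.integral_sub ?_ (by apply Continuous.intervalIntegrable; fun_prop), ← h1, ← h3, sub_zero, abs_of_nonneg hY, Real.norm_eq_abs] at this
  · exact this
  · refine IntervalIntegrable.sum (NY Y) (f := fun n v => vonMangoldt n / n * (indicator (Iio (Real.log n)) (fun _ => (1:ℝ)) v)) ?_ |>.congr ?_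
    · intro n _
      refine IntervalIntegrable.const_mul ?_ _
      rw [intervalIntegrable_iff]
      exact (integrable_indicator_iff measurableSet_Iio).2 (integrableOn_const (by
        rw [Measure.restrict_apply measurableSet_Iio]
        refine ne_top_of_le_ne_top ?_ (measure_mono inter_subset_right); simp [uIoc_of_le hY]))
    · intro v _; simp

lemma nonprime_sum : ∃ C : ℝ, 0 ≤ C ∧ ∀ s : Finset ℕ, ∑ n ∈ s, (if n.Prime then 0 else vonMangoldt n / n) ≤ C := by
  obtain ⟨C, hC⟩ := Chebyshev.psi_sub_theta_le_mul_sqrt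
  have hC0 : 0 ≤ C := by
    have h := hC 1
    rw [Chebyshev.theta_eq_zero_of_le_one le_rfl, Chebyshev.psi_eq_zero_of_lt_two (by norm_num)] at h
    simpa using h
  have hv : Summable (fun k : ℕ => C * Real.exp (1/2) * Real.exp ((k:ℝ) * (-(1/2)))) :=
    (Real.summable_exp_nat_mul_iff.2 (by norm_num)).mul_left _
  have hf0 : ∀ n : ℕ, 0 ≤ (if n.Prime then 0 else vonMangoldt n / n) := by
    intro n; split_ifs
    · exact le_rfl
    · exact div_nonneg ArithmeticFunction.vonMangoldt_nonneg (Nat.cast_nonneg _)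
  suffices hk : ∀ N k : ℕ, ∑ n ∈ Finset.range N with wk n = k, (if n.Prime then 0 else vonMangoldt n / n) ≤ C * Real.exp (1/2) * Real.exp ((k:ℝ) * (-(1/2))) by
    obtain ⟨a, b⟩ := window (f := fun n : ℕ => if n.Prime then 0 else vonMangoldt n / n) hf0 (fun k => by positivity) hk hv
    exact ⟨_, tsum_nonneg hf0, fun s => a.sum_le_tsum s fun n _ => hf0 n⟩
  · intro N k
    have hle : ∑ n ∈ Finset.range N with wk n = k, (if n.Prime then 0 else vonMangoldt n / n) ≤
        Real.exp (-k) * (Chebyshev.psi (Real.exp (k+1)) - Chebyshev.theta (Real.exp (k+1))) := by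
      rw [Chebyshev.psi_sub_theta_eq_sum_not_prime, Finset.mul_sum]
      calc ∑ n ∈ Finset.range N with wk n = k, (if n.Prime then 0 else vonMangoldt n / n)
          ≤ ∑ n ∈ Finset.range N with wk n = k, (if n.Prime then 0 else Real.exp (-k) * vonMangoldt n) := by
            refine Finset.sum_le_sum fun n hn => ?_
            split_ifs
            · exact le_rfl
            · rcases Nat.eq_zero_or_pos n with h | h
              · subst h; simp
              · have h1 := (wk_bounds (Finset.mem_filter.1 hn).2).1
                have hn0 : (0:ℝ) < n := by exact_mod_cast h
                rw [Real.le_log_iff_exp_le hn0] at h1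
                rw [Real.exp_neg, div_eq_inv_mul]
                exact mul_le_mul_of_nonneg_right (inv_anti₀ (Real.exp_pos _) h1) ArithmeticFunction.vonMangoldt_nonneg
        _ = ∑ n ∈ (Finset.range N).filter (fun n => wk n = k) with ¬ n.Prime, Real.exp (-k) * vonMangoldt n := by
            rw [Finset.sum_filter (p := fun n => ¬ Nat.Prime n) (s := (Finset.range N).filter (fun n => wk n = k))]
            refine Finset.sum_congr rfl fun n _ => ?_
            by_cases h : n.Prime <;> simp [h]
        _ ≤ ∑ n ∈ (Finset.Ioc 0 ⌊Real.exp (k+1)⌋₊ ∪ {0}) with ¬ n.Prime, Real.exp (-k) * vonMangoldt n := by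
            refine Finset.sum_le_sum_of_subset_of_nonneg (fun n hn => ?_) fun _ _ _ => mul_nonneg (Real.exp_pos _).le ArithmeticFunction.vonMangoldt_nonneg
            simp only [Finset.mem_filter] at hn ⊢
            refine ⟨?_, hn.2⟩
            have h1 := (wk_bounds hn.1.2).2
            rcases Nat.eq_zero_or_pos n with h | h
            · simp [h]
            · refine Finset.mem_union_left _ (Finset.mem_Ioc.2 ⟨h, Nat.le_floor ?_⟩)
              exact ((Real.log_lt_iff_lt_exp (by exact_mod_cast h)).1 h1).le
        _ = _ := by
            rw [Finset.filter_union, Finset.sum_union]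
            · have : ∑ n ∈ ({0} : Finset ℕ) with ¬ n.Prime, Real.exp (-k) * vonMangoldt n = 0 := by
                refine Finset.sum_eq_zero fun n hn => ?_
                have := (Finset.mem_filter.1 hn).1
                rw [Finset.mem_singleton] at this
                subst this; simp
              rw [this, add_zero]
            · refine Finset.disjoint_filter_filter ?_
              simp
    refine hle.trans ((mul_le_mul_of_nonneg_left (hC _) (Real.exp_pos _).le).trans (le_of_eq ?_))
    have : √(Real.exp (k+1)) = Real.exp ((k+1)/2) := by
      rw [Real.exp_half]
    rw [this, show ∀ a b c : ℝ, a * (b * c) = b * (a * c) by intros; ring, mul_assoc, ← Real.exp_add, ← Real.exp_add]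
    congr 2; ring

def B2 (Y : ℝ) : ℝ := ∑ n ∈ NY Y, vonMangoldt n ^ 2 / n

lemma B2_bound : ∃ C : ℝ, 0 ≤ C ∧ ∀ Y : ℝ, 0 ≤ Y → |B2 Y - Y^2/2| ≤ C * Y := by
  obtain ⟨C, hC0, hC⟩ := nonprime_sum
  have hl4 : 0 ≤ Real.log 4 := Real.log_nonneg (by norm_num)
  refine ⟨C + 2 * (Real.log 4 + 4), by positivity, fun Y hY => ?_⟩
  have h1 := abs_le.1 (B1_bound hY)
  have h2 : B2 Y ≤ B1 Y := by
    refine Finset.sum_le_sum fun n hn => ?_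
    have a := ArithmeticFunction.vonMangoldt_nonneg (n := n)
    have b := ArithmeticFunction.vonMangoldt_le_log (n := n)
    rw [sq, mul_div_right_comm]
    exact mul_le_mul_of_nonneg_left b (div_nonneg a (Nat.cast_nonneg _))
  have h3 : B1 Y - B2 Y ≤ C * Y := by
    unfold B1 B2
    rw [← Finset.sum_sub_distrib]
    calc _ ≤ ∑ n ∈ NY Y, (if n.Prime then 0 else vonMangoldt n / n) * Y := by
          refine Finset.sum_le_sum fun n hn => ?_
          have a := ArithmeticFunction.vonMangoldt_nonneg (n := n)
          obtain ⟨b1, b2⟩ := mem_NY.1 hn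
          split_ifs with hp
          · rw [ArithmeticFunction.vonMangoldt_apply_prime hp, sq]; apply le_of_eq; ring
          · have c1 := mul_le_mul_of_nonneg_left b2 (div_nonneg a (Nat.cast_nonneg (α := ℝ) n))
            have c2 : 0 ≤ vonMangoldt n ^ 2 / (n:ℝ) := by positivity
            linarith
      _ ≤ C * Y := by
          rw [← Finset.sum_mul]
          exact mul_le_mul_of_nonneg_right (hC _) hY
  rw [abs_le]; constructor <;> linarith

end PC

namespace PC
open ArithmeticFunction (vonMangoldt)

lemma ac_sq (y : ℝ) (n : ℕ) : ac y n ^ 2 = vonMangoldt n ^ 2 / n * Real.exp (-(2 * |y - Real.log n|)) := by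
  rcases Nat.eq_zero_or_pos n with h | h
  · subst h; simp [ac]
  · have hn : (0:ℝ) < n := by exact_mod_cast h
    unfold ac
    rw [mul_pow, ← Real.exp_nat_mul, div_mul_eq_mul_div, mul_div_assoc]
    congr 1
    rw [eq_div_iff hn.ne']
    conv_lhs => rw [mul_comm, ← congrArg (· * Real.exp _) (Real.exp_log hn)]
    change Real.exp (Real.log n) * _ = _
    rw [← Real.exp_add]; congr 1; push_cast; ring

lemma kap_bound {Y l : ℝ} (hY : 0 ≤ Y) (hl : 0 ≤ l) :
    |(∫ y in (0:ℝ)..Y, Real.exp (-(2 * |y - l|))) - (if l ≤ Y then 1 else 0)| ≤ 1/2 * (Real.exp (-(2*|Y - l|)) + Real.exp (-(2 * |0 - l|))) := by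
  have up : ∀ a b : ℝ, a ≤ b → b ≤ l → ∫ y in a..b, Real.exp (-(2 * |y - l|)) = 1/2 * (Real.exp (-(2*|b - l|)) - Real.exp (-(2*|a-l|))) := by
    intro a b hab hbl
    have : ∫ y in a..b, Real.exp (-(2 * |y - l|)) = ∫ y in a..b, Real.exp (2 * (y - l)) := by
      refine intervalIntegral.integral_congr fun y hy => ?_
      rw [uIcc_of_le hab] at hy
      change Real.exp _ = Real.exp _
      rw [abs_of_nonpos (by linarith [hy.2])]; congr 1; ring
    rw [this, intervalIntegral.integral_eq_sub_of_hasDerivAt (f := fun y => 1/2 * Real.exp (2 * (y - l)))]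
    · rw [abs_of_nonpos (by linarith), abs_of_nonpos (by linarith)]
      rw [show -(2 * -(a - l)) = 2 * (a - l) by ring, show -(2 * -(b - l)) = 2 * (b - l) by ring]; ring
    · intro y _
      have h1 : HasDerivAt (fun y : ℝ => 2 * (y - l)) (2 * 1) y := ((hasDerivAt_id y).sub_const l).const_mul 2
      exact (h1.exp.const_mul (1/2)).congr_deriv (by ring)
    · apply Continuous.intervalIntegrable; fun_prop
  have dn : ∀ a b : ℝ, a ≤ b → l ≤ a → ∫ y in a..b, Real.exp (-(2 * |y - l|)) = 1/2 * (Real.exp (-(2*|a - l|)) - Real.exp (-(2*|b-l|))) := by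
    intro a b hab hbl
    have : ∫ y in a..b, Real.exp (-(2 * |y - l|)) = ∫ y in a..b, Real.exp (-2 * (y - l)) := by
      refine intervalIntegral.integral_congr fun y hy => ?_
      rw [uIcc_of_le hab] at hy
      change Real.exp _ = Real.exp _
      rw [abs_of_nonneg (by linarith [hy.1])]; congr 1; ring
    rw [this, intervalIntegral.integral_eq_sub_of_hasDerivAt (f := fun y => -(1/2) * Real.exp (-2 * (y - l)))]
    · rw [abs_of_nonneg (by linarith), abs_of_nonneg (by linarith)]
      rw [show -(2 * (a - l)) = -2 * (a - l) by ring, show -(2 * (b - l)) = -2 * (b - l) by ring]; ring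
    · intro y _
      have h1 : HasDerivAt (fun y : ℝ => -2 * (y - l)) (-2 * 1) y := ((hasDerivAt_id y).sub_const l).const_mul (-2)
      exact (h1.exp.const_mul (-(1/2))).congr_deriv (by ring)
    · apply Continuous.intervalIntegrable; fun_prop
  have c1 := Real.exp_pos (-(2*|Y - l|))
  have c2 := Real.exp_pos (-(2*|0 - l|))
  by_cases h : l ≤ Y
  · rw [if_pos h, ← intervalIntegral.integral_add_adjacent_intervals (b := l) (by apply Continuous.intervalIntegrable; fun_prop) (by apply Continuous.intervalIntegrable; fun_prop),
      up 0 l hl le_rfl, dn l Y h le_rfl]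
    simp only [sub_self, abs_zero, mul_zero, neg_zero, Real.exp_zero]
    rw [abs_le]; constructor <;> linarith
  · rw [if_neg h, up 0 Y hY (by linarith)]
    rw [abs_le]; constructor <;> linarith

lemma ac_sq_le {Y y : ℝ} (h0 : 0 ≤ y) (h1 : y ≤ Y) (n : ℕ) : ac y n ^ 2 ≤ Real.exp (2*Y) * ac 0 n ^ 2 := by
  rw [ac_sq, ac_sq, show ∀ a b c : ℝ, a * (b * c) = b * (a * c) by intros; ring, ← Real.exp_add]
  refine mul_le_mul_of_nonneg_left (Real.exp_le_exp.2 ?_) (by positivity)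
  have := abs_sub_abs_le_abs_sub (0 - Real.log n) (-y)
  rw [abs_neg, abs_of_nonneg h0, show (0 - Real.log n - -y) = y - Real.log n by ring] at this
  linarith

lemma QQ_contOn (Y : ℝ) : ContinuousOn QQ (Icc 0 Y) := by
  unfold QQ
  refine continuousOn_tsum (u := fun n => Real.exp (2*Y) * ac 0 n ^ 2) (fun n => ?_) ((QQ_summable le_rfl).mul_left _) fun n y hy => ?_
  · unfold ac; fun_prop
  · rw [Real.norm_of_nonneg (sq_nonneg _)]; exact ac_sq_le hy.1 hy.2 n

lemma QQ_int {Y : ℝ} (hY : 0 ≤ Y) : HasSum (fun n : ℕ => ∫ y in (0:ℝ)..Y, ac y n ^ 2) (∫ y in (0:ℝ)..Y, QQ y) := by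
  have hc : ∀ n, Continuous fun y => ac y n ^ 2 := fun n => by unfold ac; fun_prop
  simp_rw [intervalIntegral.integral_of_le hY]
  refine hasSum_integral_of_summable_integral_norm (fun n => (hc n).integrableOn_Ioc) ?_
  refine Summable.of_nonneg_of_le (fun n => integral_nonneg fun y => norm_nonneg _) (fun n => ?_) ((QQ_summable le_rfl).mul_left (Real.exp (2*Y) * Y))
  calc ∫ y in Ioc 0 Y, ‖ac y n ^ 2‖ ≤ ∫ y in Ioc 0 Y, Real.exp (2*Y) * ac 0 n ^ 2 := by
        refine setIntegral_mono_on (hc n).norm.integrableOn_Ioc (integrableOn_const (by simp)) measurableSet_Ioc fun y hy => ?_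
        rw [Real.norm_of_nonneg (sq_nonneg _)]; exact ac_sq_le hy.1.le hy.2 n
    _ = _ := by simp [hY]; ring

lemma QQ_asymp : ∃ C : ℝ, 0 ≤ C ∧ ∀ Y : ℝ, 0 ≤ Y → |(∫ y in (0:ℝ)..Y, QQ y) - Y^2/2| ≤ C * (Y + 8) := by
  obtain ⟨C, hC0, hC⟩ := B2_bound
  refine ⟨C + CW, add_nonneg hC0 CW_nonneg, fun Y hY => ?_⟩
  have h1 := QQ_int hY
  have h2 : HasSum (fun n : ℕ => vonMangoldt n ^ 2 / n * (if Real.log n ≤ Y then 1 else 0)) (B2 Y) := by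
    have e : B2 Y = ∑ n ∈ NY Y, vonMangoldt n ^ 2 / (n:ℝ) * (if Real.log n ≤ Y then 1 else 0) := by
      refine Finset.sum_congr rfl fun n hn => by rw [if_pos (mem_NY.1 hn).2, mul_one]
    rw [e]
    refine hasSum_sum_of_ne_finset_zero (L := SummationFilter.unconditional ℕ) (fun n hn => ?_)
    rw [mem_NY, not_and] at hn
    rcases Nat.eq_zero_or_pos n with h | h
    · subst h; simp
    · rw [if_neg (hn h), mul_zero]
  have hs : Summable (fun n : ℕ => 1/2 * (ac Y n ^ 2 + ac 0 n ^ 2)) := ((QQ_summable hY).add (QQ_summable le_rfl)).mul_left (1/2)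
  generalize hF : (fun n : ℕ => vonMangoldt n ^ 2 / (n:ℝ) * (if Real.log n ≤ Y then (1:ℝ) else 0)) = F at h2
  have h3 := h1.sub h2
  have hF' : ∀ n, F n = vonMangoldt n ^ 2 / (n:ℝ) * (if Real.log n ≤ Y then (1:ℝ) else 0) := fun n => by rw [← hF]
  have hb : ∀ n : ℕ, |(∫ y in (0:ℝ)..Y, ac y n ^ 2) - F n| ≤ 1/2 * (ac Y n ^ 2 + ac 0 n ^ 2) := by
    intro n
    rw [hF']
    simp_rw [ac_sq]
    rw [intervalIntegral.integral_const_mul, ← mul_sub, abs_mul, abs_of_nonneg (by positivity)]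
    have := kap_bound hY (log_nat_nonneg n)
    refine (mul_le_mul_of_nonneg_left this (by positivity)).trans (le_of_eq ?_)
    ring
  have h4 : Summable (fun n : ℕ => |(∫ y in (0:ℝ)..Y, ac y n ^ 2) - F n|) :=
    Summable.of_nonneg_of_le (fun _ => abs_nonneg _) hb hs
  have h5 := norm_tsum_le_tsum_norm (f := fun n : ℕ => (∫ y in (0:ℝ)..Y, ac y n ^ 2) - F n) h4
  rw [h3.tsum_eq] at h5
  simp only [Real.norm_eq_abs] at h5
  have h6 := h4.tsum_le_tsum hb hs
  rw [tsum_mul_left, (QQ_summable hY).tsum_add (QQ_summable le_rfl)] at h6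
  change _ ≤ 1/2 * (QQ Y + QQ 0) at h6
  have h7 := QQ_le hY
  have h8 := QQ_le (le_refl (0:ℝ))
  have h9 := abs_le.1 (hC Y hY)
  have h10 := abs_le.1 (h5.trans h6)
  have := CW_nonneg
  have : 0 ≤ CW * Y := by positivity
  rw [abs_le]; constructor <;> linarith

end PC

namespace PC

def CD (T a : ℝ) : ℝ := ∫ s in (0:ℝ)..a, FR T s

lemma exp_int {c : ℝ} (hc : 0 < c) (b : ℝ) : ∫ a in (0:ℝ)..b, Real.exp (-(c * a)) = (1 - Real.exp (-(c * b))) / c := by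
  rw [intervalIntegral.integral_eq_sub_of_hasDerivAt (f := fun a => -(1/c) * Real.exp (-(c * a)))]
  · simp only [mul_zero, neg_zero, Real.exp_zero]; field_simp; ring
  · intro y _
    have h1 : HasDerivAt (fun y : ℝ => -(c * y)) (-(c * 1)) y := ((hasDerivAt_id y).const_mul c).neg
    exact (h1.exp.const_mul (-(1/c))).congr_deriv (by field_simp)
  · apply Continuous.intervalIntegrable; fun_prop

lemma tendsto_of_theta {f : ℝ → ℝ} {l K : ℝ} (hK : 0 ≤ K)
    (h : ∀ θ, 0 < θ → θ ≤ 1 → ∃ R : ℝ → ℝ, Tendsto R atTop (nhds 0) ∧ ∀ᶠ T in atTop, |f T - l| ≤ θ * K + R T) :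
    Tendsto f atTop (nhds l) := by
  rw [Metric.tendsto_nhds]
  intro ε hε
  have hθ : 0 < min 1 (ε / (2 * (K + 1))) := by positivity
  obtain ⟨R, hR, hb⟩ := h _ hθ (min_le_left _ _)
  have hR' := hR.eventually (gt_mem_nhds (show (0:ℝ) < ε/2 by positivity))
  filter_upwards [hb, hR'] with T h1 h2
  rw [Real.dist_eq]
  have h3 : min 1 (ε / (2 * (K + 1))) * K ≤ ε / 2 := by
    calc _ ≤ (ε / (2 * (K + 1))) * (K + 1) := by
          gcongr
          · exact min_le_right _ _
          · linarith
      _ = ε / 2 := by field_simp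
  linarith

lemma cdf_lt (hRH : RiemannHypothesis) {b : ℝ} (hb : 0 < b) (hb1 : b < 1) :
    Tendsto (fun T => CD T b) atTop (nhds (1/2 + b^2/2)) := by
  obtain ⟨C, hC0, hC⟩ := QQ_asymp
  have hCP := CP_nonneg
  have hCE := CE_nonneg
  have hC2 := C2_nonneg
  set δ := min (1 - b) (1/2) with hδd
  have hδ : 0 < δ := lt_min (by linarith) (by norm_num)
  have hδb : b ≤ 1 - δ := by have := min_le_left (1-b) (1/2:ℝ); linarith
  have hδ2 : δ ≤ 1/2 := min_le_right _ _
  set D := 5 * (Dp (1+δ) + CW^2) with hD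
  have hD0 : 0 ≤ D := by have := Dp_nonneg (1+δ); positivity
  refine tendsto_of_theta (K := 5 * CP + 1/2) (by positivity) fun θ hθ hθ1 => ?_
  refine ⟨fun T => 8 * (CP + 1) * (1 / Real.log T) + (3 * CE / θ + C2) * eps T + D * T^(-δ^2)
    + C * (b + 8) * (1 / Real.log T) + Real.exp (-(2 * b * Real.log T)) / 2, ?_, ?_⟩
  · have t1 : Tendsto (fun T : ℝ => 1 / Real.log T) atTop (nhds 0) := by
      simp_rw [one_div]; exact Real.tendsto_log_atTop.inv_tendsto_atTop
    have t2 : Tendsto (fun T : ℝ => T^(-δ^2)) atTop (nhds 0) := tendsto_rpow_neg_atTop (by positivity)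
    have t3 : Tendsto (fun T : ℝ => Real.exp (-(2 * b * Real.log T))) atTop (nhds 0) :=
      Real.tendsto_exp_neg_atTop_nhds_zero.comp (Real.tendsto_log_atTop.const_mul_atTop (by positivity))
    have := ((((t1.const_mul (8 * (CP + 1))).add (eps_tendsto.const_mul (3 * CE / θ + C2))).add (t2.const_mul D)).add
      (t1.const_mul (C * (b + 8)))).add (t3.div_const 2)
    simpa using this
  · filter_upwards [eventually_ge_atTop 3] with T hT
    have hL := one_le_log hT
    have hT0 : 0 < T := by linarith
    set L := Real.log T with hLd
    have hL0 : 0 < L := by linarith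
    -- comparison functions
    have iF : IntervalIntegrable (FR T) volume 0 b := (FR_cont T).intervalIntegrable _ _
    have cQ : ContinuousOn (fun a => QQ (a * L) / L) (Icc 0 b) := by
      refine ContinuousOn.div_const ((QQ_contOn (b * L)).comp (by fun_prop) fun a ha => ?_) _
      exact ⟨mul_nonneg ha.1 hL0.le, mul_le_mul_of_nonneg_right ha.2 hL0.le⟩
    have iQ : IntervalIntegrable (fun a => QQ (a * L) / L) volume 0 b := by
      apply ContinuousOn.intervalIntegrable; rwa [uIcc_of_le hb.le]
    have iE : IntervalIntegrable (fun a => L * Real.exp (-(2 * L * a))) volume 0 b := by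
      apply Continuous.intervalIntegrable; fun_prop
    have vQ : ∫ a in (0:ℝ)..b, QQ (a * L) / L = (∫ y in (0:ℝ)..(b*L), QQ y) / L^2 := by
      rw [intervalIntegral.integral_div, intervalIntegral.integral_comp_mul_right (fun y => QQ y) hL0.ne', zero_mul, smul_eq_mul]
      field_simp
    have vE : ∫ a in (0:ℝ)..b, L * Real.exp (-(2 * L * a)) = (1 - Real.exp (-(2 * b * L))) / 2 := by
      rw [intervalIntegral.integral_const_mul, exp_int (by positivity), show 2 * L * b = 2 * b * L by ring]
      field_simp
    have hpt : ∀ a ∈ uIoc 0 b, ‖FR T a - QQ (a * L) / L - L * Real.exp (-(2 * L * a))‖ ≤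
        (θ * (5 * CP) + (3 * CE / θ + C2) * eps T + D * T^(-δ^2)) + θ * (L * Real.exp (-(2 * L * a))) + 4 * (CP + 1) * Real.exp (-(L/2 * a)) := by
      intro a ha
      rw [uIoc_of_le hb.le] at ha
      have h1 := abs_le.1 (FRa hRH hT ha.1 (by linarith [ha.2]) hθ hθ1)
      have h2 := abs_le.1 (PP_sharp hT ha.1 (ha.2.trans hδb) hδ hδ2)
      rw [← hLd, show -(2 * (a * L)) = -(2 * L * a) by ring, show -(a * L / 2) = -(L/2 * a) by ring] at h1
      rw [← hLd, ← hD] at h2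
      rw [Real.norm_eq_abs, abs_le]; constructor <;> linarith
    have iH : IntervalIntegrable (fun a => (θ * (5 * CP) + (3 * CE / θ + C2) * eps T + D * T^(-δ^2)) + θ * (L * Real.exp (-(2 * L * a))) + 4 * (CP + 1) * Real.exp (-(L/2 * a))) volume 0 b := by
      apply Continuous.intervalIntegrable; fun_prop
    have h1 := intervalIntegral.norm_integral_le_of_norm_le hb.le (Eventually.of_forall fun a ha => hpt a (by rwa [uIoc_of_le hb.le])) iH
    rw [intervalIntegral.integral_sub (iF.sub iQ) iE, intervalIntegral.integral_sub iF iQ, vQ, vE,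
      intervalIntegral.integral_add (by apply Continuous.intervalIntegrable; fun_prop) (by apply Continuous.intervalIntegrable; fun_prop),
      intervalIntegral.integral_add (by simp) (by apply Continuous.intervalIntegrable; fun_prop),
      intervalIntegral.integral_const_mul θ, vE, intervalIntegral.integral_const_mul (4 * (CP+1)), exp_int (by positivity),
      intervalIntegral.integral_const, Real.norm_eq_abs, smul_eq_mul, sub_zero] at h1
    change |CD T b - _ - _| ≤ _ at h1
    have hE := eps_nonneg hT
    have hTδ : 0 ≤ T^(-δ^2) := Real.rpow_nonneg hT0.le _
    have e1 := Real.exp_pos (-(2 * b * L))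
    have e2 := Real.exp_pos (-(L/2 * b))
    have b1 : b * (θ * (5 * CP) + (3 * CE / θ + C2) * eps T + D * T^(-δ^2)) ≤ (θ * (5 * CP) + (3 * CE / θ + C2) * eps T + D * T^(-δ^2)) :=
      mul_le_of_le_one_left (by positivity) hb1.le
    have b2 : θ * ((1 - Real.exp (-(2 * b * L))) / 2) ≤ θ * (1/2) := by gcongr; linarith
    have b3 : 4 * (CP + 1) * ((1 - Real.exp (-(L/2 * b))) / (L/2)) ≤ 8 * (CP + 1) * (1 / L) := by
      calc _ ≤ 4 * (CP + 1) * (1 / (L/2)) := by gcongr; linarith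
        _ = _ := by field_simp; ring
    have b4 : |(∫ y in (0:ℝ)..(b*L), QQ y) / L^2 - b^2/2| ≤ C * (b + 8) * (1 / L) := by
      have := hC (b * L) (by positivity)
      have e : (∫ y in (0:ℝ)..(b*L), QQ y) / L^2 - b^2/2 = ((∫ y in (0:ℝ)..(b*L), QQ y) - (b*L)^2/2) / L^2 := by field_simp
      rw [e, abs_div, abs_of_pos (by positivity : 0 < L^2), div_le_iff₀ (by positivity)]
      refine this.trans ?_
      calc C * (b * L + 8) ≤ C * ((b + 8) * L) := by gcongr; nlinarith
        _ = _ := by field_simp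
    have b5 := abs_le.1 b4
    have b6 := abs_le.1 h1
    rw [abs_le]; constructor <;> linarith

lemma CD_sub (T a b : ℝ) : CD T b - CD T a = ∫ s in a..b, FR T s := by
  unfold CD
  rw [intervalIntegral.integral_interval_sub_left ((FR_cont T).intervalIntegrable _ _) ((FR_cont T).intervalIntegrable _ _)]

lemma CD_neg (T a : ℝ) : CD T (-a) = - CD T a := by
  unfold CD
  have := intervalIntegral.integral_comp_neg (f := FR T) (a := 0) (b := a)
  simp only [FR_neg, neg_zero] at this
  rw [this, intervalIntegral.integral_symm]

lemma cdf_one (hRH : RiemannHypothesis) : Tendsto (fun T => CD T 1) atTop (nhds 1) := by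
  obtain ⟨M, hM⟩ := FR_bdd hRH
  refine tendsto_of_theta (K := max M 0 + 1) (by positivity) fun θ hθ hθ1 => ?_
  have h := cdf_lt hRH (b := 1 - θ/2) (by linarith) (by linarith)
  refine ⟨fun T => |CD T (1 - θ/2) - (1/2 + (1 - θ/2)^2/2)|, ?_, ?_⟩
  · have := (h.sub_const (1/2 + (1 - θ/2)^2/2)).abs
    simpa using this
  · filter_upwards [hM, eventually_ge_atTop 3] with T h1 hT
    have h2 : |CD T 1 - CD T (1 - θ/2)| ≤ max M 0 * (θ/2) := by
      rw [CD_sub]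
      have := intervalIntegral.norm_integral_le_of_norm_le_const (a := 1 - θ/2) (b := 1) (C := max M 0) (f := FR T) (fun a ha => ?_)
      · rw [show (1:ℝ) - (1 - θ/2) = θ/2 by ring, abs_of_pos (by positivity : 0 < θ/2)] at this
        exact this
      · rw [uIoc_of_le (by linarith)] at ha
        rw [Real.norm_of_nonneg (FR_nonneg hRH (by linarith) a)]
        exact (h1 a (by linarith [ha.1]) ha.2).trans (le_max_left _ _)
    have h3 : |(1/2 + (1 - θ/2)^2/2) - 1| ≤ θ := by
      rw [abs_le]; constructor <;> nlinarith
    have h4 : |CD T 1 - 1| ≤ |CD T 1 - CD T (1 - θ/2)| + |CD T (1 - θ/2) - (1/2 + (1 - θ/2)^2/2)| + |(1/2 + (1 - θ/2)^2/2) - 1| := by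
      have := abs_add_three (CD T 1 - CD T (1 - θ/2)) (CD T (1 - θ/2) - (1/2 + (1 - θ/2)^2/2)) ((1/2 + (1 - θ/2)^2/2) - 1)
      refine le_trans (le_of_eq ?_) this; congr 1; ring
    have : 0 ≤ max M 0 := le_max_right _ _
    nlinarith

lemma SPC_FR (hRH : RiemannHypothesis) (hSPC : SPC) {M : ℝ} (hM : 1 ≤ M) {ε : ℝ} (hε : 0 < ε) :
    ∀ᶠ T in atTop, ∀ a ∈ Icc 1 M, |FR T a - 1| < ε := by
  obtain ⟨T0, h⟩ := hSPC M hM (ε/2) (by positivity)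
  filter_upwards [eventually_ge_atTop T0, eventually_gt_atTop 1] with T h0 hT a ha
  have := h T h0 a ha.1 ha.2
  rw [FF_eq hRH hT, ← Complex.ofReal_one, ← Complex.ofReal_sub, Complex.norm_real, Real.norm_eq_abs] at this
  linarith

lemma cdf_ge (hRH : RiemannHypothesis) (hSPC : SPC) {b : ℝ} (hb : 1 ≤ b) :
    Tendsto (fun T => CD T b) atTop (nhds b) := by
  refine tendsto_of_theta (K := b) (by linarith) fun θ hθ hθ1 => ?_
  refine ⟨fun T => |CD T 1 - 1|, ?_, ?_⟩
  · simpa using ((cdf_one hRH).sub_const 1).abs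
  · filter_upwards [SPC_FR hRH hSPC hb hθ] with T h1
    have h2 : |CD T b - CD T 1 - (b - 1)| ≤ θ * (b - 1) := by
      have e : CD T b - CD T 1 - (b - 1) = ∫ a in (1:ℝ)..b, (FR T a - 1) := by
        rw [intervalIntegral.integral_sub ((FR_cont T).intervalIntegrable _ _) (by simp), CD_sub]; simp
      have := intervalIntegral.norm_integral_le_of_norm_le_const (a := 1) (b := b) (C := θ) (f := fun a => FR T a - 1) (fun a ha => ?_)
      · rw [abs_of_nonneg (by linarith : 0 ≤ b - 1), ← e] at this
        exact this
      · rw [uIoc_of_le hb] at ha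
        exact (h1 a ⟨ha.1.le, ha.2⟩).le
    have h3 := abs_le.1 h2
    have h4 := neg_abs_le (CD T 1 - 1)
    have h5 := le_abs_self (CD T 1 - 1)
    rw [abs_le]; constructor <;> linarith

/-- the limit of the integrated form factor -/
def Cpos (b : ℝ) : ℝ := if b = 0 then 0 else if b < 1 then 1/2 + b^2/2 else b
def Cinf (b : ℝ) : ℝ := if 0 ≤ b then Cpos b else - Cpos (-b)

lemma cdf_lim (hRH : RiemannHypothesis) (hSPC : SPC) (b : ℝ) : Tendsto (fun T => CD T b) atTop (nhds (Cinf b)) := by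
  have key : ∀ b, 0 ≤ b → Tendsto (fun T => CD T b) atTop (nhds (Cpos b)) := by
    intro b hb
    unfold Cpos
    split_ifs with h1 h2
    · subst h1; simp [CD]
    · exact cdf_lt hRH (lt_of_le_of_ne hb (Ne.symm h1)) h2
    · exact cdf_ge hRH hSPC (by linarith)
  unfold Cinf
  split_ifs with h
  · exact key b h
  · have := (key (-b) (by linarith)).neg
    simp_rw [CD_neg, neg_neg] at this
    exact this

lemma CD_mono (hRH : RiemannHypothesis) {T : ℝ} (hT : 1 < T) : Monotone (CD T) := by
  intro a b hab
  have := CD_sub T a b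
  have h2 : 0 ≤ ∫ s in a..b, FR T s := intervalIntegral.integral_nonneg hab fun s _ => FR_nonneg hRH hT s
  linarith

lemma CD_cont (T : ℝ) : Continuous (CD T) := intervalIntegral.continuous_primitive (fun _ _ => (FR_cont T).intervalIntegrable _ _) 0

lemma CD_bdd (hRH : RiemannHypothesis) (hSPC : SPC) (M : ℝ) : ∃ K, 0 ≤ K ∧ ∀ᶠ T in atTop, ∀ a, |a| ≤ M → |CD T a| ≤ K := by
  have h := (cdf_lim hRH hSPC M).eventually (gt_mem_nhds (lt_add_one _))
  refine ⟨max (Cinf M + 1) 0, le_max_right _ _, ?_⟩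
  filter_upwards [h, eventually_gt_atTop 1] with T h1 hT a ha
  have h2 := CD_mono hRH hT (abs_le.1 ha).2
  have h3 := CD_mono hRH hT (abs_le.1 ha).1
  rw [CD_neg] at h3
  have := le_max_left (Cinf M + 1) 0
  rw [abs_le]; constructor <;> linarith

end PC

namespace PC

def PT (T t : ℝ) : ℝ := ∑ g ∈ zset T, (MM g : ℝ) * (2 / (1 + (t - g)^2))

lemma kern_integrable (g : ℝ) : Integrable (fun t : ℝ => 2 / (1 + (t - g)^2)) := by
  have := (integrable_inv_one_add_sq.const_mul 2).comp_sub_right g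
  simpa [div_eq_mul_inv] using this

lemma kern_integral (g : ℝ) : ∫ t : ℝ, 2 / (1 + (t - g)^2) = 2 * π := by
  rw [integral_sub_right_eq_self (fun t : ℝ => 2 / (1 + t^2)) g]
  simp_rw [div_eq_mul_inv]
  rw [integral_const_mul, integral_univ_inv_one_add_sq]

lemma PT_integrable (T : ℝ) : Integrable (PT T) := by
  unfold PT
  exact integrable_finsetSum _ fun g _ => (kern_integrable g).const_mul _

lemma PT_integral (T : ℝ) : ∫ t, PT T t = 2 * π * NT T := by
  unfold PT NT
  rw [integral_finsetSum _ fun g _ => (kern_integrable g).const_mul _, Finset.mul_sum]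
  refine Finset.sum_congr rfl fun g _ => ?_
  rw [integral_const_mul, kern_integral]; ring

lemma gterm_zero (t g : ℝ) : gterm t 0 g = (((MM g : ℝ) * (2 / (1 + (t - g)^2)) : ℝ) : ℂ) := by
  unfold gterm; push_cast; simp

lemma PT_mid (hRH : RiemannHypothesis) {T t K : ℝ} (hK : 0 < K) (h1 : K ≤ t) (h2 : t ≤ T - K) :
    SS t - (4 * SS 0 + 2 / K^2 * ∑ g ∈ zint (2 * T), (MM g : ℝ)) ≤ PT T t := by
  have h := tail_mid hRH (le_refl (0:ℝ)) hK h1 h2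
  have e1 : bz t 0 = ((SS t : ℝ) : ℂ) := by
    unfold bz SS; simp_rw [gterm_zero]; rw [Complex.ofReal_tsum]
  have e2 : bT T t 0 = ((PT T t : ℝ) : ℂ) := by
    unfold bT PT; simp_rw [gterm_zero]; rw [Complex.ofReal_sum]
  rw [e1, e2, ← Complex.ofReal_sub, Complex.norm_real, Real.norm_eq_abs] at h
  have := (abs_le.1 h).2
  linarith

lemma NT_lower' (hRH : RiemannHypothesis) {e : ℝ} (he : 0 < e) (he2 : e < 1/2) {T : ℝ} (hT : 3 ≤ T) :
    (1 - 2 * e) * T * (Real.log T + Real.log e - C0 - 4 * SS 0 - 12 * CC / e^2 * (Real.log T / T)) ≤ 2 * π * NT T := by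
  have hT0 : 0 < T := by linarith
  set B := Real.log T + Real.log e - C0 - 4 * SS 0 - 12 * CC / e^2 * (Real.log T / T) with hB
  rw [← PT_integral]
  have hle : e * T ≤ (1 - e) * T := by gcongr; linarith
  have hnn : ∀ t, 0 ≤ PT T t := fun t => Finset.sum_nonneg fun _ _ => by positivity
  have h1 : ∫ t in Set.Icc (e*T) ((1-e)*T), PT T t ≤ ∫ t, PT T t :=
    setIntegral_le_integral (PT_integrable T) (Eventually.of_forall hnn)
  refine le_trans ?_ h1
  have h2 : ∫ t in Set.Icc (e*T) ((1-e)*T), B ≤ ∫ t in Set.Icc (e*T) ((1-e)*T), PT T t := by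
    refine setIntegral_mono_on (by simp) (PT_integrable T).integrableOn measurableSet_Icc fun t ht => ?_
    have heT : 0 < e * T := by positivity
    refine le_trans ?_ (PT_mid hRH heT ht.1 (by linarith [ht.2]))
    have hs := SS_ge hRH t
    have ht0 : 0 < t := heT.trans_le ht.1
    rw [abs_of_pos ht0] at hs
    have hl : Real.log T + Real.log e ≤ Real.log (1 + t) := by
      rw [← Real.log_mul hT0.ne' he.ne']
      exact Real.log_le_log (by positivity) (by linarith [ht.1])
    have hc : 2 / (e*T)^2 * ∑ g ∈ zint (2 * T), (MM g : ℝ) ≤ 12 * CC / e^2 * (Real.log T / T) := by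
      calc _ ≤ 2 / (e*T)^2 * (6 * T * (CC * Real.log T)) := by
            gcongr; exact count_le' hRH hT
        _ = _ := by field_simp; ring
    rw [hB]; linarith
  refine le_trans (le_of_eq ?_) h2
  rw [setIntegral_const, smul_eq_mul, Measure.real, Real.volume_Icc, ENNReal.toReal_ofReal (by linarith)]
  ring

lemma NT_lower (hRH : RiemannHypothesis) {e : ℝ} (he : 0 < e) :
    ∀ᶠ T in atTop, 1 - e ≤ (T / (2 * π) * Real.log T)⁻¹ * NT T := by
  set d := min (e/4) (1/4) with hd
  have hd0 : 0 < d := by positivity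
  have hd1 : d ≤ e/4 := min_le_left _ _
  have hd2 : d ≤ 1/4 := min_le_right _ _
  have t1 : Tendsto (fun T : ℝ => Real.log T / T) atTop (nhds 0) := by
    have := Real.isLittleO_log_id_atTop.tendsto_div_nhds_zero
    simpa using this
  have t2 : Tendsto (fun T : ℝ => 1 / Real.log T) atTop (nhds 0) := by
    simp_rw [one_div]; exact Real.tendsto_log_atTop.inv_tendsto_atTop
  have t3 : Tendsto (fun T : ℝ => (1 - 2*d) * (1 + (Real.log d - C0 - 4 * SS 0 - 12 * CC / d^2 * (Real.log T / T)) * (1 / Real.log T))) atTop (nhds ((1 - 2*d) * (1 + (Real.log d - C0 - 4 * SS 0 - 12 * CC / d^2 * 0) * 0))) :=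
    ((((t1.const_mul _).const_sub _).mul t2).const_add 1).const_mul _
  have h := t3.eventually (lt_mem_nhds (show 1 - e < _ by rw [mul_zero, add_zero]; linarith))
  filter_upwards [h, eventually_ge_atTop 3] with T h1 hT
  refine h1.le.trans ?_
  have hL : 0 < Real.log T := by linarith [one_le_log hT]
  have := NT_lower' hRH hd0 (by linarith) hT
  have hT0 : 0 < T := by linarith
  rw [inv_mul_eq_div, le_div_iff₀ (by positivity)]
  have hpi := Real.pi_pos
  have e1 : (1 - 2*d) * (1 + (Real.log d - C0 - 4 * SS 0 - 12 * CC / d^2 * (Real.log T / T)) * (1 / Real.log T)) * (T / (2 * π) * Real.log T) = ((1 - 2 * d) * T * (Real.log T + Real.log d - C0 - 4 * SS 0 - 12 * CC / d^2 * (Real.log T / T))) / (2 * π) := by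
    field_simp; ring
  rw [e1, div_le_iff₀ (by positivity)]
  linarith

end PC

namespace PC

def tri (a : ℝ) : ℝ := max 0 (1 - |a|)
def kk (u : ℝ) : ℝ := (Real.sinc (π * u))^2

lemma tri_cont : Continuous tri := by unfold tri; fun_prop
lemma kk_cont : Continuous kk := by
  unfold kk; exact (Real.continuous_sinc.comp (continuous_const.mul continuous_id)).pow 2
lemma kk_nonneg (u : ℝ) : 0 ≤ kk u := sq_nonneg _
lemma kk_le_one (u : ℝ) : kk u ≤ 1 := by
  unfold kk; rw [sq_le_one_iff_abs_le_one]; exact Real.abs_sinc_le_one _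
lemma kk_neg (u : ℝ) : kk (-u) = kk u := by unfold kk; rw [mul_neg, Real.sinc_neg]
lemma kk_zero : kk 0 = 1 := by unfold kk; simp
lemma tri_nonneg (a : ℝ) : 0 ≤ tri a := le_max_left _ _

lemma kk_bound (u : ℝ) : kk u ≤ 2 * (1 + u^2)⁻¹ := by
  rw [← div_eq_mul_inv, le_div_iff₀ (by positivity)]
  have h1 := kk_le_one u
  have h2 : kk u * u^2 ≤ 1 := by
    by_cases hu : u = 0
    · simp [hu]
    · unfold kk
      rw [Real.sinc_of_ne_zero (by positivity)]
      have : (Real.sin (π * u) / (π * u))^2 * u^2 = (Real.sin (π * u))^2 / π^2 := by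
        field_simp
      rw [this, div_le_one (by positivity)]
      have := Real.sin_sq_le_one (π * u)
      have := Real.pi_gt_three
      nlinarith
  linarith

lemma kk_integrable : Integrable kk := by
  refine (integrable_inv_one_add_sq.const_mul 2).mono' kk_cont.aestronglyMeasurable (Eventually.of_forall fun u => ?_)
  rw [Real.norm_of_nonneg (kk_nonneg u)]; exact kk_bound u

lemma half_cos (u : ℝ) : ∫ a in (0:ℝ)..1, (1 - a) * (2 * Real.cos (2 * π * u * a)) = kk u := by
  by_cases hu : u = 0
  · subst hu
    simp only [mul_zero, zero_mul, Real.cos_zero, mul_one, kk_zero]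
    rw [intervalIntegral.integral_mul_const, intervalIntegral.integral_sub (by simp) (by simp)]
    norm_num
  · have hc : (2 * π * u) ≠ 0 := by positivity
    set c := 2 * π * u with hcd
    rw [intervalIntegral.integral_eq_sub_of_hasDerivAt (f := fun a => 2 * ((1 - a) * Real.sin (c * a) / c - Real.cos (c * a) / c^2))]
    · simp only [mul_one, mul_zero, Real.sin_zero, Real.cos_zero, sub_self, zero_mul]
      unfold kk
      rw [Real.sinc_of_ne_zero (by positivity)]
      have h1 : Real.cos c = 1 - 2 * Real.sin (π * u)^2 := by
        rw [hcd, show 2 * π * u = 2 * (π * u) by ring, Real.cos_two_mul, Real.cos_sq']; ring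
      rw [h1, hcd]; field_simp; ring
    · intro y _
      have h0 : HasDerivAt (fun y : ℝ => c * y) (c * 1) y := (hasDerivAt_id y).const_mul c
      have h1 : HasDerivAt (fun y : ℝ => 1 - y) (-1) y := (hasDerivAt_id y).const_sub 1
      refine ((((h1.mul h0.sin).div_const c).sub (h0.cos.div_const (c^2))).const_mul 2).congr_deriv ?_
      field_simp; ring
    · apply Continuous.intervalIntegrable; fun_prop

lemma tri_zero {a : ℝ} (h : 1 ≤ |a|) : tri a = 0 := max_eq_left (by linarith)
lemma tri_of_nonneg {a : ℝ} (h : 0 ≤ a) (h1 : a ≤ 1) : tri a = 1 - a := by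
  unfold tri; rw [abs_of_nonneg h]; exact max_eq_right (by linarith)
lemma tri_neg (a : ℝ) : tri (-a) = tri a := by unfold tri; rw [abs_neg]

lemma tri_supp : Function.support tri ⊆ Set.Ioc (-1) 1 := by
  intro a ha
  by_contra h
  refine ha (tri_zero ?_)
  by_contra h2
  push Not at h2
  have := abs_lt.1 h2
  exact h ⟨this.1, this.2.le⟩

lemma tri_int (f : ℝ → ℂ) (hf : Continuous f) :
    ∫ v, (tri v : ℂ) * f v = ∫ a in (0:ℝ)..1, ((1 - a : ℝ) : ℂ) * (f a + f (-a)) := by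
  have hct : Continuous fun v => (tri v : ℂ) * f v := (Complex.continuous_ofReal.comp tri_cont).mul hf
  have h1 : ∫ v, (tri v : ℂ) * f v = ∫ v in (-1:ℝ)..1, (tri v : ℂ) * f v := by
    refine (intervalIntegral.integral_eq_integral_of_support_subset ?_).symm
    intro v hv
    refine tri_supp fun h => hv ?_
    simp [h]
  rw [h1, ← intervalIntegral.integral_add_adjacent_intervals (b := 0) (hct.intervalIntegrable _ _) (hct.intervalIntegrable _ _)]
  have h2 : ∫ v in (-1:ℝ)..0, (tri v : ℂ) * f v = ∫ v in (0:ℝ)..1, (tri v : ℂ) * f (-v) := by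
    have := intervalIntegral.integral_comp_neg (a := 0) (b := 1) fun v => (tri v : ℂ) * f v
    simp only [tri_neg, neg_zero] at this
    exact this.symm
  have hct' : Continuous fun v => (tri v : ℂ) * f (-v) := (Complex.continuous_ofReal.comp tri_cont).mul (hf.comp continuous_neg)
  rw [h2, ← intervalIntegral.integral_add (hct'.intervalIntegrable _ _) (hct.intervalIntegrable _ _)]
  refine intervalIntegral.integral_congr fun v hv => ?_
  rw [Set.uIcc_of_le zero_le_one] at hv
  rw [tri_of_nonneg hv.1 hv.2]; ring

lemma tri_integrable : Integrable tri := by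
  refine Continuous.integrable_of_hasCompactSupport tri_cont ?_
  refine HasCompactSupport.intro (isCompact_Icc (a := (-1:ℝ)) (b := 1)) fun a ha => ?_
  by_contra h
  have := tri_supp h
  exact ha ⟨this.1.le, this.2⟩

open FourierTransform in
lemma fourier_tri (u : ℝ) : 𝓕 (fun a => (tri a : ℂ)) u = (kk u : ℂ) := by
  rw [Real.fourier_real_eq_integral_exp_smul]
  have h1 := tri_int (fun v => Complex.exp ((-2 * π * v * u : ℝ) * I)) (by fun_prop)
  have h2 : ∫ v : ℝ, Complex.exp ((-2 * π * v * u : ℝ) * I) • (tri v : ℂ) = ∫ v, (tri v : ℂ) * Complex.exp ((-2 * π * v * u : ℝ) * I) := by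
    refine integral_congr_ae (Eventually.of_forall fun v => ?_)
    simp only [smul_eq_mul]; ring
  rw [h2, h1, ← half_cos, ← intervalIntegral.integral_ofReal]
  refine intervalIntegral.integral_congr fun a _ => ?_
  push_cast
  rw [Complex.two_cos, add_comm]
  congr 2
  · congr 1; ring_nf
  · ring_nf

open FourierTransform in
lemma kk_cos (b : ℝ) : ∫ u, kk u * Real.cos (2 * π * b * u) = tri b := by
  have hi : Integrable (fun a => (tri a : ℂ)) := tri_integrable.ofReal
  have hF : (𝓕 (fun a => (tri a : ℂ)) : ℝ → ℂ) = fun u => (kk u : ℂ) := funext fourier_tri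
  have h := Continuous.fourierInv_fourier_eq (Complex.continuous_ofReal.comp tri_cont) hi (by rw [show Complex.ofReal ∘ tri = fun a => (tri a : ℂ) from rfl, hF]; exact kk_integrable.ofReal)
  have hb := congrFun h b
  rw [show Complex.ofReal ∘ tri = fun a => (tri a : ℂ) from rfl, hF, Real.fourierInv_eq', ] at hb
  have h2 := congrArg Complex.re hb
  simp only [Complex.ofReal_re] at h2
  rw [← h2]
  have hIntg : Integrable (fun v : ℝ => Complex.exp (((2 * π * inner ℝ v b : ℝ) : ℂ) * I) • (kk v : ℂ)) := by
    refine (kk_integrable.ofReal (𝕜 := ℂ)).mono ?_ (Eventually.of_forall fun v => ?_)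
    · refine Continuous.aestronglyMeasurable ?_
      have := Complex.continuous_ofReal.comp kk_cont
      simp only [smul_eq_mul]
      refine Continuous.mul ?_ this
      simp; fun_prop
    · rw [norm_smul, Complex.norm_exp_ofReal_mul_I, one_mul]
      simp
  have := integral_re hIntg
  rw [← RCLike.re_eq_complex_re, ← this]
  refine integral_congr_ae (Eventually.of_forall fun v => ?_)
  simp only [smul_eq_mul, RCLike.re_eq_complex_re]
  rw [Complex.re_mul_ofReal, Complex.exp_ofReal_mul_I_re, mul_comm]
  simp only [RCLike.inner_apply, conj_trivial]; ring_nf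

end PC

namespace PC

def AW (η : ℝ) (φ : ℝ → ℝ) (b : ℝ) : ℝ := ∫ a in (0:ℝ)..1, (1 - a) * (φ (b + η * a) + φ (b - η * a))

lemma AW_cos (η b c : ℝ) : AW η (fun x => Real.cos (c * x)) b = kk (η * c / (2 * π)) * Real.cos (c * b) := by
  unfold AW
  rw [← half_cos, ← intervalIntegral.integral_mul_const]
  refine intervalIntegral.integral_congr fun a _ => ?_
  have : 2 * π * (η * c / (2 * π)) * a = c * (η * a) := by
    have := Real.pi_pos; field_simp
  simp only
  rw [this, mul_add c, mul_sub c, Real.cos_add, Real.cos_sub]; ring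

lemma AW_prim {η : ℝ} (hη : 0 < η) {φ Φ : ℝ → ℝ} (hc : Continuous φ) (h : ∀ x, HasDerivAt Φ (φ x) x) (b : ℝ) :
    AW η φ b = (1/η) * ∫ a in (0:ℝ)..1, (Φ (b + η * a) - Φ (b - η * a)) := by
  have hΦ : Continuous Φ := continuous_iff_continuousAt.2 fun x => (h x).continuousAt
  have h0 := intervalIntegral.integral_eq_sub_of_hasDerivAt (a := 0) (b := 1) (f := fun a => (1 - a) * (Φ (b + η * a) - Φ (b - η * a)))
    (f' := fun a => η * ((1 - a) * (φ (b + η * a) + φ (b - η * a))) - (Φ (b + η * a) - Φ (b - η * a))) (fun y _ => by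
      have h1 : HasDerivAt (fun y : ℝ => 1 - y) (-1) y := (hasDerivAt_id y).const_sub 1
      have h2 : HasDerivAt (fun y : ℝ => b + η * y) (η * 1) y := ((hasDerivAt_id y).const_mul η).const_add b
      have h3 : HasDerivAt (fun y : ℝ => b - η * y) (-(η * 1)) y := ((hasDerivAt_id y).const_mul η).const_sub b
      have h4 := (h (b + η * y)).comp y h2
      have h5 := (h (b - η * y)).comp y h3
      exact (h1.mul (h4.sub h5)).congr_deriv (by simp only [Pi.sub_apply, Function.comp_apply]; ring))
    (by apply Continuous.intervalIntegrable; fun_prop)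
  rw [intervalIntegral.integral_sub (by apply Continuous.intervalIntegrable; fun_prop) (by apply Continuous.intervalIntegrable; fun_prop),
    intervalIntegral.integral_const_mul] at h0
  simp only [mul_zero, add_zero, sub_zero, sub_self, zero_mul] at h0
  unfold AW
  rw [sub_eq_zero.1 h0 |>.symm, ← mul_assoc, one_div, inv_mul_cancel₀ hη.ne', one_mul]

def GT (η T b : ℝ) : ℝ := (T / (2 * π) * Real.log T)⁻¹ *
  ∑ g ∈ zset T, ∑ h ∈ zset T, (MM g * MM h : ℝ) * (4 / (4 + (g - h)^2)) * (kk (η * ((g - h) * Real.log T) / (2 * π)) * Real.cos (((g - h) * Real.log T) * b))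

lemma GT_eq (η T b : ℝ) : GT η T b = AW η (FR T) b := by
  have hfr : FR T = fun a => (T / (2 * π) * Real.log T)⁻¹ *
      ∑ g ∈ zset T, ∑ h ∈ zset T, (MM g * MM h : ℝ) * (4 / (4 + (g - h)^2)) * Real.cos (((g - h) * Real.log T) * a) := by
    funext a; unfold FR
    congr 1
    refine Finset.sum_congr rfl fun g _ => Finset.sum_congr rfl fun h _ => ?_
    congr 2; ring
  have : ∀ (a : ℝ), (1 - a) * (FR T (b + η * a) + FR T (b - η * a)) = (T / (2 * π) * Real.log T)⁻¹ *
      ∑ g ∈ zset T, ∑ h ∈ zset T, (MM g * MM h : ℝ) * (4 / (4 + (g - h)^2)) * ((1 - a) * (Real.cos (((g - h) * Real.log T) * (b + η * a)) + Real.cos (((g - h) * Real.log T) * (b - η * a)))) := by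
    intro a
    rw [hfr]
    simp only
    rw [← mul_add, mul_left_comm, ← Finset.sum_add_distrib, Finset.mul_sum]
    congr 1
    refine Finset.sum_congr rfl fun g _ => ?_
    rw [← Finset.sum_add_distrib, Finset.mul_sum]
    refine Finset.sum_congr rfl fun h _ => ?_
    ring
  unfold AW GT
  simp_rw [this]
  rw [intervalIntegral.integral_const_mul, intervalIntegral.integral_finsetSum]
  · congr 1
    refine Finset.sum_congr rfl fun g _ => ?_
    rw [intervalIntegral.integral_finsetSum]
    · refine Finset.sum_congr rfl fun h _ => ?_
      rw [intervalIntegral.integral_const_mul]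
      congr 1
      exact (AW_cos η b _).symm
    · intro h _; apply Continuous.intervalIntegrable; fun_prop
  · intro g _; apply Continuous.intervalIntegrable; fun_prop

lemma CD_deriv (T x : ℝ) : HasDerivAt (CD T) (FR T x) x :=
  intervalIntegral.integral_hasDerivAt_right ((FR_cont T).intervalIntegrable _ _) ((FR_cont T).stronglyMeasurableAtFilter _ _) (FR_cont T).continuousAt

lemma GT_lim (hRH : RiemannHypothesis) (hSPC : SPC) {η : ℝ} (hη : 0 < η) (b : ℝ) :
    Tendsto (fun T => GT η T b) atTop (nhds ((1/η) * ∫ a in (0:ℝ)..1, (Cinf (b + η * a) - Cinf (b - η * a)))) := by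
  have e : (fun T => GT η T b) = fun T => (1/η) * ∫ a in (0:ℝ)..1, (CD T (b + η * a) - CD T (b - η * a)) := by
    funext T; rw [GT_eq, AW_prim hη (FR_cont T) (CD_deriv T)]
  rw [e]
  refine Tendsto.const_mul _ ?_
  obtain ⟨K, hK, hb⟩ := CD_bdd hRH hSPC (|b| + η)
  refine intervalIntegral.tendsto_integral_filter_of_dominated_convergence (fun _ => K + K) ?_ ?_ (by simp) ?_
  · refine Eventually.of_forall fun T => Continuous.aestronglyMeasurable ?_
    have := CD_cont T
    fun_prop
  · filter_upwards [hb] with T hT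
    refine Eventually.of_forall fun a ha => ?_
    rw [Set.uIoc_of_le zero_le_one] at ha
    have h1 : |η * a| ≤ η := by
      rw [abs_of_nonneg (by have := ha.1; positivity)]
      nlinarith [ha.2]
    refine (norm_sub_le _ _).trans (add_le_add (hT _ ?_) (hT _ ?_))
    · exact (abs_add_le _ _).trans (by linarith)
    · exact (abs_sub _ _).trans (by linarith)
  · exact Eventually.of_forall fun a _ => (cdf_lim hRH hSPC _).sub (cdf_lim hRH hSPC _)

def Tri (x : ℝ) : ℝ := ∫ a in (0:ℝ)..x, tri a

lemma Tri_deriv (x : ℝ) : HasDerivAt Tri (tri x) x :=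
  intervalIntegral.integral_hasDerivAt_right (tri_cont.intervalIntegrable _ _) (tri_cont.stronglyMeasurableAtFilter _ _) tri_cont.continuousAt

lemma Tri_neg (x : ℝ) : Tri (-x) = - Tri x := by
  unfold Tri
  have := intervalIntegral.integral_comp_neg (a := 0) (b := x) tri
  simp only [tri_neg, neg_zero] at this
  rw [this, intervalIntegral.integral_symm]

lemma Tri_le {x : ℝ} (h0 : 0 ≤ x) (h1 : x ≤ 1) : Tri x = x - x^2/2 := by
  unfold Tri
  have : ∫ a in (0:ℝ)..x, tri a = ∫ a in (0:ℝ)..x, (1 - a) := by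
    refine intervalIntegral.integral_congr fun a ha => ?_
    rw [Set.uIcc_of_le h0] at ha
    exact tri_of_nonneg ha.1 (ha.2.trans h1)
  rw [this, intervalIntegral.integral_sub (by simp) (by simp)]
  simp

lemma Tri_ge {x : ℝ} (h1 : 1 ≤ x) : Tri x = 1/2 := by
  have h : Tri x = Tri 1 + ∫ a in (1:ℝ)..x, tri a := by
    unfold Tri
    rw [intervalIntegral.integral_add_adjacent_intervals (tri_cont.intervalIntegrable _ _) (tri_cont.intervalIntegrable _ _)]
  have h2 : ∫ a in (1:ℝ)..x, tri a = ∫ a in (1:ℝ)..x, (0:ℝ) := by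
    refine intervalIntegral.integral_congr fun a ha => ?_
    rw [Set.uIcc_of_le h1] at ha
    exact tri_zero (ha.1.trans (le_abs_self a))
  rw [h, h2, Tri_le zero_le_one le_rfl]; simp; norm_num

lemma Cinf_nonneg_eq {x : ℝ} (h : 0 < x) : Cinf x = 1/2 + x - Tri x := by
  unfold Cinf Cpos
  rw [if_pos h.le, if_neg h.ne']
  split_ifs with h1
  · rw [Tri_le h.le h1.le]; ring
  · rw [Tri_ge (by linarith)]; ring

lemma Cinf_eq (x : ℝ) : Cinf x = Real.sign x / 2 + x - Tri x := by
  rcases lt_trichotomy x 0 with h | h | h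
  · have h1 := Cinf_nonneg_eq (x := -x) (by linarith)
    rw [Real.sign_of_neg h]
    have h2 : Cinf x = - Cinf (-x) := by
      unfold Cinf
      rw [if_neg (by linarith), if_pos (by linarith)]
    rw [h2, h1, Tri_neg]; ring
  · subst h
    have : Tri 0 = 0 := by simp [Tri]
    rw [this]; simp [Cinf, Cpos]
  · rw [Cinf_nonneg_eq h, Real.sign_of_pos h]

lemma abs_deriv {x : ℝ} (hx : x ≠ 0) : HasDerivAt (fun x : ℝ => |x|) (Real.sign x) x := by
  rcases lt_or_gt_of_ne hx with h | h
  · rw [Real.sign_of_neg h]; exact hasDerivAt_abs_neg h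
  · rw [Real.sign_of_pos h]; exact hasDerivAt_abs_pos h

lemma sign_meas : Measurable Real.sign := by
  unfold Real.sign
  exact Measurable.ite measurableSet_Iio measurable_const (Measurable.ite measurableSet_Ioi measurable_const measurable_const)

lemma sign_ii {f : ℝ → ℝ} (hf : Continuous f) (a b : ℝ) : IntervalIntegrable (fun x => Real.sign (f x)) volume a b := by
  refine (intervalIntegrable_const (c := (1:ℝ))).mono_fun (sign_meas.comp hf.measurable).aestronglyMeasurable (Eventually.of_forall fun x => ?_)
  simp only [Real.norm_eq_abs, abs_one]
  rcases Real.sign_apply_eq (f x) with h | h | h <;> simp [h]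

lemma sign_int (b : ℝ) {c : ℝ} (hc : c ≠ 0) : ∫ a in (0:ℝ)..1, Real.sign (b + c * a) = (|b + c| - |b|) / c := by
  have h := integral_eq_of_hasDerivAt_off_countable (fun a => |b + c * a| / c) (fun a => Real.sign (b + c * a)) (a := 0) (b := 1)
    (s := {-b/c}) (Set.countable_singleton _) (by fun_prop) (fun y hy => by
      have hne : b + c * y ≠ 0 := by
        intro h0
        refine hy.2 ?_
        rw [Set.mem_singleton_iff, eq_div_iff hc]; linarith
      have h2 : HasDerivAt (fun y : ℝ => b + c * y) (c * 1) y := ((hasDerivAt_id y).const_mul c).const_add b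
      exact (((abs_deriv hne).comp y h2).div_const c).congr_deriv (by rw [mul_one, mul_div_cancel_right₀ _ hc])) (sign_ii (by fun_prop) _ _)
  rw [h]; simp; ring

lemma abs_tri {η : ℝ} (hη : 0 < η) (b : ℝ) : |b + η| + |b - η| - 2 * |b| = 2 * η * tri (b / η) := by
  unfold tri
  rw [abs_div, abs_of_pos hη]
  have e : η * max 0 (1 - |b| / η) = max 0 (η - |b|) := by
    rw [← mul_max_of_nonneg _ _ hη.le |>.symm]
    · rw [mul_zero]; congr 1; field_simp
  rw [mul_assoc, e]
  rcases abs_cases b with h | h <;> rcases abs_cases (b + η) with h1 | h1 <;> rcases abs_cases (b - η) with h2 | h2 <;>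
    rcases max_cases 0 (η - |b|) with h3 | h3 <;> linarith

def kd (η u : ℝ) : ℝ := kk (η * u) * (1 - kk u)

lemma kkη_integrable {η : ℝ} (hη : 0 < η) : Integrable (fun u => kk (η * u)) :=
  kk_integrable.comp_mul_left' hη.ne'

lemma cosmul_integrable {f : ℝ → ℝ} (hf : Integrable f) (c : ℝ) : Integrable (fun u => f u * Real.cos (c * u)) := by
  refine hf.mul_bdd (c := 1) (Continuous.aestronglyMeasurable (by fun_prop)) (Eventually.of_forall fun u => ?_)
  exact Real.abs_cos_le_one _

lemma kkη_cos {η : ℝ} (hη : 0 < η) (b : ℝ) : ∫ u, kk (η * u) * Real.cos (2 * π * b * u) = (1/η) * tri (b / η) := by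
  have h := Measure.integral_comp_mul_left (fun v => kk v * Real.cos (2 * π * (b/η) * v)) η
  rw [kk_cos, abs_of_pos (inv_pos.2 hη), smul_eq_mul] at h
  rw [one_div, ← h]
  refine integral_congr_ae (Eventually.of_forall fun u => ?_)
  simp only
  congr 2; field_simp

lemma AW_tri {η : ℝ} (hη : 0 < η) (b : ℝ) : AW η tri b = ∫ u, kk u * (kk (η * u) * Real.cos (2 * π * b * u)) := by
  have e : ∀ a : ℝ, (1 - a) * (tri (b + η * a) + tri (b - η * a)) =
      ∫ u, kk u * ((1 - a) * (Real.cos ((2 * π * u) * (b + η * a)) + Real.cos ((2 * π * u) * (b - η * a)))) := by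
    intro a
    rw [← kk_cos, ← kk_cos, ← integral_add (cosmul_integrable kk_integrable _) (cosmul_integrable kk_integrable _), ← integral_const_mul]
    refine integral_congr_ae (Eventually.of_forall fun u => ?_)
    simp only
    rw [show 2 * π * (b + η * a) * u = (2 * π * u) * (b + η * a) by ring, show 2 * π * (b - η * a) * u = (2 * π * u) * (b - η * a) by ring]
    ring
  have e2 : ∀ u : ℝ, kk u * (kk (η * u) * Real.cos (2 * π * b * u)) = ∫ a in Set.Ioc (0:ℝ) 1, kk u * ((1 - a) * (Real.cos ((2 * π * u) * (b + η * a)) + Real.cos ((2 * π * u) * (b - η * a)))) := by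
    intro u
    have := AW_cos η b (2 * π * u)
    unfold AW at this
    rw [integral_const_mul, ← intervalIntegral.integral_of_le zero_le_one, this]
    have h1 : η * (2 * π * u) / (2 * π) = η * u := by have := Real.pi_pos; field_simp
    rw [h1]; congr 3; ring
  unfold AW
  simp_rw [e, e2]
  rw [intervalIntegral.integral_of_le zero_le_one]
  refine integral_integral_swap ?_
  have hp : Integrable (fun p : ℝ × ℝ => (2:ℝ) * kk p.2) ((volume.restrict (Set.Ioc (0:ℝ) 1)).prod volume) :=
    Integrable.mul_prod (f := fun _ : ℝ => (2:ℝ)) (g := kk) (by simp) kk_integrable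
  refine hp.mono' ?_ ?_
  · refine Continuous.aestronglyMeasurable ?_
    have := kk_cont
    simp only [Function.uncurry_def]
    fun_prop
  · have hm : ∀ᵐ p : ℝ × ℝ ∂((volume.restrict (Set.Ioc (0:ℝ) 1)).prod volume), p.1 ∈ Set.Ioc (0:ℝ) 1 :=
      Measure.quasiMeasurePreserving_fst.ae (ae_restrict_mem measurableSet_Ioc)
    filter_upwards [hm] with p hp
    simp only [Function.uncurry_def]
    rw [norm_mul, Real.norm_of_nonneg (kk_nonneg _), mul_comm]
    gcongr
    · exact kk_nonneg _
    rw [norm_mul, Real.norm_of_nonneg (by linarith [hp.2])]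
    have h1 : ‖Real.cos ((2 * π * p.2) * (b + η * p.1)) + Real.cos ((2 * π * p.2) * (b - η * p.1))‖ ≤ 1 + 1 :=
      (norm_add_le _ _).trans (add_le_add (Real.abs_cos_le_one _) (Real.abs_cos_le_one _))
    have h2 : 1 - p.1 ≤ 1 := by linarith [hp.1]
    have h3 : 0 ≤ 1 - p.1 := by linarith [hp.2]
    nlinarith [norm_nonneg (Real.cos ((2 * π * p.2) * (b + η * p.1)) + Real.cos ((2 * π * p.2) * (b - η * p.1)))]

lemma limit_id {η : ℝ} (hη : 0 < η) (b : ℝ) :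
    (1/η) * ∫ a in (0:ℝ)..1, (Cinf (b + η * a) - Cinf (b - η * a)) = 1 + ∫ u, kd η u * Real.cos (2 * π * b * u) := by
  have hTc : Continuous Tri := continuous_iff_continuousAt.2 fun x => (Tri_deriv x).continuousAt
  have e : ∀ a, Cinf (b + η * a) - Cinf (b - η * a) = ((Real.sign (b + η * a) - Real.sign (b + (-η) * a)) * (1/2) + (2 * η) * a) - (Tri (b + η * a) - Tri (b - η * a)) := by
    intro a; rw [Cinf_eq, Cinf_eq, show b + -η * a = b - η * a by ring]; ring
  simp_rw [e]
  have i1 : IntervalIntegrable (fun a => Real.sign (b + η * a)) volume 0 1 := sign_ii (by fun_prop) _ _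
  have i2 : IntervalIntegrable (fun a => Real.sign (b + (-η) * a)) volume 0 1 := sign_ii (by fun_prop) _ _
  have i3 : IntervalIntegrable (fun a => (Real.sign (b + η * a) - Real.sign (b + (-η) * a)) * (1/2)) volume 0 1 := (i1.sub i2).mul_const _
  have i4 : IntervalIntegrable (fun a => (2 * η) * a) volume 0 1 := by apply Continuous.intervalIntegrable; fun_prop
  have i5 : IntervalIntegrable (fun a => (Real.sign (b + η * a) - Real.sign (b + (-η) * a)) * (1/2) + (2 * η) * a) volume 0 1 := i3.add i4
  have i6 : IntervalIntegrable (fun a => Tri (b + η * a) - Tri (b - η * a)) volume 0 1 := by apply Continuous.intervalIntegrable; fun_prop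
  rw [intervalIntegral.integral_sub i5 i6, intervalIntegral.integral_add i3 i4, intervalIntegral.integral_mul_const,
    intervalIntegral.integral_sub i1 i2, sign_int b hη.ne', sign_int b (neg_ne_zero.2 hη.ne'), intervalIntegral.integral_const_mul,
    mul_sub, ← AW_prim hη tri_cont Tri_deriv, AW_tri hη]
  have e2 : ∀ u, kd η u * Real.cos (2 * π * b * u) = kk (η * u) * Real.cos (2 * π * b * u) - kk u * (kk (η * u) * Real.cos (2 * π * b * u)) := by
    intro u; unfold kd; ring
  simp_rw [e2]
  have j1 := cosmul_integrable (kkη_integrable hη) (2 * π * b)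
  have j2 : Integrable (fun u => kk u * (kk (η * u) * Real.cos (2 * π * b * u))) := by
    refine j1.bdd_mul (c := 1) kk_cont.aestronglyMeasurable (Eventually.of_forall fun u => ?_)
    rw [Real.norm_of_nonneg (kk_nonneg _)]; exact kk_le_one u
  rw [integral_sub j1 j2, kkη_cos hη]
  have h := abs_tri hη b
  have h3 : tri (b/η) = (|b + η| + |b - η| - 2 * |b|) / (2 * η) := by rw [h]; field_simp
  rw [h3, integral_id, show b + -η = b - η by ring]
  generalize (∫ u, kk u * (kk (η * u) * Real.cos (2 * π * b * u))) = X
  field_simp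
  ring

lemma GT_lim' (hRH : RiemannHypothesis) (hSPC : SPC) {η : ℝ} (hη : 0 < η) (b : ℝ) :
    Tendsto (fun T => GT η T b) atTop (nhds (1 + ∫ u, kd η u * Real.cos (2 * π * b * u))) := by
  rw [← limit_id hη]; exact GT_lim hRH hSPC hη b

end PC

namespace PC

lemma levy1 {ι : Type} (s : ℕ → Finset ι) (p x : ℕ → ι → ℝ) (hp : ∀ n i, 0 ≤ p n i) (hp1 : ∀ n, ∑ i ∈ s n, p n i = 1)
    (α : ℝ) (hα : 0 ≤ α) (k : ℝ → ℝ) (hk : ∀ u, 0 ≤ k u) (hki : Integrable k) (h1 : α + ∫ u, k u = 1)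
    (h : ∀ ξ : ℝ, Tendsto (fun n => ∑ i ∈ s n, (p n i : ℂ) * Complex.exp (ξ * x n i * I)) atTop (nhds (α + ∫ u, (k u : ℂ) * Complex.exp (ξ * u * I))))
    {r : ℝ} (hr : 0 < r) :
    Tendsto (fun n => ∑ i ∈ s n, if |x n i| ≤ r then p n i else 0) atTop (nhds (α + ∫ u in Set.Icc (-r) r, k u)) := by
  set μ : ℕ → Measure ℝ := fun n => ∑ i ∈ s n, ENNReal.ofReal (p n i) • Measure.dirac (x n i) with hμ
  set ν1 : Measure ℝ := ENNReal.ofReal α • Measure.dirac (0:ℝ) with hν1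
  set ν2 : Measure ℝ := volume.withDensity (fun u => ENNReal.ofReal (k u)) with hν2
  have hμE : ∀ n (E : Set ℝ), MeasurableSet E → μ n E = ∑ i ∈ s n, ENNReal.ofReal (p n i) * E.indicator 1 (x n i) := by
    intro n E hE
    simp [hμ, Measure.finsetSum_apply, Measure.dirac_apply' _ hE]
  have hνMeas : ∀ E : Set ℝ, MeasurableSet E → ν2 E = ENNReal.ofReal (∫ u in E, k u) := by
    intro E hE
    rw [hν2, withDensity_apply _ hE, ofReal_integral_eq_lintegral_ofReal hki.integrableOn (Eventually.of_forall hk)]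
  have pμ : ∀ n, IsProbabilityMeasure (μ n) := fun n => ⟨by
    rw [hμE n _ MeasurableSet.univ]
    simp only [Set.indicator_univ, Pi.one_apply, mul_one]
    rw [← ENNReal.ofReal_sum_of_nonneg fun i _ => hp n i, hp1, ENNReal.ofReal_one]⟩
  have hk0 : 0 ≤ ∫ u, k u := integral_nonneg hk
  have pν : IsProbabilityMeasure (ν1 + ν2) := ⟨by
    rw [Measure.add_apply, hνMeas _ MeasurableSet.univ, hν1]
    simp only [Measure.smul_apply, measure_univ, smul_eq_mul, mul_one, Measure.restrict_univ]
    rw [← ENNReal.ofReal_add hα hk0, h1, ENNReal.ofReal_one]⟩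
  have f2 : IsFiniteMeasure ν2 := ⟨by rw [hνMeas _ MeasurableSet.univ]; exact ENNReal.ofReal_lt_top⟩
  have f1 : IsFiniteMeasure ν1 := ⟨by rw [hν1]; simp⟩
  have bint : ∀ (m : Measure ℝ) [IsFiniteMeasure m] (ξ : ℝ), Integrable (fun u : ℝ => Complex.exp (ξ * u * I)) m := by
    intro m _ ξ
    refine Integrable.of_bound (Continuous.aestronglyMeasurable (by fun_prop)) 1 (Eventually.of_forall fun u => ?_)
    rw [← Complex.ofReal_mul, Complex.norm_exp_ofReal_mul_I]
  let Pn : ℕ → ProbabilityMeasure ℝ := fun n => ⟨μ n, pμ n⟩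
  let Pl : ProbabilityMeasure ℝ := ⟨ν1 + ν2, pν⟩
  have hw : Tendsto Pn atTop (nhds Pl) := by
    rw [ProbabilityMeasure.tendsto_iff_tendsto_charFun]
    intro ξ
    have e1 : ∀ n, charFun (μ n) ξ = ∑ i ∈ s n, (p n i : ℂ) * Complex.exp (ξ * x n i * I) := by
      intro n
      rw [charFun_apply_real, hμ]
      simp only
      rw [integral_finsetSum_measure]
      · refine Finset.sum_congr rfl fun i _ => ?_
        rw [integral_smul_measure, integral_dirac, ENNReal.toReal_ofReal (hp n i)]
        simp
      · intro i _
        exact (bint _ ξ).smul_measure ENNReal.ofReal_ne_top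
    have e2 : charFun (ν1 + ν2) ξ = α + ∫ u, (k u : ℂ) * Complex.exp (ξ * u * I) := by
      rw [charFun_apply_real, integral_add_measure (bint _ _) (bint _ _)]
      congr 1
      · rw [hν1, integral_smul_measure, integral_dirac, ENNReal.toReal_ofReal hα]; simp
      · rw [hν2, integral_withDensity_eq_integral_toReal_smul₀ hki.aemeasurable.ennreal_ofReal (by simp)]
        refine integral_congr_ae (Eventually.of_forall fun u => ?_)
        simp only
        rw [ENNReal.toReal_ofReal (hk u)]; simp
    have e4 : charFun (Pl : Measure ℝ) ξ = α + ∫ u, (k u : ℂ) * Complex.exp (ξ * u * I) := e2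
    rw [e4]
    exact (h ξ).congr fun n => (e1 n).symm
  have hfr : (ν1 + ν2) (frontier (Set.Icc (-r) r)) = 0 := by
    rw [frontier_Icc (by linarith), Measure.add_apply, hνMeas _ (by measurability), hν1]
    have : (0:ℝ) ∉ ({-r, r} : Set ℝ) := by
      simp only [Set.mem_insert_iff, Set.mem_singleton_iff, not_or]
      constructor <;> linarith
    have hv : volume ({-r, r} : Set ℝ) = 0 := (Set.toFinite _).measure_zero _
    rw [Measure.smul_apply, Measure.dirac_apply' _ (by measurability), Set.indicator_of_notMem this, setIntegral_measure_zero _ hv]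
    simp
  have ht := ProbabilityMeasure.tendsto_measure_of_null_frontier_of_tendsto' hw (E := Set.Icc (-r) r) hfr
  change Tendsto (fun n => μ n (Set.Icc (-r) r)) atTop (nhds ((ν1 + ν2) (Set.Icc (-r) r))) at ht
  have ht2 := (ENNReal.tendsto_toReal (measure_ne_top _ _)).comp ht
  have e3 : ((ν1 + ν2) (Set.Icc (-r) r)).toReal = α + ∫ u in Set.Icc (-r) r, k u := by
    rw [Measure.add_apply, hνMeas _ measurableSet_Icc, hν1, Measure.smul_apply, Measure.dirac_apply' _ measurableSet_Icc,
      Set.indicator_of_mem (show (0:ℝ) ∈ Set.Icc (-r) r from ⟨by linarith, hr.le⟩)]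
    simp only [Pi.one_apply, smul_eq_mul, mul_one]
    rw [ENNReal.toReal_add ENNReal.ofReal_ne_top ENNReal.ofReal_ne_top, ENNReal.toReal_ofReal hα,
      ENNReal.toReal_ofReal (integral_nonneg hk)]
  rw [e3] at ht2
  refine ht2.congr fun n => ?_
  simp only [Function.comp_apply]
  rw [hμE n _ measurableSet_Icc, ENNReal.toReal_sum]
  · refine Finset.sum_congr rfl fun i _ => ?_
    split_ifs with hi
    · rw [Set.indicator_of_mem (show x n i ∈ Set.Icc (-r) r from abs_le.1 hi)]; simp [ENNReal.toReal_ofReal (hp n i)]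
    · rw [Set.indicator_of_notMem (show x n i ∉ Set.Icc (-r) r from fun hh => hi (abs_le.2 hh))]; simp
  · intro i _
    refine ENNReal.mul_ne_top ENNReal.ofReal_ne_top ?_
    by_cases hi : x n i ∈ Set.Icc (-r) r <;> simp [hi]

lemma exp_split (a y : ℝ) : (a : ℂ) * Complex.exp (y * I) = ((a * Real.cos y : ℝ) : ℂ) + ((a * Real.sin y : ℝ) : ℂ) * I := by
  rw [Complex.exp_mul_I]; push_cast; ring

lemma levy2 {ι : Type} (s : ℕ → Finset ι) (c x : ℕ → ι → ℝ) (hc : ∀ n i, 0 ≤ c n i)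
    (k : ℝ → ℝ) (hk : ∀ u, 0 ≤ k u) (hki : Integrable k) (hke : ∀ u, k (-u) = k u)
    (hs : ∀ n ξ, ∑ i ∈ s n, c n i * Real.sin (ξ * x n i) = 0)
    (h : ∀ ξ : ℝ, Tendsto (fun n => ∑ i ∈ s n, c n i * Real.cos (ξ * x n i)) atTop (nhds (1 + ∫ u, k u * Real.cos (ξ * u))))
    {r : ℝ} (hr : 0 < r) :
    Tendsto (fun n => ∑ i ∈ s n, if |x n i| ≤ r then c n i else 0) atTop (nhds (1 + ∫ u in Set.Icc (-r) r, k u)) := by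
  have h0 := h 0
  simp only [zero_mul, Real.cos_zero, mul_one] at h0
  set M := 1 + ∫ u, k u with hM
  have hMp : 0 < M := by have : 0 ≤ ∫ u, k u := integral_nonneg hk; positivity
  obtain ⟨n0, hn0⟩ := eventually_atTop.1 (h0.eventually (lt_mem_nhds hMp))
  rw [← tendsto_add_atTop_iff_nat n0] at h0 ⊢
  have hpos : ∀ n, 0 < ∑ i ∈ s (n + n0), c (n + n0) i := fun n => hn0 _ (by omega)
  have hksin : ∀ ξ : ℝ, ∫ u, k u * Real.sin (ξ * u) = 0 := by
    intro ξ
    have := integral_neg_eq_self (fun u => k u * Real.sin (ξ * u)) volume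
    simp only [hke, mul_neg, Real.sin_neg] at this
    rw [integral_neg] at this
    linarith
  have hL := levy1 (fun n => s (n + n0)) (fun n i => c (n + n0) i / ∑ i ∈ s (n + n0), c (n + n0) i) (fun n => x (n + n0))
    (fun n i => div_nonneg (hc _ _) (hpos n).le) (fun n => by rw [← Finset.sum_div, div_self (hpos n).ne'])
    (1 / M) (by positivity) (fun u => k u / M) (fun u => div_nonneg (hk u) hMp.le) (hki.div_const M)
    (by rw [integral_div, ← add_div, ← hM, div_self hMp.ne']) ?_ hr
  · have := hL.mul h0
    rw [integral_div, ← add_div, div_mul_cancel₀ _ hMp.ne'] at this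
    refine this.congr fun n => ?_
    rw [Finset.sum_mul]
    refine Finset.sum_congr rfl fun i _ => ?_
    split_ifs
    · rw [div_mul_cancel₀ _ (hpos n).ne']
    · simp
  · intro ξ
    have hξ := (tendsto_add_atTop_iff_nat n0).2 (h ξ)
    have hd := hξ.div h0 hMp.ne'
    have hd2 := (Complex.continuous_ofReal.tendsto _).comp hd
    have icos := cosmul_integrable hki ξ
    have isin : Integrable (fun u => k u * Real.sin (ξ * u)) :=
      hki.mul_bdd (c := 1) (Continuous.aestronglyMeasurable (by fun_prop)) (Eventually.of_forall fun u => Real.abs_sin_le_one _)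
    have e1 : ∫ u, ((k u / M : ℝ) : ℂ) * Complex.exp (ξ * u * I) = (((∫ u, k u * Real.cos (ξ * u)) / M : ℝ) : ℂ) := by
      have : ∀ u : ℝ, ((k u / M : ℝ) : ℂ) * Complex.exp (ξ * u * I) =
          (((k u * Real.cos (ξ * u) : ℝ) : ℂ) + ((k u * Real.sin (ξ * u) : ℝ) : ℂ) * I) / M := by
        intro u
        rw [← Complex.ofReal_mul, Complex.ofReal_div, div_mul_eq_mul_div, exp_split]
      simp_rw [this]
      have i1 : Integrable (fun u => ((k u * Real.cos (ξ * u) : ℝ) : ℂ)) := icos.ofReal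
      have i2 : Integrable (fun u => ((k u * Real.sin (ξ * u) : ℝ) : ℂ) * I) := isin.ofReal.mul_const I
      rw [integral_div, integral_add i1 i2, integral_mul_const, integral_complex_ofReal, integral_complex_ofReal, hksin]
      push_cast; simp
    rw [e1]
    have e2 : ((1 / M : ℝ) : ℂ) + (((∫ u, k u * Real.cos (ξ * u)) / M : ℝ) : ℂ) = (((1 + ∫ u, k u * Real.cos (ξ * u)) / M : ℝ) : ℂ) := by
      push_cast; ring
    rw [e2]
    refine hd2.congr fun n => ?_
    simp only [Function.comp_apply]
    have e3 : ∀ i, ((c (n + n0) i / ∑ i ∈ s (n + n0), c (n + n0) i : ℝ) : ℂ) * Complex.exp (ξ * x (n + n0) i * I) =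
        (((c (n + n0) i * Real.cos (ξ * x (n + n0) i) : ℝ) : ℂ) + ((c (n + n0) i * Real.sin (ξ * x (n + n0) i) : ℝ) : ℂ) * I) / ((∑ i ∈ s (n + n0), c (n + n0) i : ℝ) : ℂ) := by
      intro i
      rw [← Complex.ofReal_mul, Complex.ofReal_div, div_mul_eq_mul_div, exp_split]
    simp_rw [e3]
    rw [← Finset.sum_div, Finset.sum_add_distrib, ← Finset.sum_mul, ← Complex.ofReal_sum, ← Complex.ofReal_sum, hs]
    push_cast; simp

end PC

namespace PC

def cw (η T : ℝ) (p : ℝ × ℝ) : ℝ := (T / (2 * π) * Real.log T)⁻¹ *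
  ((MM p.1 * MM p.2 : ℝ) * (4 / (4 + (p.1 - p.2)^2)) * kk (η * ((p.1 - p.2) * Real.log T) / (2 * π)))
def xw (T : ℝ) (p : ℝ × ℝ) : ℝ := (p.1 - p.2) * Real.log T / (2 * π)

lemma norm_pos {T : ℝ} (hT : 3 ≤ T) : 0 < (T / (2 * π) * Real.log T)⁻¹ := by
  have := one_le_log hT
  have : 0 < Real.log T := by linarith
  have : 0 < T := by linarith
  have := Real.pi_pos
  positivity

lemma cw_nonneg (η : ℝ) {T : ℝ} (hT : 3 ≤ T) (p : ℝ × ℝ) : 0 ≤ cw η T p := by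
  have h1 := norm_pos hT
  have h2 := kk_nonneg (η * ((p.1 - p.2) * Real.log T) / (2 * π))
  unfold cw; positivity

lemma cw_swap (η T g h : ℝ) : cw η T (h, g) = cw η T (g, h) := by
  unfold cw
  simp only
  rw [← kk_neg, show (h - g)^2 = (g - h)^2 by ring, show -(η * ((h - g) * Real.log T) / (2 * π)) = η * ((g - h) * Real.log T) / (2 * π) by ring]
  ring

lemma xw_swap (T g h : ℝ) : xw T (h, g) = - xw T (g, h) := by unfold xw; ring

lemma kd_nonneg (η u : ℝ) : 0 ≤ kd η u := mul_nonneg (kk_nonneg _) (by linarith [kk_le_one u])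
lemma kd_le (η u : ℝ) : kd η u ≤ 1 - kk u := by
  unfold kd
  have h1 := kk_le_one (η * u)
  have h2 := kk_le_one u
  have h3 : 0 ≤ 1 - kk u := by linarith
  nlinarith
lemma kd_neg (η u : ℝ) : kd η (-u) = kd η u := by unfold kd; rw [mul_neg, kk_neg, kk_neg]
lemma kd_cont (η : ℝ) : Continuous (kd η) := by
  unfold kd; have := kk_cont; fun_prop
lemma kd_integrable {η : ℝ} (hη : 0 < η) : Integrable (kd η) := by
  refine (kkη_integrable hη).mono' (kd_cont η).aestronglyMeasurable (Eventually.of_forall fun u => ?_)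
  rw [Real.norm_of_nonneg (kd_nonneg _ _)]
  unfold kd
  nlinarith [kk_nonneg (η * u), kk_nonneg u]

lemma levy_window (hRH : RiemannHypothesis) (hSPC : SPC) {η : ℝ} (hη : 0 < η) {r : ℝ} (hr : 0 < r) :
    Tendsto (fun T => ∑ p ∈ zset T ×ˢ zset T, if |xw T p| ≤ r then cw η T p else 0) atTop (nhds (1 + ∫ u in Set.Icc (-r) r, kd η u)) := by
  refine tendsto_of_seq_tendsto fun v hv => ?_
  have hv3 : Tendsto (fun n => max (v n) 3) atTop atTop := tendsto_atTop_mono (fun n => le_max_left _ _) hv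
  have key := levy2 (fun n => zset (max (v n) 3) ×ˢ zset (max (v n) 3)) (fun n => cw η (max (v n) 3)) (fun n => xw (max (v n) 3))
    (fun n p => cw_nonneg η (le_max_right _ _) p) (kd η) (kd_nonneg η) (kd_integrable hη) (kd_neg η) ?_ ?_ hr
  · refine key.congr' ?_
    filter_upwards [hv.eventually_ge_atTop 3] with n hn
    simp only [Function.comp_apply, max_eq_left hn]
  · intro n ξ
    set T := max (v n) 3
    rw [Finset.sum_product]
    have h1 : ∑ g ∈ zset T, ∑ h ∈ zset T, cw η T (g, h) * Real.sin (ξ * xw T (g, h)) = - ∑ g ∈ zset T, ∑ h ∈ zset T, cw η T (g, h) * Real.sin (ξ * xw T (g, h)) := by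
      conv_lhs => rw [Finset.sum_comm]
      rw [← Finset.sum_neg_distrib]
      refine Finset.sum_congr rfl fun g _ => ?_
      rw [← Finset.sum_neg_distrib]
      refine Finset.sum_congr rfl fun h _ => ?_
      rw [cw_swap, xw_swap, mul_neg, Real.sin_neg, mul_neg]
    linarith
  · intro ξ
    have hG := (GT_lim' hRH hSPC hη (ξ / (2 * π))).comp hv3
    have hpi := Real.pi_pos
    have e1 : ∀ u, 2 * π * (ξ / (2 * π)) * u = ξ * u := fun u => by field_simp
    simp_rw [e1] at hG
    refine hG.congr fun n => ?_
    simp only [Function.comp_apply]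
    set T := max (v n) 3
    unfold GT
    rw [Finset.sum_product, Finset.mul_sum]
    refine Finset.sum_congr rfl fun g _ => ?_
    rw [Finset.mul_sum]
    refine Finset.sum_congr rfl fun h _ => ?_
    unfold cw xw
    simp only
    rw [show ξ * ((g - h) * Real.log T / (2 * π)) = (g - h) * Real.log T * (ξ / (2 * π)) by ring]
    ring

def DD (T : ℝ) : ℝ := (T / (2 * π) * Real.log T)⁻¹ * ∑ g ∈ zset T, (MM g : ℝ)^2

lemma diag_sum (η T : ℝ) : ∑ p ∈ zset T ×ˢ zset T, (if p.1 = p.2 then cw η T p else 0) = DD T := by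
  unfold DD
  rw [Finset.sum_product, Finset.mul_sum]
  refine Finset.sum_congr rfl fun g hg => ?_
  simp only
  rw [Finset.sum_ite_eq, if_pos hg]
  unfold cw
  simp [kk_zero]; left; ring

lemma DD_lim (hRH : RiemannHypothesis) (hSPC : SPC) : Tendsto DD atTop (nhds 1) := by
  refine tendsto_order.2 ⟨fun a ha => ?_, fun a ha => ?_⟩
  · filter_upwards [NT_lower hRH (e := (1 - a)/2) (by linarith), eventually_ge_atTop 3] with T h1 hT
    have h2 := norm_pos hT
    have : (T / (2 * π) * Real.log T)⁻¹ * NT T ≤ DD T := by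
      unfold DD NT
      gcongr with g _
      exact_mod_cast Nat.le_self_pow two_ne_zero _
    linarith
  · set r := (a - 1) / 4 with hr
    have hr0 : 0 < r := by rw [hr]; linarith
    have hw := levy_window hRH hSPC one_pos hr0
    have hle : ∫ u in Set.Icc (-r) r, kd 1 u ≤ 2 * r := by
      have : ∫ u in Set.Icc (-r) r, kd 1 u ≤ ∫ u in Set.Icc (-r) r, (1:ℝ) :=
        setIntegral_mono_on (kd_integrable one_pos).integrableOn (by simp) measurableSet_Icc fun u _ => (kd_le 1 u).trans (by linarith [kk_nonneg u])
      rw [setIntegral_const, Measure.real, Real.volume_Icc, ENNReal.toReal_ofReal (by linarith), smul_eq_mul] at this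
      linarith
    filter_upwards [hw.eventually (gt_mem_nhds (show _ < a by linarith)), eventually_ge_atTop 3] with T h1 hT
    refine lt_of_le_of_lt ?_ h1
    rw [← diag_sum 1 T]
    refine Finset.sum_le_sum fun p _ => ?_
    have := cw_nonneg 1 hT p
    by_cases hp : p.1 = p.2
    · have hx : |xw T p| ≤ r := by unfold xw; rw [hp]; simp; exact hr0.le
      rw [if_pos hp, if_pos hx]
    · rw [if_neg hp]; split_ifs <;> linarith

def PP2 (η T β : ℝ) : ℝ := ∑ g ∈ zset T, ∑ h ∈ zset T, if 0 < h - g ∧ h - g ≤ 2 * π * β / Real.log T then cw η T (g, h) else 0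

lemma split3 (η : ℝ) {T β : ℝ} (hT : 3 ≤ T) (hβ : 0 < β) :
    ∑ p ∈ zset T ×ˢ zset T, (if |xw T p| ≤ β then cw η T p else 0) = DD T + 2 * PP2 η T β := by
  have hL : 0 < Real.log T := by linarith [one_le_log hT]
  have hpi := Real.pi_pos
  have e : ∀ p : ℝ × ℝ, (if |xw T p| ≤ β then cw η T p else 0) = (if p.1 = p.2 then cw η T p else 0) +
      ((if 0 < p.2 - p.1 ∧ p.2 - p.1 ≤ 2 * π * β / Real.log T then cw η T p else 0) +
       (if 0 < p.1 - p.2 ∧ p.1 - p.2 ≤ 2 * π * β / Real.log T then cw η T p else 0)) := by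
    intro p
    have hx : |xw T p| ≤ β ↔ |p.1 - p.2| ≤ 2 * π * β / Real.log T := by
      unfold xw
      rw [abs_div, abs_mul, abs_of_pos hL, abs_of_pos (by positivity : 0 < 2 * π), div_le_iff₀ (by positivity), le_div_iff₀ hL, mul_comm β]
    have hB : 0 < 2 * π * β / Real.log T := by positivity
    simp only [hx]
    rcases lt_trichotomy p.1 p.2 with h | h | h
    · rw [abs_of_neg (by linarith), if_neg h.ne, if_neg (c := 0 < p.1 - p.2 ∧ _) (fun hh => by linarith [hh.1])]
      simp only [neg_sub, sub_pos, h, true_and, zero_add, add_zero]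
    · rw [h]; simp [hB.le]
    · rw [abs_of_pos (by linarith), if_neg h.ne', if_neg (c := 0 < p.2 - p.1 ∧ _) (fun hh => by linarith [hh.1])]
      simp only [sub_pos, h, true_and, zero_add]
  simp_rw [e]
  rw [Finset.sum_add_distrib, Finset.sum_add_distrib, diag_sum, Finset.sum_product, Finset.sum_product]
  have h3 : ∑ g ∈ zset T, ∑ h ∈ zset T, (if 0 < g - h ∧ g - h ≤ 2 * π * β / Real.log T then cw η T (g, h) else 0) = PP2 η T β := by
    unfold PP2
    rw [Finset.sum_comm]
    refine Finset.sum_congr rfl fun g _ => Finset.sum_congr rfl fun h _ => ?_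
    rw [cw_swap]
  simp only
  rw [h3]
  unfold PP2; ring

lemma even_int {η β : ℝ} (hβ : 0 < β) : ∫ u in Set.Icc (-β) β, kd η u = 2 * ∫ u in (0:ℝ)..β, kd η u := by
  rw [integral_Icc_eq_integral_Ioc, ← intervalIntegral.integral_of_le (by linarith),
    ← intervalIntegral.integral_add_adjacent_intervals (b := 0) ((kd_cont η).intervalIntegrable _ _) ((kd_cont η).intervalIntegrable _ _)]
  have := intervalIntegral.integral_comp_neg (a := 0) (b := β) (kd η)
  simp only [kd_neg, neg_zero] at this
  rw [← this]; ring

lemma PP2_lim (hRH : RiemannHypothesis) (hSPC : SPC) {η : ℝ} (hη : 0 < η) {β : ℝ} (hβ : 0 < β) :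
    Tendsto (fun T => PP2 η T β) atTop (nhds (∫ u in (0:ℝ)..β, kd η u)) := by
  have h := ((levy_window hRH hSPC hη hβ).sub (DD_lim hRH hSPC)).div_const 2
  rw [even_int hβ] at h
  have e : (1 + 2 * (∫ u in (0:ℝ)..β, kd η u) - 1) / 2 = ∫ u in (0:ℝ)..β, kd η u := by ring
  rw [e] at h
  refine h.congr' ?_
  filter_upwards [eventually_ge_atTop 3] with T hT
  rw [split3 η hT hβ]; ring

lemma Np_lower (hRH : RiemannHypothesis) (η : ℝ) {T : ℝ} (β : ℝ) (hT : 3 ≤ T) : PP2 η T β ≤ Npair T β := by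
  rw [Npair_eq hRH]
  unfold PP2
  rw [Finset.mul_sum]
  refine Finset.sum_le_sum fun g _ => ?_
  rw [Finset.mul_sum]
  refine Finset.sum_le_sum fun h _ => ?_
  split_ifs
  · unfold cw
    have := norm_pos hT
    refine mul_le_mul_of_nonneg_left ?_ this.le
    rw [mul_assoc]
    refine mul_le_of_le_one_right (by positivity) (mul_le_one₀ ?_ (kk_nonneg _) (kk_le_one _))
    rw [div_le_one (by positivity)]
    nlinarith [sq_nonneg (g - h)]
  · simp

lemma Np_upper (hRH : RiemannHypothesis) {η κ T β : ℝ} (hβ : 0 < β) (hT : 3 ≤ T)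
    (hκ : ∀ u, |u| ≤ β → κ ≤ kk (η * u)) :
    κ * (4 / (4 + (2 * π * β / Real.log T)^2)) * Npair T β ≤ PP2 η T β := by
  have hL : 0 < Real.log T := by linarith [one_le_log hT]
  have hpi := Real.pi_pos
  rw [Npair_eq hRH]
  unfold PP2
  rw [← mul_assoc, Finset.mul_sum]
  refine Finset.sum_le_sum fun g _ => ?_
  rw [Finset.mul_sum]
  refine Finset.sum_le_sum fun h _ => ?_
  split_ifs with hc
  · unfold cw
    simp only
    have h1 := norm_pos hT
    have h2 : κ ≤ kk (η * ((g - h) * Real.log T) / (2 * π)) := by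
      rw [mul_div_assoc]
      refine hκ _ ?_
      rw [abs_div, abs_mul, abs_of_pos hL, abs_of_pos (by positivity : 0 < 2 * π), div_le_iff₀ (by positivity), abs_sub_comm, abs_of_pos hc.1, mul_comm β]
      exact (le_div_iff₀ hL).1 hc.2
    have h3 : 4 / (4 + (2 * π * β / Real.log T)^2) ≤ 4 / (4 + (g - h)^2) := by
      rw [show (g - h)^2 = (h - g)^2 by ring]
      have := hc.1.le
      gcongr
      exact hc.2
    have h4 : κ * (4 / (4 + (2 * π * β / Real.log T)^2)) ≤ kk (η * ((g - h) * Real.log T) / (2 * π)) * (4 / (4 + (g - h)^2)) :=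
      mul_le_mul h2 h3 (by positivity) (kk_nonneg _)
    calc _ = (T / (2 * π) * Real.log T)⁻¹ * (MM g * MM h : ℝ) * (κ * (4 / (4 + (2 * π * β / Real.log T)^2))) := by ring
      _ ≤ (T / (2 * π) * Real.log T)⁻¹ * (MM g * MM h : ℝ) * (kk (η * ((g - h) * Real.log T) / (2 * π)) * (4 / (4 + (g - h)^2))) := by gcongr
      _ = _ := by ring
  · simp

lemma exists_eta {κ β : ℝ} (hκ : κ < 1) (hβ : 0 < β) : ∃ η, 0 < η ∧ ∀ u, |u| ≤ β → κ ≤ kk (η * u) := by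
  have h := kk_cont.continuousAt (x := 0)
  have h2 := h.eventually (lt_mem_nhds (show κ < kk 0 by rw [kk_zero]; exact hκ))
  obtain ⟨δ, hδ, hd⟩ := Metric.eventually_nhds_iff.1 h2
  refine ⟨δ / (2 * β), by positivity, fun u hu => (hd ?_).le⟩
  rw [Real.dist_eq, sub_zero, abs_mul, abs_of_pos (by positivity : 0 < δ / (2 * β))]
  calc δ / (2 * β) * |u| ≤ δ / (2 * β) * β := by gcongr
    _ = δ / 2 := by field_simp
    _ < δ := by linarith

lemma final (hRH : RiemannHypothesis) (hSPC : SPC) {β : ℝ} (hβ : 0 < β) :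
    Tendsto (fun T => Npair T β) atTop (nhds (∫ u in (0:ℝ)..β, (1 - kk u))) := by
  have hkc := kk_cont
  set Iv := ∫ u in (0:ℝ)..β, (1 - kk u) with hI
  have hI0 : 0 ≤ Iv := intervalIntegral.integral_nonneg hβ.le fun u _ => by linarith [kk_le_one u]
  have hup : ∀ η, ∫ u in (0:ℝ)..β, kd η u ≤ Iv := fun η =>
    intervalIntegral.integral_mono_on hβ.le ((kd_cont η).intervalIntegrable _ _) (by apply Continuous.intervalIntegrable; fun_prop) fun u _ => kd_le η u
  have hlo : ∀ η κ, (∀ u, |u| ≤ β → κ ≤ kk (η * u)) → κ * Iv ≤ ∫ u in (0:ℝ)..β, kd η u := by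
    intro η κ h
    rw [hI, ← intervalIntegral.integral_const_mul]
    refine intervalIntegral.integral_mono_on hβ.le (by apply Continuous.intervalIntegrable; fun_prop) ((kd_cont η).intervalIntegrable _ _) fun u hu => ?_
    unfold kd
    have h1 := h u (by rw [abs_of_nonneg hu.1]; exact hu.2)
    have h2 : 0 ≤ 1 - kk u := by linarith [kk_le_one u]
    gcongr
  have hkap : ∀ e, 0 < e → ∃ κ, 0 < κ ∧ κ < 1 ∧ Iv - e < κ * Iv ∧ Iv / κ < Iv + e := by
    intro e he
    have hp : 0 < 2 * (Iv + e) := by positivity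
    have hq : e / (2 * (Iv + e)) ≤ 1/2 := by rw [div_le_iff₀ hp]; linarith
    have hq0 : 0 < e / (2 * (Iv + e)) := by positivity
    have hq1 : e / (2 * (Iv + e)) * (Iv + e) = e / 2 := by field_simp
    refine ⟨1 - e / (2 * (Iv + e)), by linarith, by linarith, ?_, ?_⟩
    · nlinarith
    · rw [div_lt_iff₀ (by linarith)]; nlinarith
  refine tendsto_order.2 ⟨fun a ha => ?_, fun a ha => ?_⟩
  · obtain ⟨κ, h0, h1, h2, -⟩ := hkap (Iv - a) (by linarith)
    obtain ⟨η, hη, hk⟩ := exists_eta h1 hβ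
    have hl := PP2_lim hRH hSPC hη hβ
    filter_upwards [hl.eventually (lt_mem_nhds (show a < _ by linarith [hlo η κ hk])), eventually_ge_atTop 3] with T h3 hT
    exact h3.trans_le (Np_lower hRH η β hT)
  · obtain ⟨κ, h0, h1, -, h2⟩ := hkap (a - Iv) (by linarith)
    obtain ⟨η, hη, hk⟩ := exists_eta h1 hβ
    have hl := PP2_lim hRH hSPC hη hβ
    have hw : Tendsto (fun T => κ * (4 / (4 + (2 * π * β / Real.log T)^2))) atTop (nhds (κ * (4 / (4 + 0^2)))) := by
      refine Tendsto.const_mul _ (Tendsto.div tendsto_const_nhds (Tendsto.const_add _ (Tendsto.pow ?_ 2)) (by norm_num))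
      exact Real.tendsto_log_atTop.const_div_atTop _
    have hd := hl.div hw (by positivity)
    have hlt : (∫ u in (0:ℝ)..β, kd η u) / (κ * (4 / (4 + 0^2))) < a := by
      calc _ = (∫ u in (0:ℝ)..β, kd η u) / κ := by norm_num
        _ ≤ Iv / κ := by gcongr; exact hup η
        _ < a := by linarith
    filter_upwards [hd.eventually (gt_mem_nhds hlt), eventually_ge_atTop 3] with T h3 hT
    refine lt_of_le_of_lt ?_ h3
    simp only [Pi.div_apply]
    rw [le_div_iff₀ (by positivity), mul_comm]
    exact Np_upper hRH hβ hT hk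

end PC

/-- Assuming RH and the Strong Pair Correlation Conjecture, the Pair Correlation
Conjecture holds: for each fixed `β > 0`,
`N(T,β) → ∫₀^β (1 - (sin πu / πu)²) du` as `T → ∞`. -/
theorem SPC_implies_PCC (hRH : RiemannHypothesis) (hSPC : SPC) :
    ∀ β : ℝ, 0 < β →
      Filter.Tendsto (fun T => Npair T β) Filter.atTop
        (nhds (∫ u in (0 : ℝ)..β, (1 - (Real.sin (π * u) / (π * u)) ^ 2))) := by
  intro β hβ
  have h := PC.final hRH hSPC hβ
  have e : ∫ u in (0:ℝ)..β, (1 - PC.kk u) = ∫ u in (0:ℝ)..β, (1 - (Real.sin (π * u) / (π * u)) ^ 2) := by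
    rw [intervalIntegral.integral_of_le hβ.le, intervalIntegral.integral_of_le hβ.le]
    refine setIntegral_congr_fun measurableSet_Ioc fun u hu => ?_
    have hu0 : π * u ≠ 0 := (mul_pos Real.pi_pos hu.1).ne'
    simp only [PC.kk]
    rw [Real.sinc_of_ne_zero hu0]
  rw [e] at h
  exact h
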